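/- Let n ∈ {2,3}, let B = B₁(0) ⊆ ℝⁿ, and let θ ∈ [0,1). Then there exist c > 0 and ε₀ > 0 such that for every ε ∈ (0, ε₀) and every u ∈ C²(closure(B)) with |u(0)| ≤ θ one has 𝒲_ε(u) + S_ε(u) ≥ c, where the energies are taken over B. Equivalently, liminf_{ε→0} inf{ (𝒲_ε + S_ε)(u) : u ∈ C²(closure(B)), |u(0)| ≤ θ } > 0. -/

import Mathlib

open MeasureTheory Filter Metric Set

noncomputable section

abbrev E (n : ℕ) : Type := EuclideanSpace ℝ (Fin n)

def W (t : ℝ) : ℝ := (t ^ 2 - 1) ^ 2 / 4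

def W' (t : ℝ) : ℝ := t ^ 3 - t

def c0 : ℝ := 2 * Real.sqrt 2 / 3

def lap {n : ℕ} (u : E n → ℝ) (x : E n) : ℝ :=
  ∑ i, (fderiv ℝ (fderiv ℝ u) x) (EuclideanSpace.single i 1) (EuclideanSpace.single i 1)

def areaDensity {n : ℕ} (ev : ℝ) (u : E n → ℝ) (x : E n) : ℝ :=
  ev / 2 * ‖fderiv ℝ u x‖ ^ 2 + (1 / ev) * W (u x)

def willDensity {n : ℕ} (ev : ℝ) (u : E n → ℝ) (x : E n) : ℝ :=
  (ev * lap u x - (1 / ev) * W' (u x)) ^ 2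

def Se {n : ℕ} (ev : ℝ) (Ω : Set (E n)) (u : E n → ℝ) : ℝ :=
  (1 / c0) * ∫ x in Ω, areaDensity ev u x

def We {n : ℕ} (ev : ℝ) (Ω : Set (E n)) (u : E n → ℝ) : ℝ :=
  (1 / (c0 * ev)) * ∫ x in Ω, willDensity ev u x

def mue {n : ℕ} (ev : ℝ) (Ω : Set (E n)) (u : E n → ℝ) (U : Set (E n)) : ℝ :=
  (1 / c0) * ∫ x in U ∩ Ω, areaDensity ev u x

def ale {n : ℕ} (ev : ℝ) (Ω : Set (E n)) (u : E n → ℝ) (U : Set (E n)) : ℝ :=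
  (1 / (c0 * ev)) * ∫ x in U ∩ Ω, willDensity ev u x

def xiPlus {n : ℕ} (ev : ℝ) (Ω : Set (E n)) (u : E n → ℝ) (U : Set (E n)) : ℝ :=
  ∫ x in U ∩ Ω, max (ev / 2 * ‖fderiv ℝ u x‖ ^ 2 - (1 / ev) * W (u x)) 0

def sptM {n : ℕ} (μ : Measure (E n)) : Set (E n) :=
  {x | ∀ r > 0, 0 < μ (ball x r)}

def weakConvA {n : ℕ} (Ω : Set (E n)) (ε : ℕ → ℝ) (u : ℕ → E n → ℝ)
    (μ : Measure (E n)) : Prop :=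
  ∀ φ : BoundedContinuousFunction (E n) ℝ,
    Tendsto (fun k => (1 / c0) * ∫ x in Ω, φ x * areaDensity (ε k) (u k) x) atTop
      (nhds (∫ x, φ x ∂μ))

def weakConvW {n : ℕ} (Ω : Set (E n)) (ε : ℕ → ℝ) (u : ℕ → E n → ℝ)
    (α : Measure (E n)) : Prop :=
  ∀ φ : BoundedContinuousFunction (E n) ℝ,
    Tendsto (fun k => (1 / (c0 * ε k)) * ∫ x in Ω, φ x * willDensity (ε k) (u k) x) atTop
      (nhds (∫ x, φ x ∂α))

/-- The partial derivative in the `i`-th coordinate direction. -/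
def pd {n : ℕ} (i : Fin n) (u : E n → ℝ) (x : E n) : ℝ :=
  fderiv ℝ u x (EuclideanSpace.single i 1)

section PartialDerivatives

variable {n : ℕ} {i j : Fin n} {u v : E n → ℝ} {x : E n}

lemma norm_fderiv_sq (u : E n → ℝ) (x : E n) :
    ‖fderiv ℝ u x‖ ^ 2 = ∑ i, pd i u x ^ 2 := by
  have h := (InnerProductSpace.toDual ℝ (E n)).symm.norm_map (fderiv ℝ u x)
  rw [← h, EuclideanSpace.real_norm_sq_eq]
  refine Finset.sum_congr rfl fun i _ => ?_
  congr 1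
  have := InnerProductSpace.toDual_symm_apply (𝕜 := ℝ) (y := fderiv ℝ u x)
    (x := EuclideanSpace.single i (1 : ℝ))
  rw [pd, ← this, EuclideanSpace.inner_single_right]
  simp

lemma ContDiff.pd {k m : WithTop ℕ∞} (hu : ContDiff ℝ k u) (hk : m + 1 ≤ k) (i : Fin n) :
    ContDiff ℝ m (pd i u) :=
  (hu.fderiv_right hk).clm_apply contDiff_const

lemma HasCompactSupport.pd (hu : HasCompactSupport u) (i : Fin n) :
    HasCompactSupport (pd i u) :=
  hu.fderiv_apply (𝕜 := ℝ) _

lemma pd_mul (hu : DifferentiableAt ℝ u x) (hv : DifferentiableAt ℝ v x) :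
    pd i (fun y => u y * v y) x = pd i u x * v x + u x * pd i v x := by
  simp only [pd, fderiv_fun_mul hu hv]
  simp [mul_comm, add_comm]

lemma pd_add (hu : DifferentiableAt ℝ u x) (hv : DifferentiableAt ℝ v x) :
    pd i (fun y => u y + v y) x = pd i u x + pd i v x := by
  simp [pd, fderiv_fun_add hu hv]

lemma pd_sub (hu : DifferentiableAt ℝ u x) (hv : DifferentiableAt ℝ v x) :
    pd i (fun y => u y - v y) x = pd i u x - pd i v x := by
  simp [pd, fderiv_fun_sub hu hv]

lemma pd_sum {ι : Type*} {s : Finset ι} {f : ι → E n → ℝ}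
    (hf : ∀ k ∈ s, DifferentiableAt ℝ (f k) x) :
    pd i (fun y => ∑ k ∈ s, f k y) x = ∑ k ∈ s, pd i (f k) x := by
  simp [pd, fderiv_fun_sum hf]

lemma pd_comp {g : ℝ → ℝ} {g' : ℝ} (hg : HasDerivAt g g' (u x)) (hu : DifferentiableAt ℝ u x) :
    pd i (fun y => g (u y)) x = g' * pd i u x := by
  have := (hg.comp_hasFDerivAt x hu.hasFDerivAt).fderiv
  simp only [pd]
  rw [show (fun y => g (u y)) = g ∘ u from rfl, this]
  simp

lemma pd_coord (i j : Fin n) (x : E n) :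
    pd i (fun y : E n => y j) x = if i = j then 1 else 0 := by
  have : fderiv ℝ (fun y : E n => y j) x = EuclideanSpace.proj j :=
    (EuclideanSpace.proj (𝕜 := ℝ) j : E n →L[ℝ] ℝ).fderiv
  rw [pd, this]
  simp [eq_comm]

lemma pd_pd (hu : ContDiff ℝ 2 u) (i j : Fin n) (x : E n) :
    pd i (pd j u) x = fderiv ℝ (fderiv ℝ u) x (EuclideanSpace.single i 1)
      (EuclideanSpace.single j 1) := by
  have h : DifferentiableAt ℝ (fderiv ℝ u) x :=
    (hu.fderiv_right (m := 1) (by norm_num)).differentiable (by norm_num) x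
  have : pd j u = fun y => fderiv ℝ u y (EuclideanSpace.single j 1) := rfl
  rw [this, pd, fderiv_clm_apply h (differentiableAt_const _)]
  simp

lemma pd_comm (hu : ContDiff ℝ 2 u) (i j : Fin n) (x : E n) :
    pd i (pd j u) x = pd j (pd i u) x := by
  rw [pd_pd hu, pd_pd hu]
  exact (hu.contDiffAt.isSymmSndFDerivAt (by simp)).eq _ _

lemma lap_eq_sum_pd (hu : ContDiff ℝ 2 u) (x : E n) : lap u x = ∑ i, pd i (pd i u) x := by
  simp [lap, pd_pd hu]

lemma integral_mul_pd (hu : ContDiff ℝ 1 u) (hv : ContDiff ℝ 1 v) (hc : HasCompactSupport v)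
    (i : Fin n) : ∫ x, u x * pd i v x = - ∫ x, pd i u x * v x := by
  have hu' := hu.pd (m := 0) (by norm_num) i
  have hv' := hv.pd (m := 0) (by norm_num) i
  have h1 : Integrable (fun x => u x * pd i v x) :=
    (hu.continuous.mul hv'.continuous).integrable_of_hasCompactSupport (hc.pd i).mul_left
  have h2 : Integrable (fun x => pd i u x * v x) :=
    (hu'.continuous.mul hv.continuous).integrable_of_hasCompactSupport hc.mul_left
  have h3 : Integrable (fun x => u x * v x) :=
    (hu.continuous.mul hv.continuous).integrable_of_hasCompactSupport hc.mul_left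
  exact integral_mul_fderiv_eq_neg_fderiv_mul_of_integrable h2 h1 h3
    (fun x _ => hu.differentiable (by norm_num) x) (fun x _ => hv.differentiable (by norm_num) x)

lemma integral_pd_eq_zero (hu : ContDiff ℝ 1 u) (hc : HasCompactSupport u) (i : Fin n) :
    ∫ x, pd i u x = 0 := by
  simpa [pd] using integral_mul_pd (u := fun _ => 1) contDiff_const hu hc i

lemma hasDerivAt_integral_mul_translate (hu : Continuous u) (huc : HasCompactSupport u)
    (hv : ContDiff ℝ 1 v) (hc : HasCompactSupport v) (w : E n) :
    HasDerivAt (fun t : ℝ => ∫ x, u x * v (x + t • w)) (∫ x, u x * fderiv ℝ v x w) 0 := by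
  have hv' : Continuous (fderiv ℝ v) := hv.continuous_fderiv (by norm_num)
  obtain ⟨C, hC⟩ := (hv'.norm).bounded_above_of_compact_support (by
    simpa using (hc.fderiv (𝕜 := ℝ)).norm)
  have key := hasDerivAt_integral_of_dominated_loc_of_deriv_le
    (μ := (volume : Measure (E n))) (F := fun (t : ℝ) x => u x * v (x + t • w))
    (F' := fun (t : ℝ) x => u x * fderiv ℝ v (x + t • w) w) (x₀ := 0) (s := univ)
    (bound := fun x => |u x| * (C * ‖w‖)) univ_mem
    (Eventually.of_forall fun t =>
      (hu.mul (hv.continuous.comp (by fun_prop))).aestronglyMeasurable)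
    (by
      have : Continuous fun x => u x * v (x + (0 : ℝ) • w) :=
        hu.mul (hv.continuous.comp (by fun_prop))
      exact this.integrable_of_hasCompactSupport huc.mul_right)
    (by
      have : Continuous fun x => u x * fderiv ℝ v (x + (0 : ℝ) • w) w :=
        hu.mul ((hv'.comp (by fun_prop)).clm_apply continuous_const)
      exact this.aestronglyMeasurable)
    (Eventually.of_forall fun x t _ => by
      rw [norm_mul, Real.norm_eq_abs]
      gcongr
      refine (ContinuousLinearMap.le_opNorm _ _).trans ?_
      gcongr
      simpa using hC (x + t • w))
    (((hu.abs).mul continuous_const).integrable_of_hasCompactSupport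
      ((huc.norm : HasCompactSupport fun x => ‖u x‖).mul_right))
    (Eventually.of_forall fun x t _ => by
      have h1 : HasDerivAt (fun t : ℝ => x + t • w) w t := by
        simpa using ((hasDerivAt_id t).smul_const w).const_add x
      exact ((hv.differentiable (by norm_num) _).hasFDerivAt.comp_hasDerivAt t h1).const_mul _)
  simpa using key.2

/-- Mixed partial derivatives may be exchanged between two factors under the integral. -/
lemma integral_pd_mul_pd_comm (hu : ContDiff ℝ 1 u) (huc : HasCompactSupport u)
    (hv : ContDiff ℝ 1 v) (hc : HasCompactSupport v) (i j : Fin n) :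
    ∫ x, pd i u x * pd j v x = ∫ x, pd j u x * pd i v x := by
  have hu' := (hu.pd (m := 0) (by norm_num) i).continuous
  have hv' := (hv.pd (m := 0) (by norm_num) i).continuous
  have hA := hasDerivAt_integral_mul_translate hu' (huc.pd i) hv hc (EuclideanSpace.single j 1)
  have hB := (hasDerivAt_integral_mul_translate hv' (hc.pd i) hu huc
    (-EuclideanSpace.single j 1)).neg
  have heq : (fun t : ℝ => ∫ x, pd i u x * v (x + t • EuclideanSpace.single j 1)) =
      - fun t : ℝ => ∫ x, pd i v x * u (x + t • -EuclideanSpace.single j 1) := by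
    funext t
    have hvt : ContDiff ℝ 1 fun x => v (x + t • EuclideanSpace.single j 1) :=
      hv.comp (by fun_prop)
    have h1 := integral_mul_pd hvt hu huc i
    have hpd : ∀ x, pd i (fun x => v (x + t • EuclideanSpace.single j 1)) x =
        pd i v (x + t • EuclideanSpace.single j 1) := fun x => by
      simp only [pd, fderiv_comp_add_right]
    simp only [hpd] at h1
    simp only [Pi.neg_apply]
    rw [← integral_add_right_eq_self (fun x => pd i v x * u (x + t • -EuclideanSpace.single j 1))
      (t • EuclideanSpace.single j 1)]
    simp only [smul_neg, add_neg_cancel_right]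
    rw [← h1]
    exact integral_congr_ae (Eventually.of_forall fun x => mul_comm _ _)
  rw [heq] at hA
  have := hA.unique hB
  simp only [map_neg, mul_neg, integral_neg, neg_neg] at this
  change ∫ x, pd i u x * pd j v x = ∫ x, pd i v x * pd j u x at this
  rw [this]
  exact integral_congr_ae (Eventually.of_forall fun x => mul_comm _ _)

end PartialDerivatives

/-- The squared norm of the gradient. -/
def gsq {n : ℕ} (u : E n → ℝ) (x : E n) : ℝ := ∑ i, pd i u x ^ 2

/-- The inner product of two gradients. -/
def gdot {n : ℕ} (u v : E n → ℝ) (x : E n) : ℝ := ∑ i, pd i u x * pd i v x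

/-- The first variation of the Allen–Cahn energy at unit scale. -/
def chem {n : ℕ} (u : E n → ℝ) (x : E n) : ℝ := W' (u x) - lap u x

/-- The Allen–Cahn energy density at unit scale. -/
def en {n : ℕ} (u : E n → ℝ) (x : E n) : ℝ := gsq u x / 2 + W (u x)

/-- The discrepancy density at unit scale. -/
def disc {n : ℕ} (u : E n → ℝ) (x : E n) : ℝ := gsq u x / 2 - W (u x)

/-- The squared norm of the Hessian. -/
def hsq {n : ℕ} (u : E n → ℝ) (x : E n) : ℝ := ∑ i, ∑ j, pd i (pd j u) x ^ 2

lemma W_nonneg (t : ℝ) : 0 ≤ W t := by unfold W; positivity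

lemma hasDerivAt_W (t : ℝ) : HasDerivAt W (W' t) t := by
  have := (((hasDerivAt_pow 2 t).sub_const 1).pow 2).div_const 4
  convert! this using 1
  simp [W']; ring

lemma contDiff_W {k : WithTop ℕ∞} : ContDiff ℝ k W := by unfold W; fun_prop

lemma contDiff_W' {k : WithTop ℕ∞} : ContDiff ℝ k W' := by unfold W'; fun_prop

section Identities

variable {n : ℕ} {u v : E n → ℝ}

lemma gsq_nonneg (u : E n → ℝ) (x : E n) : 0 ≤ gsq u x :=
  Finset.sum_nonneg fun _ _ => sq_nonneg _

lemma en_nonneg (u : E n → ℝ) (x : E n) : 0 ≤ en u x := by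
  have := gsq_nonneg u x
  have := W_nonneg (u x)
  unfold en; positivity

lemma contDiff_gsq (hu : ContDiff ℝ 2 u) : ContDiff ℝ 1 (gsq u) := by
  unfold gsq
  exact ContDiff.sum fun i _ => (hu.pd (by norm_num) i).pow 2

lemma contDiff_en (hu : ContDiff ℝ 2 u) : ContDiff ℝ 1 (en u) := by
  unfold en
  exact ((contDiff_gsq hu).div_const 2).add (contDiff_W.comp (hu.of_le (by norm_num)))

lemma contDiff_disc (hu : ContDiff ℝ 2 u) : ContDiff ℝ 1 (disc u) := by
  unfold disc
  exact ((contDiff_gsq hu).div_const 2).sub (contDiff_W.comp (hu.of_le (by norm_num)))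

lemma continuous_gdot (hu : ContDiff ℝ 1 u) (hv : ContDiff ℝ 1 v) : Continuous (gdot u v) := by
  unfold gdot
  exact continuous_finsetSum _ fun i _ =>
    (hu.pd (m := 0) (by norm_num) i).continuous.mul (hv.pd (m := 0) (by norm_num) i).continuous

lemma continuous_gsq (hu : ContDiff ℝ 1 u) : Continuous (gsq u) := by
  unfold gsq
  exact continuous_finsetSum _ fun i _ => (hu.pd (m := 0) (by norm_num) i).continuous.pow 2

lemma continuous_lap (hu : ContDiff ℝ 2 u) : Continuous (lap u) := by
  have : lap u = fun x => ∑ i, pd i (pd i u) x := funext (lap_eq_sum_pd hu)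
  rw [this]
  exact continuous_finsetSum _ fun i _ =>
    ((hu.pd (m := 1) (by norm_num) i).pd (m := 0) (by norm_num) i).continuous

lemma continuous_chem (hu : ContDiff ℝ 2 u) : Continuous (chem u) := by
  unfold chem
  exact (contDiff_W' (k := 0).continuous.comp hu.continuous).sub (continuous_lap hu)

lemma continuous_hsq (hu : ContDiff ℝ 2 u) : Continuous (hsq u) := by
  unfold hsq
  exact continuous_finsetSum _ fun i _ => continuous_finsetSum _ fun j _ =>
    ((hu.pd (m := 1) (by norm_num) j).pd (m := 0) (by norm_num) i).continuous.pow 2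

lemma gdot_sq_le (u v : E n → ℝ) (x : E n) : gdot u v x ^ 2 ≤ gsq u x * gsq v x :=
  Finset.sum_mul_sq_le_sq_mul_sq _ _ _

lemma pd_gsq (hu : ContDiff ℝ 2 u) (i : Fin n) (x : E n) :
    pd i (gsq u) x = 2 * ∑ j, pd i (pd j u) x * pd j u x := by
  have hd : ∀ j, DifferentiableAt ℝ (pd j u) x := fun j =>
    (hu.pd (m := 1) (by norm_num) j).differentiable (by norm_num) x
  unfold gsq
  rw [pd_sum fun j _ => (hd j).fun_pow 2, Finset.mul_sum]
  refine Finset.sum_congr rfl fun j _ => ?_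
  rw [pd_comp (g := fun t => t ^ 2) (hasDerivAt_pow 2 _) (hd j)]
  push_cast; ring

lemma pd_half_gsq_add {g : ℝ → ℝ} {g' : ℝ} (hu : ContDiff ℝ 2 u) (i : Fin n) (x : E n)
    (hg : HasDerivAt g g' (u x)) :
    pd i (fun y => gsq u y / 2 + g (u y)) x =
      ∑ j, pd i (pd j u) x * pd j u x + g' * pd i u x := by
  have h1 : DifferentiableAt ℝ (gsq u) x := (contDiff_gsq hu).differentiable (by norm_num) x
  have h2 : DifferentiableAt ℝ u x := hu.differentiable (by norm_num) x
  have h3 : DifferentiableAt ℝ (fun y => g (u y)) x := hg.differentiableAt.comp x h2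
  have h1' : DifferentiableAt ℝ (fun y => gsq u y / 2) x := by
    simpa only [div_eq_mul_inv] using h1.mul_const (2 : ℝ)⁻¹
  rw [pd_add h1' h3, pd_comp hg h2,
    pd_comp (g := fun t => t / 2) ((hasDerivAt_id _).div_const 2) h1, pd_gsq hu]
  ring

lemma pd_en (hu : ContDiff ℝ 2 u) (i : Fin n) (x : E n) :
    pd i (en u) x = ∑ j, pd i (pd j u) x * pd j u x + W' (u x) * pd i u x :=
  pd_half_gsq_add hu i x (hasDerivAt_W _)

lemma pd_disc (hu : ContDiff ℝ 2 u) (i : Fin n) (x : E n) :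
    pd i (disc u) x = ∑ j, pd i (pd j u) x * pd j u x - W' (u x) * pd i u x := by
  have := pd_half_gsq_add (g := fun t => - W t) hu i x (hasDerivAt_W _).neg
  simp only [← sub_eq_add_neg, neg_mul] at this
  exact this

lemma integral_sum_pd_eq_zero {X : Fin n → E n → ℝ} (hX : ∀ i, ContDiff ℝ 1 (X i))
    (hc : ∀ i, HasCompactSupport (X i)) : ∫ x, ∑ i, pd i (X i) x = 0 := by
  rw [integral_finsetSum _ fun i _ =>
    ((hX i).pd (m := 0) (by norm_num) i).continuous.integrable_of_hasCompactSupport ((hc i).pd i)]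
  exact Finset.sum_eq_zero fun i _ => integral_pd_eq_zero (hX i) (hc i) i

/-- Weak form of the Laplacian. -/
lemma integral_lap_mul_add_gdot (hu : ContDiff ℝ 2 u) {ψ : E n → ℝ} (hψ : ContDiff ℝ 1 ψ)
    (hc : HasCompactSupport ψ) : ∫ x, (lap u x * ψ x + gdot u ψ x) = 0 := by
  rw [← integral_sum_pd_eq_zero (X := fun i x => pd i u x * ψ x)
    (fun i => (hu.pd (by norm_num) i).mul hψ) (fun i => hc.mul_left)]
  congr 1; funext x
  rw [lap_eq_sum_pd hu, gdot, Finset.sum_mul, ← Finset.sum_add_distrib]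
  refine Finset.sum_congr rfl fun i _ => ?_
  rw [pd_mul ((hu.pd (m := 1) (by norm_num) i).differentiable (by norm_num) x)
    (hψ.differentiable (by norm_num) x)]

/-- Testing the Laplacian against `h(u) η²`. -/
lemma integral_test_comp (hu : ContDiff ℝ 2 u) {h h' : ℝ → ℝ} (hh : ∀ t, HasDerivAt h (h' t) t)
    (hh' : Continuous h') {η : E n → ℝ} (hη : ContDiff ℝ 1 η) (hc : HasCompactSupport η) :
    ∫ x, (lap u x * h (u x) * η x ^ 2 + h' (u x) * gsq u x * η x ^ 2
      + 2 * h (u x) * η x * gdot u η x) = 0 := by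
  have hh1 : ContDiff ℝ 1 h := by
    rw [contDiff_one_iff_deriv]
    refine ⟨fun t => (hh t).differentiableAt, ?_⟩
    rwa [show deriv h = h' from funext fun t => (hh t).deriv]
  have hhu : ContDiff ℝ 1 fun x => h (u x) := hh1.comp (hu.of_le (by norm_num))
  rw [← integral_lap_mul_add_gdot hu (ψ := fun x => h (u x) * η x ^ 2) (hhu.mul (hη.pow 2))
    (HasCompactSupport.mul_left (hc.comp_left (g := fun t : ℝ => t ^ 2) (by norm_num)))]
  congr 1; funext x
  have hd : DifferentiableAt ℝ η x := hη.differentiable (by norm_num) x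
  have : gdot u (fun x => h (u x) * η x ^ 2) x =
      h' (u x) * gsq u x * η x ^ 2 + 2 * h (u x) * η x * gdot u η x := by
    simp only [gdot, gsq, Finset.mul_sum, Finset.sum_mul, ← Finset.sum_add_distrib]
    refine Finset.sum_congr rfl fun i _ => ?_
    rw [pd_mul (hhu.differentiable (by norm_num) x) (hd.fun_pow 2),
      pd_comp (hh _) (hu.differentiable (by norm_num) x),
      pd_comp (g := fun t => t ^ 2) (hasDerivAt_pow 2 _) hd]
    push_cast; ring
  rw [this]; ring

/-- Weak form of the Bochner identity. -/
lemma integral_hsq_sub_lap_sq (hu : ContDiff ℝ 2 u) (huc : HasCompactSupport u) {ψ : E n → ℝ}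
    (hψ : ContDiff ℝ 1 ψ) (hc : HasCompactSupport ψ) :
    ∫ x, ((hsq u x - lap u x ^ 2) * ψ x
      + ∑ i, (∑ j, pd i (pd j u) x * pd j u x - lap u x * pd i u x) * pd i ψ x) = 0 := by
  have hp : ∀ i, ContDiff ℝ 1 (pd i u) := fun i => hu.pd (by norm_num) i
  have hpc : ∀ i, HasCompactSupport (pd i u) := fun i => huc.pd i
  have hq : ∀ i, ContDiff ℝ 1 fun x => pd i u x * ψ x := fun i => (hp i).mul hψ
  have hqc : ∀ i, HasCompactSupport fun x => pd i u x * ψ x := fun i => hc.mul_left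
  have hint : ∀ (i j k l : Fin n), Integrable fun x =>
      pd i (pd j u) x * pd k (fun x => pd l u x * ψ x) x := fun i j k l =>
    (((hp j).pd (m := 0) (by norm_num) i).continuous.mul
      ((hq l).pd (m := 0) (by norm_num) k).continuous).integrable_of_hasCompactSupport
      ((hqc l).pd k).mul_left
  have key : ∑ i, ∑ j, ∫ x, pd i (pd j u) x * pd i (fun x => pd j u x * ψ x) x
      = ∑ i, ∑ j, ∫ x, pd j (pd j u) x * pd i (fun x => pd i u x * ψ x) x := by
    rw [Finset.sum_comm]
    refine Finset.sum_congr rfl fun i _ => Finset.sum_congr rfl fun j _ => ?_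
    rw [integral_pd_mul_pd_comm (hp j) (hpc j) (hq i) (hqc i) j i]
    simp only [pd_comm hu i j]
  have key' : ∫ x, ∑ i, ∑ j, (pd i (pd j u) x * pd i (fun x => pd j u x * ψ x) x
      - pd j (pd j u) x * pd i (fun x => pd i u x * ψ x) x) = 0 := by
    have hsub : ∀ i j, Integrable fun x => pd i (pd j u) x * pd i (fun x => pd j u x * ψ x) x
        - pd j (pd j u) x * pd i (fun x => pd i u x * ψ x) x := fun i j =>
      (hint i j i j).sub (hint j j i i)
    rw [integral_finsetSum _ fun i _ => integrable_finsetSum _ fun j _ => hsub i j]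
    simp_rw [integral_finsetSum _ fun j _ => hsub _ j,
      integral_sub (hint _ _ _ _) (hint _ _ _ _), Finset.sum_sub_distrib]
    rw [key, sub_self]
  rw [← key']
  congr 1; funext x
  have hd : ∀ i, DifferentiableAt ℝ (pd i u) x := fun i => (hp i).differentiable (by norm_num) x
  have hdψ : DifferentiableAt ℝ ψ x := hψ.differentiable (by norm_num) x
  simp only [pd_mul (hd _) hdψ, lap_eq_sum_pd hu, hsq]
  have e1 : (∑ i, pd i (pd i u) x) ^ 2 = ∑ i, ∑ j, pd j (pd j u) x * pd i (pd i u) x := by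
    rw [pow_two, Finset.sum_mul_sum]
    exact Finset.sum_congr rfl fun i _ => Finset.sum_congr rfl fun j _ => mul_comm _ _
  rw [e1]
  simp only [sub_mul, Finset.sum_mul, ← Finset.sum_sub_distrib, ← Finset.sum_add_distrib]
  refine Finset.sum_congr rfl fun i _ => Finset.sum_congr rfl fun j _ => ?_
  ring

/-- The Pohozaev identity for the vector field `g(x) x`. -/
lemma integral_pohozaev (hu : ContDiff ℝ 2 u) {g : E n → ℝ} (hg : ContDiff ℝ 1 g)
    (hc : HasCompactSupport g) :
    ∫ x, (chem u x * (∑ i, x i * pd i u x) * g x + en u x * (n * g x + ∑ i, x i * pd i g x)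
      - gsq u x * g x - (∑ i, x i * pd i u x) * gdot u g x) = 0 := by
  have hp : ∀ i, ContDiff ℝ 1 (pd i u) := fun i => hu.pd (by norm_num) i
  have hx : ∀ i : Fin n, ContDiff ℝ 1 fun x : E n => x i := fun i => by fun_prop
  have hS : ContDiff ℝ 1 fun x => ∑ k, x k * pd k u x := ContDiff.sum fun k _ => (hx k).mul (hp k)
  rw [← integral_sum_pd_eq_zero (X := fun i x =>
      (en u x * x i - (∑ k, x k * pd k u x) * pd i u x) * g x)
    (fun i => (((contDiff_en hu).mul (hx i)).sub (hS.mul (hp i))).mul hg) (fun i => hc.mul_left)]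
  congr 1; funext x
  have hpd : ∀ i, DifferentiableAt ℝ (pd i u) x := fun i => (hp i).differentiable (by norm_num) x
  have hxd : ∀ i : Fin n, DifferentiableAt ℝ (fun x : E n => x i) x := fun i =>
    (hx i).differentiable (by norm_num) x
  have hSd := hS.differentiable (by norm_num) x
  have hed := (contDiff_en hu).differentiable (by norm_num) x
  have hgd := hg.differentiable (by norm_num) x
  have hpS : ∀ i, pd i (fun x => ∑ k, x k * pd k u x) x =
      pd i u x + ∑ k, x k * pd i (pd k u) x := fun i => by
    rw [pd_sum fun k _ => (hxd k).fun_mul (hpd k)]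
    simp only [pd_mul (hxd _) (hpd _), pd_coord, Finset.sum_add_distrib]
    simp
  have hterm : ∀ i, pd i (fun x => (en u x * x i - (∑ k, x k * pd k u x) * pd i u x) * g x) x =
      ((∑ j, pd i (pd j u) x * pd j u x + W' (u x) * pd i u x) * x i + en u x
        - ((pd i u x + ∑ k, x k * pd i (pd k u) x) * pd i u x
          + (∑ k, x k * pd k u x) * pd i (pd i u) x)) * g x
      + (en u x * x i - (∑ k, x k * pd k u x) * pd i u x) * pd i g x := fun i => by
    rw [pd_mul ((hed.fun_mul (hxd i)).fun_sub (hSd.fun_mul (hpd i))) hgd,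
      pd_sub (hed.fun_mul (hxd i)) (hSd.fun_mul (hpd i)), pd_mul hed (hxd i), pd_mul hSd (hpd i), hpS,
      pd_en hu, pd_coord]
    simp
  have hsym : ∑ i, (∑ j, pd i (pd j u) x * pd j u x) * x i =
      ∑ i, (∑ k, x k * pd i (pd k u) x) * pd i u x := by
    simp only [Finset.sum_mul]
    rw [Finset.sum_comm]
    refine Finset.sum_congr rfl fun i _ => Finset.sum_congr rfl fun j _ => ?_
    rw [pd_comm hu]; ring
  simp only [hterm, chem, lap_eq_sum_pd hu]
  set S := ∑ k, x k * pd k u x with hSdef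
  have e1 : ∑ i, ((∑ j, pd i (pd j u) x * pd j u x + W' (u x) * pd i u x) * x i + en u x
        - ((pd i u x + ∑ k, x k * pd i (pd k u) x) * pd i u x + S * pd i (pd i u) x)) =
      W' (u x) * S + n * en u x - gsq u x - S * ∑ i, pd i (pd i u) x := by
    have h2 : ∑ i, W' (u x) * pd i u x * x i = W' (u x) * S := by
      rw [hSdef, Finset.mul_sum]; exact Finset.sum_congr rfl fun i _ => by ring
    simp only [add_mul, Finset.sum_sub_distrib, Finset.sum_add_distrib, hsym, h2, gsq,
      ← Finset.mul_sum, ← pow_two]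
    simp; ring
  have e2 : ∑ i, (en u x * x i - S * pd i u x) * pd i g x =
      en u x * ∑ i, x i * pd i g x - S * gdot u g x := by
    simp only [gdot, Finset.mul_sum, ← Finset.sum_sub_distrib]
    exact Finset.sum_congr rfl fun i _ => by ring
  rw [Finset.sum_add_distrib, ← Finset.sum_mul, e1, e2]
  ring

end Identities

section Estimates

variable {n : ℕ} {u η : E n → ℝ}

lemma pd_eq_zero_of_notMem_tsupport {x : E n} (hx : x ∉ tsupport η) (i : Fin n) :
    pd i η x = 0 := by
  simp [pd, fderiv_of_notMem_tsupport (𝕜 := ℝ) hx]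

lemma integrable_of_cutoff {F : E n → ℝ} (hc : HasCompactSupport η) (hF : Continuous F)
    (h0 : ∀ x, η x = 0 → (∀ i, pd i η x = 0) → F x = 0) : Integrable F := by
  refine hF.integrable_of_hasCompactSupport (HasCompactSupport.intro hc fun x hx => ?_)
  exact h0 x (image_eq_zero_of_notMem_tsupport hx) (pd_eq_zero_of_notMem_tsupport hx)

lemma integral_le_of_le_add_of_integral_eq_zero {F G I : E n → ℝ} (hG : Integrable G)
    (hI : Integrable I) (hF : Integrable F) (h0 : ∫ x, I x = 0) (h : ∀ x, G x ≤ I x + F x) :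
    ∫ x, G x ≤ ∫ x, F x := by
  calc ∫ x, G x ≤ ∫ x, (I x + F x) := integral_mono hG (hI.add hF) h
    _ = ∫ x, F x := by rw [integral_add hI hF, h0, zero_add]

lemma gsq_eq_zero {x : E n} (h : ∀ i, pd i η x = 0) : gsq η x = 0 := by simp [gsq, h]

lemma gdot_eq_zero {x : E n} (h : ∀ i, pd i η x = 0) : gdot u η x = 0 := by simp [gdot, h]

lemma lap_eq (u : E n → ℝ) (x : E n) : lap u x = W' (u x) - chem u x := by simp [chem]

/-- Testing with a function of `u` whose square is controlled by its product with the derivative of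
the potential. -/
lemma integral_test_le (hu : ContDiff ℝ 2 u) {h h' ω : ℝ → ℝ} {τ : ℝ}
    (hh : ∀ t, HasDerivAt h (h' t) t) (hh' : Continuous h') (hω : ∀ t, h' t = ω t - τ)
    (hW : ∀ t, h t ^ 2 ≤ 2 * (W' t * h t)) (hη : ContDiff ℝ 1 η) (hc : HasCompactSupport η) :
    ∫ x, ω (u x) * gsq u x * η x ^ 2 ≤
      ∫ x, (τ * gsq u x * η x ^ 2 + chem u x ^ 2 * η x ^ 2 + 4 * gsq u x * gsq η x) := by
  have hu1 : ContDiff ℝ 1 u := hu.of_le (by norm_num)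
  have cu := hu.continuous
  have cη := hη.continuous
  have cg := continuous_gsq hu1
  have cgη := continuous_gsq hη
  have cgd := continuous_gdot hu1 hη
  have cl := continuous_lap hu
  have cc := continuous_chem hu
  have chu : Continuous fun x => h (u x) :=
    (continuous_iff_continuousAt.2 fun t => (hh t).continuousAt).comp cu
  have ch'u : Continuous fun x => h' (u x) := hh'.comp cu
  have cω : Continuous fun x => ω (u x) := by
    have : (fun x => ω (u x)) = fun x => h' (u x) + τ := by funext x; rw [hω]; ring
    rw [this]; exact ch'u.add continuous_const
  refine integral_le_of_le_add_of_integral_eq_zero ?_ ?_ ?_ (integral_test_comp hu hh hh' hη hc) ?_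
  · exact integrable_of_cutoff hc ((cω.mul cg).mul (cη.pow 2)) fun x h1 h2 => by simp [h1]
  · exact integrable_of_cutoff hc ((((cl.mul chu).mul (cη.pow 2)).add
      ((ch'u.mul cg).mul (cη.pow 2))).add (((continuous_const.mul chu).mul cη).mul cgd))
      fun x h1 h2 => by simp [h1]
  · exact integrable_of_cutoff hc (by fun_prop) fun x h1 h2 => by simp [h1, gsq_eq_zero h2]
  intro x
  rw [lap_eq, hω]
  have h1 := gdot_sq_le u η x
  have h2 := hW (u x)
  have h3 := mul_le_mul_of_nonneg_right h2 (sq_nonneg (η x))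
  nlinarith [sq_nonneg (h (u x) * η x / 2 + 2 * gdot u η x),
    sq_nonneg (h (u x) * η x / 2 - chem u x * η x)]

lemma integral_W'_sq_le (hu : ContDiff ℝ 2 u) (hη : ContDiff ℝ 1 η) (hc : HasCompactSupport η) :
    ∫ x, W' (u x) ^ 2 * η x ^ 2 ≤ ∫ x, (2 * gsq u x * η x ^ 2 + 2 * chem u x ^ 2 * η x ^ 2
      + 8 * gsq u x * gsq η x) := by
  have hu1 : ContDiff ℝ 1 u := hu.of_le (by norm_num)
  have cu := hu.continuous
  have cη := hη.continuous
  have cg := continuous_gsq hu1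
  have cgη := continuous_gsq hη
  have cgd := continuous_gdot hu1 hη
  have cl := continuous_lap hu
  have cc := continuous_chem hu
  have cW : Continuous fun x => W' (u x) := (contDiff_W' (k := 0)).continuous.comp cu
  have hd : ∀ t, HasDerivAt W' (3 * t ^ 2 - 1) t := fun t => by
    have := (hasDerivAt_pow 3 t).sub (hasDerivAt_id t)
    convert! this using 1
  have key := integral_test_comp hu hd (by fun_prop) hη hc
  have key2 := congrArg (fun r => 2 * r) key
  simp only [← integral_const_mul, mul_zero] at key2
  refine integral_le_of_le_add_of_integral_eq_zero ?_ ?_ ?_ key2 ?_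
  · exact integrable_of_cutoff hc (by fun_prop) fun x h1 h2 => by simp [h1]
  · exact integrable_of_cutoff hc (by fun_prop) fun x h1 h2 => by simp [h1]
  · exact integrable_of_cutoff hc (by fun_prop) fun x h1 h2 => by simp [h1, gsq_eq_zero h2]
  intro x
  rw [lap_eq]
  have h1 := gdot_sq_le u η x
  have h2 : 0 ≤ (u x) ^ 2 * (gsq u x * η x ^ 2) := by have := gsq_nonneg u x; positivity
  nlinarith [sq_nonneg (W' (u x) * η x + 4 * gdot u η x),
    sq_nonneg (W' (u x) * η x - 2 * chem u x * η x)]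

lemma hess_apply_dot_sq_le (u v : E n → ℝ) (x : E n) :
    (∑ i, (∑ j, pd i (pd j u) x * pd j u x) * pd i v x) ^ 2 ≤ hsq u x * gsq u x * gsq v x := by
  calc _ ≤ (∑ i, (∑ j, pd i (pd j u) x * pd j u x) ^ 2) * gsq v x :=
        Finset.sum_mul_sq_le_sq_mul_sq _ _ _
    _ ≤ (∑ i, (∑ j, pd i (pd j u) x ^ 2) * gsq u x) * gsq v x := by
        refine mul_le_mul_of_nonneg_right ?_ (gsq_nonneg v x)
        exact Finset.sum_le_sum fun i _ => Finset.sum_mul_sq_le_sq_mul_sq _ _ _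
    _ = _ := by rw [← Finset.sum_mul, hsq]

lemma hsq_nonneg (u : E n → ℝ) (x : E n) : 0 ≤ hsq u x :=
  Finset.sum_nonneg fun _ _ => Finset.sum_nonneg fun _ _ => sq_nonneg _

lemma integral_hsq_le (hu : ContDiff ℝ 2 u) (huc : HasCompactSupport u) (hη : ContDiff ℝ 1 η)
    (hc : HasCompactSupport η) :
    ∫ x, hsq u x * η x ^ 2 ≤ ∫ x, (4 * lap u x ^ 2 * η x ^ 2 + 6 * gsq u x * gsq η x) := by
  have hu1 : ContDiff ℝ 1 u := hu.of_le (by norm_num)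
  have cη := hη.continuous
  have cg := continuous_gsq hu1
  have cgη := continuous_gsq hη
  have cgd := continuous_gdot hu1 hη
  have cl := continuous_lap hu
  have ch := continuous_hsq hu
  have cp : ∀ i, Continuous (pd i u) := fun i => (hu1.pd (m := 0) (by norm_num) i).continuous
  have cpη : ∀ i, Continuous (pd i η) := fun i => (hη.pd (m := 0) (by norm_num) i).continuous
  have cpp : ∀ i j, Continuous (pd i (pd j u)) := fun i j =>
    ((hu.pd (m := 1) (by norm_num) j).pd (m := 0) (by norm_num) i).continuous
  have key := integral_hsq_sub_lap_sq hu huc (hη.pow 2)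
    (hc.comp_left (g := fun t : ℝ => t ^ 2) (by norm_num))
  have hrw : ∀ x, (∑ i, (∑ j, pd i (pd j u) x * pd j u x - lap u x * pd i u x) *
      pd i (fun y => η y ^ 2) x) = 2 * η x * (∑ i, (∑ j, pd i (pd j u) x * pd j u x) * pd i η x)
        - 2 * η x * lap u x * gdot u η x := fun x => by
    simp only [pd_comp (g := fun t : ℝ => t ^ 2) (hasDerivAt_pow 2 _)
      (hη.differentiable (by norm_num) x), gdot, Finset.mul_sum, ← Finset.sum_sub_distrib]
    refine Finset.sum_congr rfl fun i _ => ?_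
    push_cast; ring
  simp only [hrw] at key
  have key2 := congrArg (fun r => 2 * r) key
  simp only [← integral_const_mul, mul_zero] at key2
  refine integral_le_of_le_add_of_integral_eq_zero ?_ ?_ ?_ key2 ?_
  · exact integrable_of_cutoff hc (by fun_prop) fun x h1 h2 => by simp [h1]
  · exact integrable_of_cutoff hc (by fun_prop) fun x h1 h2 => by simp [h1]
  · exact integrable_of_cutoff hc (by fun_prop) fun x h1 h2 => by simp [h1, gsq_eq_zero h2]
  intro x
  have h1 := gdot_sq_le u η x
  have h2 := hess_apply_dot_sq_le u η x
  set D := ∑ i, (∑ j, pd i (pd j u) x * pd j u x) * pd i η x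
  have hH := hsq_nonneg u x
  have hG : 0 ≤ gsq u x * gsq η x := mul_nonneg (gsq_nonneg _ _) (gsq_nonneg _ _)
  have h3 : -(4 * (η x * D)) ≤ hsq u x * η x ^ 2 + 4 * (gsq u x * gsq η x) := by
    have hn : 0 ≤ hsq u x * η x ^ 2 + 4 * (gsq u x * gsq η x) := by positivity
    refine (neg_le_abs _).trans (abs_le_of_sq_le_sq ?_ hn)
    have := mul_le_mul_of_nonneg_right h2 (sq_nonneg (η x))
    nlinarith [sq_nonneg (hsq u x * η x ^ 2 - 4 * (gsq u x * gsq η x))]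
  nlinarith [sq_nonneg (lap u x * η x - gdot u η x)]

end Estimates

section Discrepancy

variable {n : ℕ} {u η : E n → ℝ}

lemma discrepancy_pointwise {Hs w f A B p x y qη aη e N : ℝ} (hp : 0 < p) (hA : 0 ≤ A)
    (hAB : A ≤ B) (hB : B ≤ 1) (hx : 0 ≤ x) (hy : y ^ 2 ≤ 2 * x) (hN : 0 ≤ N)
    (hq : qη ^ 2 ≤ x * p * N) (ha : aη ^ 2 ≤ 2 * p * N)
    (hH : x * p + 2 * w * (y * p) + 2 * p * w ^ 2 ≤ Hs * (2 * p)) :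
    1 / 4 * (B * x * e ^ 2) ≤ (Hs - (w - f) ^ 2) * (A * e ^ 2)
      + (B * e ^ 2 * (x + f * y) + 2 * A * e * (qη + f * aη)
        - A * e ^ 2 * (x + w * y + f * y + 2 * f * w)) + 6 * f ^ 2 * e ^ 2 + 10 * (A * p) * N := by
  have hH' : x / 2 + w * y + w ^ 2 ≤ Hs := by
    have : (x / 2 + w * y + w ^ 2) * (2 * p) ≤ Hs * (2 * p) := by linarith
    exact le_of_mul_le_mul_right this (by positivity)
  have h1 : A * e ^ 2 * (x / 2 + w * y + w ^ 2) ≤ A * e ^ 2 * Hs :=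
    mul_le_mul_of_nonneg_left hH' (by positivity)
  have h2 : -(x / 8 + 4 * f ^ 2) ≤ f * y := by nlinarith [sq_nonneg (y / 4 + 2 * f)]
  have h3 : (B - A) * e ^ 2 * -(x / 8 + 4 * f ^ 2) ≤ (B - A) * e ^ 2 * (f * y) :=
    mul_le_mul_of_nonneg_left h2 (mul_nonneg (by linarith) (by positivity))
  have h4 : -(e ^ 2 * x / 8 + 8 * p * N) ≤ 2 * e * qη := by
    have hn : 0 ≤ e ^ 2 * x / 8 + 8 * p * N := by positivity
    have : |2 * e * qη| ≤ e ^ 2 * x / 8 + 8 * p * N := by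
      refine abs_le_of_sq_le_sq ?_ hn
      have := mul_le_mul_of_nonneg_left hq (sq_nonneg e)
      nlinarith [sq_nonneg (e ^ 2 * x / 8 - 8 * p * N)]
    exact (abs_le.1 this).1
  have h5 : -(e ^ 2 * f ^ 2 + 2 * p * N) ≤ 2 * e * f * aη := by
    nlinarith [sq_nonneg (e * f + aη)]
  have h6 := mul_le_mul_of_nonneg_left h4 hA
  have h7 := mul_le_mul_of_nonneg_left h5 hA
  have h8 : 0 ≤ (B - A) * e ^ 2 * x := mul_nonneg (mul_nonneg (by linarith) (by positivity)) hx
  have h9 : 0 ≤ A * e ^ 2 * x := by positivity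
  have h10 : 0 ≤ (1 - B) * (f ^ 2 * e ^ 2) := mul_nonneg (by linarith) (by positivity)
  have h11 : 0 ≤ A * (f ^ 2 * e ^ 2) := by positivity
  have h12 : 0 ≤ f ^ 2 * e ^ 2 := by positivity
  linarith

lemma disc_le_gsq (u : E n → ℝ) (x : E n) : disc u x ≤ gsq u x / 2 := by
  have := W_nonneg (u x)
  unfold disc; linarith

/-- A truncation of `t ↦ max t 0` that vanishes below the positive level `s`. -/
structure IsTruncation (s : ℝ) (φ φ' : ℝ → ℝ) : Prop where
  pos : 0 < s
  hasDerivAt : ∀ t, HasDerivAt φ (φ' t) t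
  continuous' : Continuous φ'
  eq_zero : ∀ t ≤ s, φ t = 0
  eq_zero' : ∀ t ≤ s, φ' t = 0
  nonneg : ∀ t, 0 ≤ φ t
  le_one : ∀ t, φ' t ≤ 1
  le_mul : ∀ t, φ t ≤ φ' t * t

variable {s : ℝ} {φ φ' : ℝ → ℝ}

lemma IsTruncation.nonneg' (h : IsTruncation s φ φ') (t : ℝ) : 0 ≤ φ' t := by
  rcases le_or_gt t s with ht | ht
  · rw [h.eq_zero' t ht]
  · have h0 : 0 < t := h.pos.trans ht
    exact nonneg_of_mul_nonneg_left ((h.nonneg t).trans (h.le_mul t)) h0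

lemma IsTruncation.contDiff (h : IsTruncation s φ φ') : ContDiff ℝ 1 φ := by
  rw [contDiff_one_iff_deriv]
  refine ⟨fun t => (h.hasDerivAt t).differentiableAt, ?_⟩
  rw [show deriv φ = φ' from funext fun t => (h.hasDerivAt t).deriv]
  exact h.continuous'

lemma IsTruncation.continuous (h : IsTruncation s φ φ') : Continuous φ := h.contDiff.continuous

lemma IsTruncation.contDiff_test (h : IsTruncation s φ φ') (hu : ContDiff ℝ 2 u)
    (hη : ContDiff ℝ 1 η) :
    ContDiff ℝ 1 fun x => φ (disc u x) * η x ^ 2 / (gsq u x / 2) := by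
  rw [contDiff_iff_contDiffAt]
  intro x
  rcases lt_or_ge (disc u x) s with hx | hx
  · have : (fun y => φ (disc u y) * η y ^ 2 / (gsq u y / 2)) =ᶠ[nhds x] fun _ => 0 := by
      filter_upwards [(contDiff_disc hu).continuous.continuousAt.eventually_lt
        continuousAt_const hx] with y hy
      rw [h.eq_zero _ hy.le]; simp
    exact contDiffAt_const.congr_of_eventuallyEq this
  · have hp : gsq u x / 2 ≠ 0 := (h.pos.trans_le (hx.trans (disc_le_gsq u x))).ne'
    exact (((h.contDiff.comp (contDiff_disc hu)).mul (hη.pow 2)).contDiffAt).div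
      ((contDiff_gsq hu).div_const 2).contDiffAt hp

lemma IsTruncation.pd_test (h : IsTruncation s φ φ') (hu : ContDiff ℝ 2 u)
    (hη : ContDiff ℝ 1 η) (i : Fin n) (x : E n) :
    pd i (fun x => φ (disc u x) * η x ^ 2 / (gsq u x / 2)) x =
      φ' (disc u x) * pd i (disc u) x * η x ^ 2 / (gsq u x / 2)
      + 2 * φ (disc u x) * η x * pd i η x / (gsq u x / 2)
      - φ (disc u x) * η x ^ 2 * (∑ j, pd i (pd j u) x * pd j u x) / (gsq u x / 2) ^ 2 := by
  rcases lt_or_ge (disc u x) s with hx | hx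
  · have : (fun y => φ (disc u y) * η y ^ 2 / (gsq u y / 2)) =ᶠ[nhds x] fun _ => 0 := by
      filter_upwards [(contDiff_disc hu).continuous.continuousAt.eventually_lt
        continuousAt_const hx] with y hy
      rw [h.eq_zero _ hy.le]; simp
    rw [pd, this.fderiv_eq, h.eq_zero _ hx.le, h.eq_zero' _ hx.le]
    simp
  · have hp : gsq u x / 2 ≠ 0 := (h.pos.trans_le (hx.trans (disc_le_gsq u x))).ne'
    have hp' : gsq u x ≠ 0 := fun h0 => hp (by rw [h0]; simp)
    have hdξ : DifferentiableAt ℝ (disc u) x := (contDiff_disc hu).differentiable (by norm_num) x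
    have hdη : DifferentiableAt ℝ η x := hη.differentiable (by norm_num) x
    have hdg : DifferentiableAt ℝ (gsq u) x := (contDiff_gsq hu).differentiable (by norm_num) x
    have hd1 : DifferentiableAt ℝ (fun y => φ (disc u y)) x :=
      (h.hasDerivAt _).differentiableAt.comp x hdξ
    have hi : HasDerivAt (fun t : ℝ => (t / 2)⁻¹) (-(1 / 2) / (gsq u x / 2) ^ 2) (gsq u x) :=
      ((hasDerivAt_id _).div_const 2).inv hp
    have hd3 : DifferentiableAt ℝ (fun y => (gsq u y / 2)⁻¹) x :=
      hi.differentiableAt.comp x hdg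
    have e : (fun x => φ (disc u x) * η x ^ 2 / (gsq u x / 2)) =
      fun x => (φ (disc u x) * η x ^ 2) * (gsq u x / 2)⁻¹ := by funext y; rw [div_eq_mul_inv]
    rw [e, pd_mul (hd1.fun_mul (hdη.fun_pow 2)) hd3, pd_mul hd1 (hdη.fun_pow 2),
      pd_comp (h.hasDerivAt _) hdξ, pd_comp (g := fun t : ℝ => t ^ 2) (hasDerivAt_pow 2 _) hdη,
      pd_comp hi hdg, pd_gsq hu]
    field_simp
    push_cast
    ring

lemma IsTruncation.div_gsq_eq (h : IsTruncation s φ φ') (u : E n → ℝ) (x : E n) :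
    φ' (disc u x) / (gsq u x / 2) = φ' (disc u x) / max (gsq u x / 2) s := by
  rcases le_or_gt (disc u x) s with hx | hx
  · simp [h.eq_zero' _ hx]
  · rw [max_eq_left (hx.le.trans (disc_le_gsq u x))]

/-- Weighted gradient estimate for the positive part of the discrepancy. -/
lemma IsTruncation.integral_gsq_disc_le (h : IsTruncation s φ φ') (hu : ContDiff ℝ 2 u)
    (huc : HasCompactSupport u) (hη : ContDiff ℝ 1 η) (hc : HasCompactSupport η) :
    Integrable (fun x => φ' (disc u x) / (gsq u x / 2) * gsq (disc u) x * η x ^ 2) ∧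
    ∫ x, φ' (disc u x) / (gsq u x / 2) * gsq (disc u) x * η x ^ 2 ≤
      ∫ x, (24 * chem u x ^ 2 * η x ^ 2 + 40 * φ (disc u x) * gsq η x) := by
  have hu1 : ContDiff ℝ 1 u := hu.of_le (by norm_num)
  have cη := hη.continuous
  have cg := continuous_gsq hu1
  have cgη := continuous_gsq hη
  have cl := continuous_lap hu
  have cc := continuous_chem hu
  have ch := continuous_hsq hu
  have cξ := (contDiff_disc hu).continuous
  have cgξ := continuous_gsq (contDiff_disc hu)
  have cφ : Continuous fun x => φ (disc u x) := h.continuous.comp cξ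
  have cφ' : Continuous fun x => φ' (disc u x) := h.continuous'.comp cξ
  have cp : ∀ i, Continuous (pd i u) := fun i => (hu1.pd (m := 0) (by norm_num) i).continuous
  have cpp : ∀ i j, Continuous (pd i (pd j u)) := fun i j =>
    ((hu.pd (m := 1) (by norm_num) j).pd (m := 0) (by norm_num) i).continuous
  have hψ := h.contDiff_test hu hη
  have cpψ : ∀ i, Continuous (pd i (fun x => φ (disc u x) * η x ^ 2 / (gsq u x / 2))) :=
    fun i => (hψ.pd (m := 0) (by norm_num) i).continuous
  have hψc : HasCompactSupport fun x => φ (disc u x) * η x ^ 2 / (gsq u x / 2) :=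
    HasCompactSupport.intro hc fun x hx => by simp [image_eq_zero_of_notMem_tsupport hx]
  have key := integral_hsq_sub_lap_sq hu huc hψ hψc
  have key2 := congrArg (fun r => 4 * r) key
  simp only [← integral_const_mul, mul_zero] at key2
  have hG : Integrable (fun x => φ' (disc u x) / (gsq u x / 2) * gsq (disc u) x * η x ^ 2) := by
    simp only [h.div_gsq_eq]
    have cm : Continuous fun x => max (gsq u x / 2) s := by fun_prop
    exact integrable_of_cutoff hc (((cφ'.div cm fun x =>
      (h.pos.trans_le (le_max_right _ _)).ne').mul cgξ).mul (cη.pow 2)) fun x h1 h2 => by simp [h1]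
  refine ⟨hG, integral_le_of_le_add_of_integral_eq_zero hG ?_ ?_ key2 ?_⟩
  · have cψ := hψ.continuous
    refine integrable_of_cutoff hc (continuous_const.mul (((ch.sub (cl.pow 2)).mul cψ).add
      (continuous_finsetSum _ fun i _ => ?_))) fun x h1 h2 => ?_
    · exact ((continuous_finsetSum _ fun j _ => (cpp i j).mul (cp j)).sub (cl.mul (cp i))).mul
        (cpψ i)
    · simp [h.pd_test hu hη, h1]
  · exact integrable_of_cutoff hc (((continuous_const.mul (cc.pow 2)).mul (cη.pow 2)).add
      ((continuous_const.mul cφ).mul cgη)) fun x h1 h2 => by simp [h1, gsq_eq_zero h2]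
  intro x
  rcases le_or_gt (disc u x) s with hx | hx
  · simp only [h.pd_test hu hη, h.eq_zero _ hx, h.eq_zero' _ hx]
    simp
    positivity
  have hp : 0 < gsq u x / 2 := h.pos.trans (hx.trans_le (disc_le_gsq u x))
  set p := gsq u x / 2 with hpdef
  have hg : gsq u x = 2 * p := by rw [hpdef]; ring
  have hpne : p ≠ 0 := hp.ne'
  have hAp : φ (disc u x) = φ (disc u x) / p * p := by field_simp
  have hAB : φ (disc u x) / p ≤ φ' (disc u x) := by
    rw [div_le_iff₀ hp]
    exact (h.le_mul _).trans (mul_le_mul_of_nonneg_left (disc_le_gsq u x) (h.nonneg' _))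
  have hQ : gsq (disc u) x = gsq (disc u) x / p * p := by field_simp
  have haq : gdot u (disc u) x = gdot u (disc u) x / p * p := by field_simp
  have hHa : ∀ i, ∑ j, pd i (pd j u) x * pd j u x = pd i (disc u) x + W' (u x) * pd i u x :=
    fun i => by rw [pd_disc hu]; ring
  have hHa2 : ∑ i, (∑ j, pd i (pd j u) x * pd j u x) ^ 2 =
      gsq (disc u) x + 2 * W' (u x) * gdot u (disc u) x + W' (u x) ^ 2 * gsq u x := by
    simp only [hHa, gsq, gdot, Finset.mul_sum, ← Finset.sum_add_distrib]
    exact Finset.sum_congr rfl fun i _ => by ring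
  have hH : ∑ i, (∑ j, pd i (pd j u) x * pd j u x) ^ 2 ≤ hsq u x * gsq u x := by
    rw [hsq, Finset.sum_mul]
    exact Finset.sum_le_sum fun i _ => Finset.sum_mul_sq_le_sq_mul_sq _ _ _
  have hsum : ∑ i, (∑ j, pd i (pd j u) x * pd j u x - lap u x * pd i u x) *
      pd i (fun x => φ (disc u x) * η x ^ 2 / (gsq u x / 2)) x =
      φ' (disc u x) * η x ^ 2 * (gsq (disc u) x / p + chem u x * (gdot u (disc u) x / p))
      + 2 * (φ (disc u x) / p) * η x * (gdot (disc u) η x + chem u x * gdot u η x)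
      - φ (disc u x) / p * η x ^ 2 * (gsq (disc u) x / p + W' (u x) * (gdot u (disc u) x / p)
        + chem u x * (gdot u (disc u) x / p) + 2 * chem u x * W' (u x)) := by
    have h2 : 2 * chem u x * W' (u x) = chem u x * W' (u x) * (gsq u x / p) := by
      rw [hg]; field_simp
    rw [h2]
    simp only [h.pd_test hu hη, hHa, lap_eq]
    rw [← hpdef]
    simp only [gsq, gdot, Finset.mul_sum, Finset.sum_div, ← Finset.sum_add_distrib,
      ← Finset.sum_sub_distrib]
    refine Finset.sum_congr rfl fun i _ => ?_
    field_simp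
    ring
  have main := discrepancy_pointwise (Hs := hsq u x) (w := W' (u x)) (f := chem u x)
    (A := φ (disc u x) / p) (B := φ' (disc u x)) (p := p) (x := gsq (disc u) x / p)
    (y := gdot u (disc u) x / p) (qη := gdot (disc u) η x) (aη := gdot u η x) (e := η x)
    (N := gsq η x) hp (div_nonneg (h.nonneg _) hp.le) hAB (h.le_one _)
    (div_nonneg (gsq_nonneg _ _) hp.le) ?_ (gsq_nonneg _ _) ?_ ?_ ?_
  · rw [hsum, lap_eq]
    rw [← hAp] at main
    have e1 : φ' (disc u x) / p * gsq (disc u) x = φ' (disc u x) * (gsq (disc u) x / p) := by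
      ring
    have e2 : φ (disc u x) * η x ^ 2 / p = φ (disc u x) / p * η x ^ 2 := by ring
    rw [e1, e2]
    linarith
  · have := gdot_sq_le u (disc u) x
    rw [div_pow, div_le_iff₀ (by positivity)]
    calc _ ≤ _ := this
      _ = _ := by rw [hg]; field_simp
  · rw [← hQ]; exact gdot_sq_le _ _ _
  · rw [← hg]; exact gdot_sq_le _ _ _
  · rw [← hQ, ← haq, ← hg]
    calc _ = _ := by rw [hHa2]; ring
      _ ≤ _ := hH

lemma hasDerivAt_max_zero_sq (t : ℝ) :
    HasDerivAt (fun t : ℝ => max 0 t ^ 2) (2 * max 0 t) t := by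
  rcases lt_trichotomy t 0 with ht | rfl | ht
  · have : (fun t : ℝ => max 0 t ^ 2) =ᶠ[nhds t] fun _ => 0 := by
      filter_upwards [eventually_lt_nhds ht] with y hy
      simp [max_eq_left hy.le]
    rw [max_eq_left ht.le, mul_zero]
    exact (hasDerivAt_const t (0 : ℝ)).congr_of_eventuallyEq this
  · rw [max_self, mul_zero, hasDerivAt_iff_isLittleO_nhds_zero]
    simp only [zero_add, max_self, smul_zero, sub_zero]
    have h1 : (fun h : ℝ => max 0 h ^ 2 - 0 ^ 2) =O[nhds 0] fun h : ℝ => h ^ 2 := by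
      refine Asymptotics.IsBigO.of_bound 1 (Eventually.of_forall fun h => ?_)
      have h2 : |max 0 h| ≤ |h| := by
        rcases le_total h 0 with hh | hh <;> simp [hh]
      rw [Real.norm_eq_abs, Real.norm_eq_abs, one_mul, zero_pow two_ne_zero, sub_zero, abs_pow,
        abs_pow]
      gcongr
    exact h1.trans_isLittleO (Asymptotics.isLittleO_pow_id one_lt_two)
  · have : (fun t : ℝ => max 0 t ^ 2) =ᶠ[nhds t] fun t => t ^ 2 := by
      filter_upwards [eventually_gt_nhds ht] with y hy
      simp [max_eq_right hy.le]
    rw [max_eq_right ht.le]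
    simpa using (hasDerivAt_pow 2 t).congr_of_eventuallyEq this

lemma isTruncation_max_sq_div (hs : 0 < s) :
    IsTruncation s (fun t => max 0 (t - s) ^ 2 / t) (fun t => 1 - (s / max t s) ^ 2) where
  pos := hs
  hasDerivAt t := by
    rcases lt_or_ge t s with ht | ht
    · have : (fun t : ℝ => max 0 (t - s) ^ 2 / t) =ᶠ[nhds t] fun _ => 0 := by
        filter_upwards [eventually_lt_nhds ht] with y hy
        rw [max_eq_left (by linarith)]; simp
      rw [max_eq_right ht.le, div_self hs.ne', one_pow, sub_self]
      exact (hasDerivAt_const t (0 : ℝ)).congr_of_eventuallyEq this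
    · have h0 : t ≠ 0 := (hs.trans_le ht).ne'
      have h1 : HasDerivAt (fun t : ℝ => max 0 (t - s) ^ 2) (2 * max 0 (t - s)) t := by
        exact HasDerivAt.comp_sub_const t s (hasDerivAt_max_zero_sq (t - s))
      convert! h1.div (hasDerivAt_id t) h0 using 1
      rw [max_eq_left ht, max_eq_right (sub_nonneg.2 ht)]
      simp only [id]
      field_simp
      ring
  continuous' := by
    have : ∀ t, max t s ≠ 0 := fun t => (hs.trans_le (le_max_right _ _)).ne'
    fun_prop (disch := exact this _)
  eq_zero t ht := by rw [max_eq_left (by linarith)]; simp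
  eq_zero' t ht := by rw [max_eq_right ht, div_self hs.ne']; simp
  nonneg t := by
    rcases le_or_gt t s with ht | ht
    · rw [max_eq_left (by linarith)]; simp
    · have := hs.trans ht
      positivity
  le_one t := by nlinarith [sq_nonneg (s / max t s)]
  le_mul t := by
    rcases le_or_gt t s with ht | ht
    · rw [max_eq_left (by linarith), max_eq_right ht, div_self hs.ne']; simp
    · have := hs.trans ht
      rw [max_eq_left ht.le, max_eq_right (by linarith), div_le_iff₀ this]
      have : (1 - (s / t) ^ 2) * t * t = t ^ 2 - s ^ 2 := by field_simp
      rw [this]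
      nlinarith

lemma le_max_sq_div_add (hs : 0 < s) (t : ℝ) : max 0 t ≤ max 0 (t - s) ^ 2 / t + 2 * s := by
  rcases le_or_gt t s with ht | ht
  · rw [max_eq_left (a := (0 : ℝ)) (b := t - s) (by linarith)]
    have : max 0 t ≤ s := max_le hs.le ht
    rw [zero_pow two_ne_zero, zero_div]; linarith
  · have h0 := hs.trans ht
    rw [max_eq_right h0.le, max_eq_right (by linarith), ← sub_le_iff_le_add, le_div_iff₀ h0]
    nlinarith [sq_nonneg s]

lemma IsTruncation.le_max (h : IsTruncation s φ φ') (t : ℝ) : φ t ≤ max 0 t := by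
  rcases le_or_gt t 0 with ht | ht
  · rw [h.eq_zero t (ht.trans h.pos.le)]; exact le_max_left _ _
  · refine (h.le_mul t).trans ((mul_le_of_le_one_left ht.le (h.le_one t)).trans (le_max_right _ _))

end Discrepancy

section Sobolev

lemma lintegral_enorm_pow_eq {α : Type*} [MeasurableSpace α] {μ : Measure α} {F : Type*}
    [NormedAddCommGroup F] {f : α → F} {m : ℕ} (hf : Integrable (fun x => ‖f x‖ ^ m) μ) :
    ∫⁻ x, ‖f x‖ₑ ^ m ∂μ = ENNReal.ofReal (∫ x, ‖f x‖ ^ m ∂μ) := by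
  rw [ofReal_integral_eq_lintegral_ofReal hf (Eventually.of_forall fun x => by positivity)]
  exact lintegral_congr fun x => by rw [ENNReal.ofReal_pow (norm_nonneg _), ofReal_norm]

/-- The `W^{1,1}` Sobolev inequality in three dimensions. -/
lemma exists_integral_sqrt_cube_le :
    ∃ C > 0, ∀ w : E 3 → ℝ, ContDiff ℝ 1 w → HasCompactSupport w → (∀ x, 0 ≤ w x) →
      ∀ d : ℝ, 0 ≤ d → ∫ x, ‖fderiv ℝ w x‖ ≤ d ^ 2 → ∫ x, √(w x) ^ 3 ≤ C * d ^ 3 := by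
  set C := lintegralPowLePowLIntegralFDerivConst (volume : Measure (E 3)) (3 / 2)
  refine ⟨C + 1, by positivity, fun w hw hc h0 d hd hD => ?_⟩
  have hp : Real.HolderConjugate (Module.finrank ℝ (E 3)) (3 / 2 : ℝ) := by
    rw [finrank_euclideanSpace_fin, Real.holderConjugate_iff]; norm_num
  have key := lintegral_pow_le_pow_lintegral_fderiv (volume : Measure (E 3)) hw hc hp
  have hfi : Integrable fun x => ‖fderiv ℝ w x‖ :=
    ((hw.continuous_fderiv (by norm_num)).integrable_of_hasCompactSupport (hc.fderiv ℝ)).norm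
  have e1 : ∫⁻ x, ‖fderiv ℝ w x‖ₑ = ENNReal.ofReal (∫ x, ‖fderiv ℝ w x‖) := by
    simpa using lintegral_enorm_pow_eq (m := 1) (by simpa using hfi)
  have e2 : ∀ x, ‖w x‖ₑ ^ (3 / 2 : ℝ) = ENNReal.ofReal (√(w x) ^ 3) := fun x => by
    rw [← ofReal_norm, Real.norm_of_nonneg (h0 x),
      ENNReal.ofReal_rpow_of_nonneg (h0 x) (by norm_num), Real.sqrt_eq_rpow, ← Real.rpow_natCast,
      ← Real.rpow_mul (h0 x)]
    norm_num
  have e3 : (∫⁻ x, ‖fderiv ℝ w x‖ₑ) ^ (3 / 2 : ℝ) ≤ ENNReal.ofReal (d ^ 3) := by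
    calc _ ≤ ENNReal.ofReal (d ^ 2) ^ (3 / 2 : ℝ) := by
          rw [e1]; gcongr
      _ = ENNReal.ofReal (d ^ 3) := by
          rw [ENNReal.ofReal_rpow_of_nonneg (by positivity) (by norm_num), ← Real.rpow_natCast,
            ← Real.rpow_mul hd, ← Real.rpow_natCast]
          norm_num
  simp only [e2] at key
  have hi : Integrable fun x => √(w x) ^ 3 := by
    refine Continuous.integrable_of_hasCompactSupport (by have := hw.continuous; fun_prop) ?_
    exact hc.comp_left (g := fun t => √t ^ 3) (by simp)
  rw [← ofReal_integral_eq_lintegral_ofReal hi (Eventually.of_forall fun x => by positivity)]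
    at key
  have : ENNReal.ofReal (∫ x, √(w x) ^ 3) ≤ ENNReal.ofReal (C * d ^ 3) := by
    refine key.trans ?_
    rw [ENNReal.ofReal_mul C.coe_nonneg, ENNReal.ofReal_coe_nnreal]
    gcongr
  rw [ENNReal.ofReal_le_ofReal_iff (by positivity)] at this
  refine this.trans ?_
  gcongr
  linarith

/-- The `W^{1,2}` Sobolev inequality in three dimensions. -/
lemma exists_integral_pow_six_le :
    ∃ C > 0, ∀ v : E 3 → ℝ, ContDiff ℝ 1 v → HasCompactSupport v →
      ∫ x, v x ^ 6 ≤ C * (∫ x, gsq v x) ^ 3 := by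
  set C := eLpNormLESNormFDerivOfEqInnerConst (volume : Measure (E 3)) ((2 : NNReal) : ℝ)
  refine ⟨C ^ 6 + 1, by positivity, fun v hv hc => ?_⟩
  have key := eLpNorm_le_eLpNorm_fderiv_of_eq_inner (volume : Measure (E 3)) hv hc
    (p := 2) (p' := 6) (by norm_num) (by simp) (by simp; norm_num)
  have h6 := eLpNorm_nnreal_pow_eq_lintegral (μ := (volume : Measure (E 3))) (f := v)
    (p := 6) (by norm_num)
  have h2 := eLpNorm_nnreal_pow_eq_lintegral (μ := (volume : Measure (E 3))) (f := fderiv ℝ v)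
    (p := 2) (by norm_num)
  have hfi : Integrable fun x => ‖fderiv ℝ v x‖ ^ 2 := by
    have cf := hv.continuous_fderiv (by norm_num)
    exact Continuous.integrable_of_hasCompactSupport (by fun_prop)
      ((hc.fderiv ℝ).comp_left (g := fun A => ‖A‖ ^ 2) (by simp))
  have hvi : Integrable fun x => ‖v x‖ ^ 6 := by
    have cf := hv.continuous
    exact Continuous.integrable_of_hasCompactSupport (by fun_prop)
      (hc.comp_left (g := fun A => ‖A‖ ^ 6) (by simp))
  have c6 : ((6 : NNReal) : ℝ) = ((6 : ℕ) : ℝ) := by norm_num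
  have c2 : ((2 : NNReal) : ℝ) = ((2 : ℕ) : ℝ) := by norm_num
  rw [c6] at h6
  rw [c2] at h2
  simp only [ENNReal.rpow_natCast] at h6 h2
  rw [lintegral_enorm_pow_eq hvi] at h6
  rw [lintegral_enorm_pow_eq hfi] at h2
  have key3 : ENNReal.ofReal (∫ x, ‖v x‖ ^ 6) ≤
      ENNReal.ofReal (C ^ 6 * (∫ x, ‖fderiv ℝ v x‖ ^ 2) ^ 3) := by
    rw [← h6, ENNReal.ofReal_mul (by positivity), ENNReal.ofReal_pow C.coe_nonneg,
      ENNReal.ofReal_pow (integral_nonneg fun x => by positivity), ← h2, ENNReal.ofReal_coe_nnreal,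
      ← pow_mul, ← mul_pow]
    exact pow_le_pow_left₀ (zero_le) key 6
  have hn : 0 ≤ ∫ x, ‖fderiv ℝ v x‖ ^ 2 := integral_nonneg fun x => by positivity
  rw [ENNReal.ofReal_le_ofReal_iff (by positivity)] at key3
  have e1 : ∀ x, ‖v x‖ ^ 6 = v x ^ 6 := fun x => by
    rw [Real.norm_eq_abs]; exact (show Even 6 by decide).pow_abs _
  have e2 : ∀ x, ‖fderiv ℝ v x‖ ^ 2 = gsq v x := fun x => norm_fderiv_sq v x
  simp only [e1, e2] at key3 hn
  refine key3.trans ?_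
  gcongr
  linarith

end Sobolev

section Cutoff

variable {n : ℕ} {ρ : ℝ}

/-- A `C¹` radial cutoff function supported in the ball of radius `ρ`. -/
def cut {n : ℕ} (ρ : ℝ) (x : E n) : ℝ := max 0 (1 - (∑ i, x i ^ 2) / ρ ^ 2) ^ 2

lemma sum_sq_eq_norm_sq (x : E n) : ∑ i, x i ^ 2 = ‖x‖ ^ 2 := by
  rw [EuclideanSpace.norm_sq_eq]; simp

lemma contDiff_max_zero_sq : ContDiff ℝ 1 fun t : ℝ => max 0 t ^ 2 := by
  rw [contDiff_one_iff_deriv]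
  refine ⟨fun t => (hasDerivAt_max_zero_sq t).differentiableAt, ?_⟩
  rw [show deriv (fun t : ℝ => max 0 t ^ 2) = fun t => 2 * max 0 t from
    funext fun t => (hasDerivAt_max_zero_sq t).deriv]
  fun_prop

lemma contDiff_cut : ContDiff ℝ 1 (cut ρ : E n → ℝ) := by
  unfold cut
  exact contDiff_max_zero_sq.comp (by fun_prop)

lemma cut_nonneg (x : E n) : 0 ≤ cut ρ x := by unfold cut; positivity

lemma cut_le_one (x : E n) : cut ρ x ≤ 1 := by
  unfold cut
  have h : max 0 (1 - (∑ i, x i ^ 2) / ρ ^ 2) ≤ 1 := by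
    refine max_le zero_le_one ?_
    have : 0 ≤ (∑ i, x i ^ 2) / ρ ^ 2 := by positivity
    linarith
  exact pow_le_one₀ (le_max_left _ _) h

lemma max_cut_eq_zero (hρ : 0 < ρ) {x : E n} (hx : x ∉ ball (0 : E n) ρ) :
    max 0 (1 - (∑ i, x i ^ 2) / ρ ^ 2) = 0 := by
  refine max_eq_left ?_
  rw [mem_ball_zero_iff, not_lt] at hx
  rw [sum_sq_eq_norm_sq, sub_nonpos, one_le_div (by positivity)]
  gcongr

lemma cut_eq_zero (hρ : 0 < ρ) {x : E n} (hx : x ∉ ball (0 : E n) ρ) : cut ρ x = 0 := by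
  rw [cut, max_cut_eq_zero hρ hx]; simp

lemma hasCompactSupport_cut (hρ : 0 < ρ) : HasCompactSupport (cut ρ : E n → ℝ) :=
  HasCompactSupport.intro (isCompact_closedBall 0 ρ) fun _ hx =>
    cut_eq_zero hρ fun h => hx (ball_subset_closedBall h)

lemma pd_sum_sq (i : Fin n) (x : E n) : pd i (fun x : E n => ∑ i, x i ^ 2) x = 2 * x i := by
  have hd : ∀ j : Fin n, DifferentiableAt ℝ (fun x : E n => x j) x := fun j => by fun_prop
  rw [pd_sum fun j _ => (hd j).fun_pow 2]
  simp only [pd_comp (g := fun t : ℝ => t ^ 2) (hasDerivAt_pow 2 _) (hd _), pd_coord]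
  simp

lemma pd_cut (i : Fin n) (x : E n) :
    pd i (cut ρ) x = -(4 * max 0 (1 - (∑ i, x i ^ 2) / ρ ^ 2) * x i / ρ ^ 2) := by
  have h1 : HasDerivAt (fun t : ℝ => 1 - t / ρ ^ 2) (-(1 / ρ ^ 2)) (∑ i, x i ^ 2) :=
    ((hasDerivAt_id _).div_const _).const_sub 1
  have h := (hasDerivAt_max_zero_sq _).comp _ h1
  have hd : DifferentiableAt ℝ (fun x : E n => ∑ i, x i ^ 2) x := by fun_prop
  have := pd_comp (i := i) h hd
  rw [pd_sum_sq] at this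
  refine Eq.trans this ?_
  ring

lemma half_le_cut (hρ : 0 < ρ) {x : E n} (hx : x ∈ ball (0 : E n) (ρ / 2)) : 1 / 2 ≤ cut ρ x := by
  rw [mem_ball_zero_iff] at hx
  have h : (∑ i, x i ^ 2) / ρ ^ 2 ≤ 1 / 4 := by
    rw [sum_sq_eq_norm_sq, div_le_iff₀ (by positivity)]
    nlinarith [norm_nonneg x]
  have h2 : 3 / 4 ≤ max 0 (1 - (∑ i, x i ^ 2) / ρ ^ 2) := le_max_of_le_right (by linarith)
  unfold cut
  nlinarith

lemma gsq_cut_eq_zero (hρ : 0 < ρ) {x : E n} (hx : x ∉ ball (0 : E n) ρ) :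
    gsq (cut ρ) x = 0 :=
  gsq_eq_zero fun i => by rw [pd_cut, max_cut_eq_zero hρ hx]; simp

lemma gsq_cut_le (hρ : 0 < ρ) (x : E n) : gsq (cut ρ) x ≤ 16 / ρ ^ 2 := by
  by_cases hx : x ∈ ball (0 : E n) ρ
  · rw [mem_ball_zero_iff] at hx
    set m := max 0 (1 - (∑ i, x i ^ 2) / ρ ^ 2)
    have hm1 : m ^ 2 ≤ 1 := cut_le_one x
    have : gsq (cut ρ) x = m ^ 2 * (16 / ρ ^ 2 * (‖x‖ ^ 2 / ρ ^ 2)) := by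
      have hpd : ∀ i, pd i (cut ρ) x = -(4 * m * x i / ρ ^ 2) := fun i => pd_cut i x
      rw [← sum_sq_eq_norm_sq, gsq]
      simp only [hpd, Finset.sum_div, Finset.mul_sum]
      refine Finset.sum_congr rfl fun i _ => ?_
      field_simp; ring
    rw [this]
    have h2 : ‖x‖ ^ 2 / ρ ^ 2 ≤ 1 := by
      rw [div_le_one (by positivity)]; gcongr
    calc m ^ 2 * (16 / ρ ^ 2 * (‖x‖ ^ 2 / ρ ^ 2)) ≤ 1 * (16 / ρ ^ 2 * 1) := by gcongr
      _ = _ := by ring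
  · rw [gsq_cut_eq_zero hρ hx]; positivity

lemma integrableOn_ball {F : E n → ℝ} (hF : Continuous F) (r : ℝ) :
    IntegrableOn F (ball (0 : E n) r) :=
  (hF.continuousOn.integrableOn_compact (isCompact_closedBall 0 r)).mono_set ball_subset_closedBall

lemma integral_le_setIntegral_ball {F G : E n → ℝ} (hG : Integrable G) (hF : Continuous F)
    (h : ∀ x ∈ ball (0 : E n) ρ, G x ≤ F x) (h0 : ∀ x ∉ ball (0 : E n) ρ, G x ≤ 0) :
    ∫ x, G x ≤ ∫ x in ball (0 : E n) ρ, F x := by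
  rw [← integral_indicator measurableSet_ball]
  refine integral_mono hG ((integrableOn_ball hF ρ).integrable_indicator measurableSet_ball) fun x => ?_
  by_cases hx : x ∈ ball (0 : E n) ρ
  · simpa [hx] using h x hx
  · simpa [hx] using h0 x hx

lemma setIntegral_ball_le_integral {F G : E n → ℝ} (hG : Integrable G) (hF : Continuous F)
    (h : ∀ x ∈ ball (0 : E n) ρ, F x ≤ G x) (h0 : ∀ x, 0 ≤ G x) :
    ∫ x in ball (0 : E n) ρ, F x ≤ ∫ x, G x := by
  rw [← integral_indicator measurableSet_ball]
  refine integral_mono ((integrableOn_ball hF ρ).integrable_indicator measurableSet_ball) hG fun x => ?_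
  by_cases hx : x ∈ ball (0 : E n) ρ
  · simpa [hx] using h x hx
  · simpa [hx] using h0 x

lemma setIntegral_ball_mono {F : E n → ℝ} (hF : Continuous F) (h0 : ∀ x, 0 ≤ F x) {r R : ℝ}
    (h : r ≤ R) : ∫ x in ball (0 : E n) r, F x ≤ ∫ x in ball (0 : E n) R, F x :=
  setIntegral_mono_set (integrableOn_ball hF R) (Eventually.of_forall h0)
    (ball_subset_ball h).eventuallyLE

end Cutoff

section NearWells

lemma hasDerivAt_ite_le {f g d : ℝ → ℝ} {a : ℝ} (hf : ∀ t ≤ a, HasDerivAt f (d t) t)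
    (hg : ∀ t, a ≤ t → HasDerivAt g (d t) t) (h : f a = g a) (t : ℝ) :
    HasDerivAt (fun t => if t ≤ a then f t else g t) (d t) t := by
  rcases lt_trichotomy t a with ht | rfl | ht
  · refine (hf t ht.le).congr_of_eventuallyEq ?_
    filter_upwards [eventually_lt_nhds ht] with y hy
    simp [hy.le]
  · have h1 : HasDerivWithinAt (fun s => if s ≤ t then f s else g s) (d t) (Iic t) t :=
      (hf t le_rfl).hasDerivWithinAt.congr (fun y hy => by simp [mem_Iic.1 hy]) (by simp)
    have h2 : HasDerivWithinAt (fun s => if s ≤ t then f s else g s) (d t) (Ici t) t := by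
      refine (hg t le_rfl).hasDerivWithinAt.congr (fun y hy => ?_) (by simp [h])
      rcases eq_or_lt_of_le (mem_Ici.1 hy) with rfl | hlt
      · simp [h]
      · simp [not_le.2 hlt]
    have := h1.union h2
    rwa [Iic_union_Ici, hasDerivWithinAt_univ] at this
  · refine (hg t ht.le).congr_of_eventuallyEq ?_
    filter_upwards [eventually_gt_nhds ht] with y hy
    simp [not_le.2 hy]

lemma one_sub_pow_le {y : ℝ} (hy0 : 0 ≤ y) (m : ℕ) : 1 - y ^ m ≤ m * (1 - y) := by
  have := one_add_mul_le_pow (show -2 ≤ y - 1 by linarith) m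
  simp only [add_sub_cancel] at this
  linarith

lemma one_sub_min_pow_cube_le (t : ℝ) (m : ℕ) :
    (1 - min (t ^ (2 * m)) 1) ^ 3 ≤ 4 * m ^ 2 * W t := by
  rcases le_or_gt 1 (t ^ 2) with ht | ht
  · rw [pow_mul, min_eq_right (one_le_pow₀ ht)]
    have := W_nonneg t
    norm_num; positivity
  · rw [pow_mul, min_eq_left (pow_le_one₀ (sq_nonneg t) ht.le)]
    have h1 := one_sub_pow_le (sq_nonneg t) m
    have h2 : (t ^ 2) ^ m ≤ 1 := pow_le_one₀ (sq_nonneg t) ht.le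
    have h3 : 0 ≤ (t ^ 2) ^ m := by positivity
    have h4 : (1 - (t ^ 2) ^ m) ^ 2 ≤ (m * (1 - t ^ 2)) ^ 2 :=
      pow_le_pow_left₀ (by linarith) h1 2
    have e : 4 * m ^ 2 * W t = (m * (1 - t ^ 2)) ^ 2 := by unfold W; ring
    rw [e]
    nlinarith [sq_nonneg (1 - (t ^ 2) ^ m)]

variable {n : ℕ} {u η : E n → ℝ}

/-- The Dirichlet energy near the wells is controlled by a small fraction of the energy. -/
lemma integral_min_pow_mul_gsq_le (hu : ContDiff ℝ 2 u) (hη : ContDiff ℝ 1 η)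
    (hc : HasCompactSupport η) (m : ℕ) :
    ∫ x, min (u x ^ (2 * m)) 1 * gsq u x * η x ^ 2 ≤
      ∫ x, (1 / (2 * m + 1) * gsq u x * η x ^ 2 + chem u x ^ 2 * η x ^ 2
        + 4 * gsq u x * gsq η x) := by
  set τ : ℝ := 1 / (2 * m + 1) with hτ
  have hm0 : (0 : ℝ) ≤ m := Nat.cast_nonneg m
  have hM : (0 : ℝ) < 2 * m + 1 := by positivity
  set P : ℝ → ℝ := fun t => (t ^ (2 * m + 1) - t) * τ with hP
  set f : ℝ → ℝ := fun t => if t ≤ 1 then P t else (t - 1) * (1 - τ) with hf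
  set h : ℝ → ℝ := fun t => if t ≤ -1 then (t + 1) * (1 - τ) else f t with hh
  have hPd : ∀ t, HasDerivAt P (t ^ (2 * m) - τ) t := fun t => by
    have := (((hasDerivAt_pow (2 * m + 1) t).sub (hasDerivAt_id t)).mul_const τ)
    convert! this using 1
    simp only [hτ, Nat.add_sub_cancel]
    push_cast
    field_simp
  have hlin : ∀ a t, HasDerivAt (fun t : ℝ => (t + a) * (1 - τ)) (1 - τ) t := fun a t => by
    simpa using ((hasDerivAt_id t).add_const a).mul_const (1 - τ)
  have hbig : ∀ t : ℝ, 1 ≤ t ^ 2 → min (t ^ (2 * m)) 1 = 1 := fun t ht => by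
    rw [pow_mul]; exact min_eq_right (one_le_pow₀ ht)
  have hsmall : ∀ t : ℝ, t ^ 2 ≤ 1 → min (t ^ (2 * m)) 1 = t ^ (2 * m) := fun t ht => by
    rw [pow_mul]; exact min_eq_left (pow_le_one₀ (sq_nonneg t) ht)
  have hfd : ∀ t, -1 ≤ t → HasDerivAt f (min (t ^ (2 * m)) 1 - τ) t := by
    intro t ht
    rcases le_or_gt t 1 with h1 | h1
    · have key := hasDerivAt_ite_le (a := 1) (f := P) (g := fun t => (t - 1) * (1 - τ))
        (d := fun t => if t ≤ 1 then t ^ (2 * m) - τ else 1 - τ)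
        (fun t ht => by simpa [ht] using hPd t)
        (fun t ht => by
          have := hlin (-1) t
          rcases eq_or_lt_of_le ht with rfl | h2
          · simpa [← sub_eq_add_neg] using this
          · simpa [not_le.2 h2, ← sub_eq_add_neg] using this) (by simp [hP]) t
      rw [hsmall t (by nlinarith)]
      simpa [h1] using key
    · rw [hbig t (by nlinarith)]
      refine (hlin (-1) t).congr_of_eventuallyEq ?_
      filter_upwards [eventually_gt_nhds h1] with y hy
      simp [hf, not_le.2 hy, sub_eq_add_neg]
  have hhd : ∀ t, HasDerivAt h (min (t ^ (2 * m)) 1 - τ) t := by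
    refine hasDerivAt_ite_le (fun t ht => ?_) hfd ?_
    · rw [hbig t (by nlinarith)]; exact hlin 1 t
    · simp [hf, hP, pow_succ, pow_mul]
  have hτ0 : 0 ≤ τ := by positivity
  have hτ1 : τ ≤ 1 := by rw [hτ, div_le_one hM]; linarith
  have hmτ : m * τ ≤ 1 / 2 := by
    rw [hτ, mul_one_div, div_le_iff₀ hM]; linarith
  refine integral_test_le hu hhd (by fun_prop) (fun t => rfl) (fun t => ?_) hη hc
  have hk : ∃ k : ℝ, 0 ≤ k ∧ k ≤ 2 ∧ h t = k * W' t := by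
    rcases le_or_gt (t ^ 2) 1 with h1 | h1
    · have ht1 : t ≤ 1 := by nlinarith
      have ht2 : -1 ≤ t := by nlinarith
      have hht : h t = P t := by
        rcases eq_or_lt_of_le ht2 with rfl | h3
        · simp [hh, hP, pow_succ, pow_mul]
        · simp [hh, hf, not_le.2 h3, ht1]
      rcases eq_or_lt_of_le h1 with h2 | h2
      · refine ⟨0, le_rfl, by norm_num, ?_⟩
        rw [hht, hP]
        simp [pow_succ, pow_mul, h2]
      · have hpos : 0 < 1 - t ^ 2 := by linarith
        have hb := one_sub_pow_le (sq_nonneg t) m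
        have hb2 : (t ^ 2) ^ m ≤ 1 := pow_le_one₀ (sq_nonneg t) h1
        refine ⟨τ * (1 - (t ^ 2) ^ m) / (1 - t ^ 2), ?_, ?_, ?_⟩
        · exact div_nonneg (mul_nonneg hτ0 (by linarith)) hpos.le
        · rw [div_le_iff₀ hpos]
          nlinarith [mul_le_mul_of_nonneg_left hb hτ0]
        · rw [hht]
          simp only [hP, W', pow_succ (n := 2 * m), pow_mul]
          field_simp
          ring
    · refine ⟨(1 - τ) / (|t| * (|t| + 1)), ?_, ?_, ?_⟩
      · have : 0 ≤ 1 - τ := by linarith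
        positivity
      · have ha : 1 < |t| := by rwa [one_lt_sq_iff_one_lt_abs] at h1
        rw [div_le_iff₀ (by positivity)]
        nlinarith
      · have ha : 1 < |t| := by rwa [one_lt_sq_iff_one_lt_abs] at h1
        rcases le_total 0 t with h0 | h0
        · rw [abs_of_nonneg h0] at ha ⊢
          have : h t = (t - 1) * (1 - τ) := by
            simp [hh, hf, not_le.2 ha, not_le.2 (show -1 < t by linarith)]
          rw [this, W']
          field_simp
          ring
        · rw [abs_of_nonpos h0] at ha ⊢
          have : h t = (t + 1) * (1 - τ) := by
            simp [hh, show t ≤ -1 by linarith]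
          have hne : -t ≠ 0 := by linarith
          have hne2 : -t + 1 ≠ 0 := by linarith
          have e : (1 - τ) / (-t * (-t + 1)) * W' t =
              (1 - τ) * (t + 1) * ((-t * (-t + 1)) / (-t * (-t + 1))) := by
            rw [W']; ring
          rw [this, e, div_self (mul_ne_zero hne hne2)]
          ring
  obtain ⟨k, hk0, hk2, hkt⟩ := hk
  rw [hkt]
  have : 0 ≤ (2 - k) * k * W' t ^ 2 := by
    have : 0 ≤ 2 - k := by linarith
    positivity
  linarith

end NearWells

/-- The energy in the centered ball of radius `r`. -/
def energy {n : ℕ} (u : E n → ℝ) (r : ℝ) : ℝ := ∫ x in ball (0 : E n) r, en u x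

/-- The squared `L²` norm of the first variation in the centered ball of radius `r`. -/
def defect {n : ℕ} (u : E n → ℝ) (r : ℝ) : ℝ := ∫ x in ball (0 : E n) r, chem u x ^ 2

section DiscrepancyDecay

variable {n : ℕ} {u : E n → ℝ}

lemma continuous_en (hu : ContDiff ℝ 2 u) : Continuous (en u) := (contDiff_en hu).continuous

lemma energy_nonneg (u : E n → ℝ) (r : ℝ) : 0 ≤ energy u r :=
  setIntegral_nonneg measurableSet_ball fun x _ => en_nonneg u x

lemma defect_nonneg (u : E n → ℝ) (r : ℝ) : 0 ≤ defect u r :=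
  setIntegral_nonneg measurableSet_ball fun _ _ => sq_nonneg _

lemma energy_mono (hu : ContDiff ℝ 2 u) {r R : ℝ} (h : r ≤ R) : energy u r ≤ energy u R :=
  setIntegral_ball_mono (continuous_en hu) (en_nonneg u) h

lemma defect_mono (hu : ContDiff ℝ 2 u) {r R : ℝ} (h : r ≤ R) : defect u r ≤ defect u R :=
  setIntegral_ball_mono ((continuous_chem hu).pow 2) (fun _ => sq_nonneg _) h

lemma half_gsq_le_en (u : E n → ℝ) (x : E n) : gsq u x / 2 ≤ en u x := by
  have := W_nonneg (u x)
  unfold en; linarith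

lemma W_le_en (u : E n → ℝ) (x : E n) : W (u x) ≤ en u x := by
  have := gsq_nonneg u x
  unfold en; linarith

lemma max_disc_le_en (u : E n → ℝ) (x : E n) : max 0 (disc u x) ≤ en u x :=
  max_le (en_nonneg u x) ((disc_le_gsq u x).trans (half_gsq_le_en u x))

lemma integral_le_defect_add_energy (hu : ContDiff ℝ 2 u) {G : E n → ℝ} (hG : Integrable G)
    {a b r : ℝ} (h : ∀ x ∈ ball (0 : E n) r, G x ≤ a * chem u x ^ 2 + b * en u x)
    (h0 : ∀ x ∉ ball (0 : E n) r, G x ≤ 0) :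
    ∫ x, G x ≤ a * defect u r + b * energy u r := by
  have cc : Continuous fun x => chem u x ^ 2 := (continuous_chem hu).pow 2
  have ce := continuous_en hu
  rw [defect, energy, ← integral_const_mul, ← integral_const_mul,
    ← integral_add ((integrableOn_ball cc r).const_mul a) ((integrableOn_ball ce r).const_mul b)]
  exact integral_le_setIntegral_ball hG (by fun_prop) h h0

variable {s : ℝ} {φ φ' : ℝ → ℝ}

lemma IsTruncation.norm_fderiv_mul_sq_le (h : IsTruncation s φ φ') (hu : ContDiff ℝ 2 u)
    {η : E n → ℝ} (hη : ContDiff ℝ 1 η) (hη0 : ∀ x, 0 ≤ η x) (x : E n) :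
    ‖fderiv ℝ (fun y => φ (disc u y) * η y ^ 2) x‖ ≤
      φ' (disc u x) * η x ^ 2 * ‖fderiv ℝ (disc u) x‖
        + 2 * φ (disc u x) * η x * ‖fderiv ℝ η x‖ := by
  have hdξ := ((contDiff_disc hu).differentiable (by norm_num) x).hasFDerivAt
  have hdη := (hη.differentiable (by norm_num) x).hasFDerivAt
  have h1 := (h.hasDerivAt (disc u x)).comp_hasFDerivAt x hdξ
  have h2 := (hasDerivAt_pow 2 (η x)).comp_hasFDerivAt x hdη
  have h3 := h1.mul h2
  have e : fderiv ℝ (fun y => φ (disc u y) * η y ^ 2) x = _ := h3.fderiv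
  rw [e]
  refine (norm_add_le _ _).trans ?_
  simp only [norm_smul, Real.norm_eq_abs, Function.comp]
  rw [abs_of_nonneg (h.nonneg _), abs_of_nonneg (h.nonneg' _), abs_of_nonneg (sq_nonneg (η x))]
  have : |((2 : ℕ) : ℝ) * η x ^ (2 - 1)| = 2 * η x := by
    norm_num; exact hη0 x
  rw [this]
  exact le_of_eq (by ring)

lemma IsTruncation.integral_norm_fderiv_le (h : IsTruncation s φ φ') (hu : ContDiff ℝ 2 u)
    (huc : HasCompactSupport u) {L : ℝ} (hL : 0 < L) :
    ∫ x, ‖fderiv ℝ (fun y => φ (disc u y) * cut (2 * L) y ^ 2) x‖ ≤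
      165 * L * (defect u (2 * L) + energy u (2 * L) / L ^ 2) := by
  have hρ : 0 < 2 * L := by positivity
  have hη : ContDiff ℝ 1 (cut (2 * L) : E n → ℝ) := contDiff_cut
  have hc : HasCompactSupport (cut (2 * L) : E n → ℝ) := hasCompactSupport_cut hρ
  have cη := hη.continuous
  have cgη := continuous_gsq hη
  have cξ := (contDiff_disc hu).continuous
  have cφ : Continuous fun x => φ (disc u x) := h.continuous.comp cξ
  have cc := continuous_chem hu
  have ce := continuous_en hu
  obtain ⟨hGi, hG⟩ := h.integral_gsq_disc_le hu huc hη hc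
  have hφ : ∀ x, φ (disc u x) ≤ en u x := fun x => (h.le_max _).trans (max_disc_le_en u x)
  have hN : ∀ x : E n, gsq (cut (2 * L)) x ≤ 4 / L ^ 2 := fun x => by
    refine (gsq_cut_le hρ x).trans (le_of_eq ?_)
    field_simp; ring
  have h1 : ∫ x, (24 * chem u x ^ 2 * cut (2 * L) x ^ 2 + 40 * φ (disc u x) * gsq (cut (2 * L)) x)
      ≤ 24 * defect u (2 * L) + 160 / L ^ 2 * energy u (2 * L) := by
    refine integral_le_defect_add_energy hu ?_ (fun x _ => ?_) fun x hx => ?_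
    · exact integrable_of_cutoff hc (((continuous_const.mul (cc.pow 2)).mul (cη.pow 2)).add
        ((continuous_const.mul cφ).mul cgη)) fun x h1 h2 => by simp [h1, gsq_eq_zero h2]
    · have e1 : cut (2 * L) x ^ 2 ≤ 1 := pow_le_one₀ (cut_nonneg x) (cut_le_one x)
      have e2 : φ (disc u x) * gsq (cut (2 * L)) x ≤ en u x * (4 / L ^ 2) :=
        mul_le_mul (hφ x) (hN x) (gsq_nonneg _ _) (en_nonneg u x)
      have e3 : 160 / L ^ 2 * en u x = 40 * (en u x * (4 / L ^ 2)) := by ring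
      rw [e3]
      nlinarith [mul_le_mul_of_nonneg_left e1 (sq_nonneg (chem u x))]
    · simp [cut_eq_zero hρ hx, gsq_cut_eq_zero hρ hx]
  have hwd : ContDiff ℝ 1 fun y => φ (disc u y) * cut (2 * L) y ^ 2 :=
    (h.contDiff.comp (contDiff_disc hu)).mul (hη.pow 2)
  have hwc : HasCompactSupport fun y => φ (disc u y) * cut (2 * L) y ^ 2 :=
    HasCompactSupport.intro hc fun x hx => by simp [image_eq_zero_of_notMem_tsupport hx]
  have hwi : Integrable fun x => ‖fderiv ℝ (fun y => φ (disc u y) * cut (2 * L) y ^ 2) x‖ :=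
    ((hwd.continuous_fderiv (by norm_num)).integrable_of_hasCompactSupport (hwc.fderiv ℝ)).norm
  have h2 : ∫ x, (‖fderiv ℝ (fun y => φ (disc u y) * cut (2 * L) y ^ 2) x‖
      - L * (φ' (disc u x) / (gsq u x / 2) * gsq (disc u) x * cut (2 * L) x ^ 2)) ≤
      5 / L * energy u (2 * L) := by
    have : 5 / L * energy u (2 * L) = ∫ x in ball (0 : E n) (2 * L), 5 / L * en u x := by
      rw [integral_const_mul, energy]
    rw [this]
    refine integral_le_setIntegral_ball (hwi.sub (hGi.const_mul L)) (by fun_prop)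
      (fun x _ => ?_) fun x hx => ?_
    · have hb := h.norm_fderiv_mul_sq_le hu hη cut_nonneg x
      have hη0 := cut_nonneg (ρ := 2 * L) x
      have hη1 := cut_le_one (ρ := 2 * L) x
      have hdη : ‖fderiv ℝ (cut (2 * L)) x‖ ≤ 2 / L := by
        refine abs_le_of_sq_le_sq' ?_ (by positivity) |>.2
        calc _ = gsq (cut (2 * L)) x := norm_fderiv_sq _ _
          _ ≤ _ := hN x
          _ = _ := by ring
      have hen := en_nonneg u x
      have t2 : 2 * φ (disc u x) * cut (2 * L) x * ‖fderiv ℝ (cut (2 * L)) x‖ ≤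
          4 / L * en u x := by
        calc _ ≤ 2 * en u x * 1 * (2 / L) := by
              have := h.nonneg (disc u x)
              gcongr
              exact hφ x
          _ = _ := by ring
      have t1 : φ' (disc u x) * cut (2 * L) x ^ 2 * ‖fderiv ℝ (disc u) x‖ ≤
          L * (φ' (disc u x) / (gsq u x / 2) * gsq (disc u) x * cut (2 * L) x ^ 2)
            + 1 / L * en u x := by
        rcases le_or_gt (disc u x) s with hx | hx
        · rw [h.eq_zero' _ hx]; simp; positivity
        have hp : 0 < gsq u x / 2 := h.pos.trans (hx.trans_le (disc_le_gsq u x))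
        have hpe := half_gsq_le_en u x
        have hg : gsq (disc u) x = ‖fderiv ℝ (disc u) x‖ ^ 2 := (norm_fderiv_sq _ _).symm
        rw [hg]
        set p := gsq u x / 2
        set q := ‖fderiv ℝ (disc u) x‖
        have hy : q ≤ L * (q ^ 2 / p) + 1 / L * p := by
          have : L * (q ^ 2 / p) + 1 / L * p - q = (L ^ 2 * q ^ 2 + p ^ 2 - L * p * q) / (L * p) := by
            field_simp
          have h3 : 0 ≤ (L ^ 2 * q ^ 2 + p ^ 2 - L * p * q) / (L * p) := by
            refine div_nonneg ?_ (by positivity)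
            nlinarith [sq_nonneg (L * q - p), sq_nonneg (L * q), sq_nonneg p]
          linarith
        have hB := h.nonneg' (disc u x)
        have hB1 := h.le_one (disc u x)
        have hBη : φ' (disc u x) * cut (2 * L) x ^ 2 ≤ 1 :=
          mul_le_one₀ hB1 (by positivity) (pow_le_one₀ hη0 hη1)
        calc _ ≤ φ' (disc u x) * cut (2 * L) x ^ 2 * (L * (q ^ 2 / p) + 1 / L * p) := by gcongr
          _ = L * (φ' (disc u x) / p * q ^ 2 * cut (2 * L) x ^ 2)
              + φ' (disc u x) * cut (2 * L) x ^ 2 * (1 / L * p) := by ring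
          _ ≤ L * (φ' (disc u x) / p * q ^ 2 * cut (2 * L) x ^ 2) + 1 * (1 / L * en u x) := by
              gcongr
          _ = _ := by ring
      have e : 5 / L * en u x = 4 / L * en u x + 1 / L * en u x := by ring
      linarith
    · have hb := h.norm_fderiv_mul_sq_le hu hη cut_nonneg x
      rw [cut_eq_zero hρ hx] at hb ⊢
      simp at hb ⊢
      rw [hb]
  rw [integral_sub hwi (hGi.const_mul L), integral_const_mul] at h2
  have h3 := mul_le_mul_of_nonneg_left (hG.trans h1) hL.le
  have hdn := defect_nonneg u (2 * L)
  have e1 : 165 * L * (defect u (2 * L) + energy u (2 * L) / L ^ 2) =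
    165 * (L * defect u (2 * L)) + 165 * (energy u (2 * L) / L) := by field_simp
  have e2 : L * (24 * defect u (2 * L) + 160 / L ^ 2 * energy u (2 * L)) =
    24 * (L * defect u (2 * L)) + 160 * (energy u (2 * L) / L) := by field_simp
  have e3 : 5 / L * energy u (2 * L) = 5 * (energy u (2 * L) / L) := by ring
  have : 0 ≤ L * defect u (2 * L) := by positivity
  rw [e1]; rw [e2] at h3; rw [e3] at h2
  linarith

lemma sq_mul_le_young {a b l : ℝ} (ha : 0 ≤ a) (hb : 0 ≤ b) (hl : 0 < l) :
    a ^ 2 * b ≤ l * a ^ 3 + b ^ 3 / l ^ 2 := by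
  rcases le_total b (l * a) with h | h
  · have h1 := mul_le_mul_of_nonneg_left h (sq_nonneg a)
    have : 0 ≤ b ^ 3 / l ^ 2 := by positivity
    linarith
  · have h1 : (l * a) ^ 2 ≤ b ^ 2 := pow_le_pow_left₀ (by positivity) h 2
    have h2 : a ^ 2 * b ≤ b ^ 3 / l ^ 2 := by
      rw [le_div_iff₀ (by positivity)]
      nlinarith [mul_le_mul_of_nonneg_right h1 hb]
    have : 0 ≤ l * a ^ 3 := by positivity
    linarith

lemma integral_min_pow_mul_gsq_cut_le (hu : ContDiff ℝ 2 u) (m : ℕ) {L : ℝ} (hL : 0 < L) :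
    ∫ x, min (u x ^ (2 * m)) 1 * gsq u x * cut (2 * L) x ^ 2 ≤
      1 * defect u (2 * L) + (2 / (2 * m + 1) + 32 / L ^ 2) * energy u (2 * L) := by
  have hρ : 0 < 2 * L := by positivity
  have hη : ContDiff ℝ 1 (cut (2 * L) : E n → ℝ) := contDiff_cut
  have hc : HasCompactSupport (cut (2 * L) : E n → ℝ) := hasCompactSupport_cut hρ
  have cη := hη.continuous
  have cgη := continuous_gsq hη
  have cc := continuous_chem hu
  have cg := continuous_gsq (u := u) (hu.of_le (by norm_num))
  refine (integral_min_pow_mul_gsq_le hu hη hc m).trans ?_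
  refine integral_le_defect_add_energy hu ?_ (fun x _ => ?_) fun x hx => ?_
  · exact integrable_of_cutoff hc (by fun_prop) fun x h1 h2 => by simp [h1, gsq_eq_zero h2]
  · have hN : gsq (cut (2 * L)) x ≤ 4 / L ^ 2 := by
      refine (gsq_cut_le hρ x).trans (le_of_eq ?_)
      field_simp; ring
    have hg := gsq_nonneg u x
    have he := half_gsq_le_en u x
    have e1 : cut (2 * L) x ^ 2 ≤ 1 := pow_le_one₀ (cut_nonneg x) (cut_le_one x)
    calc _ ≤ 1 / (2 * m + 1) * (2 * en u x) * 1 + chem u x ^ 2 * 1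
          + 4 * (2 * en u x) * (4 / L ^ 2) := by
          have := en_nonneg u x
          have := gsq_nonneg (cut (2 * L)) x
          gcongr <;> linarith
      _ = _ := by ring
  · simp [cut_eq_zero hρ hx, gsq_cut_eq_zero hρ hx]

/-- Decay of the positive part of the discrepancy on large balls. -/
lemma exists_integral_disc_le :
    ∃ C > 0, ∀ u : E 3 → ℝ, ContDiff ℝ 2 u → HasCompactSupport u → ∀ l : ℝ, 1 ≤ l → ∀ m : ℕ,
      ∀ κ > 0, defect u (2 * l ^ 2) + energy u (2 * l ^ 2) / (l ^ 2) ^ 2 ≤ 1 →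
      ∫ x in ball (0 : E 3) (l ^ 2), max 0 (disc u x) ≤
        (l ^ 2) ^ 2 * (C * (1 / (2 * m + 1) + 1 / l + κ / l + m ^ 2 / κ ^ 2)) *
          (defect u (2 * l ^ 2) + energy u (2 * l ^ 2) / (l ^ 2) ^ 2) := by
  obtain ⟨S, hS, hSob⟩ := exists_integral_sqrt_cube_le
  refine ⟨100 + 4 * (S * 2197), by positivity, fun u hu huc l hl m κ hκ hT1 => ?_⟩
  set L := l ^ 2 with hLdef
  set T := defect u (2 * L) + energy u (2 * L) / L ^ 2 with hT
  have hl0 : 0 < l := by linarith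
  have hL : 0 < L := by positivity
  have hL1 : 1 ≤ L := one_le_pow₀ hl
  have hen := energy_nonneg u (2 * L)
  have hde := defect_nonneg u (2 * L)
  have hT0 : 0 ≤ T := by positivity
  have hρ : 0 < 2 * L := by positivity
  have hη : ContDiff ℝ 1 (cut (2 * L) : E 3 → ℝ) := contDiff_cut
  have hc : HasCompactSupport (cut (2 * L) : E 3 → ℝ) := hasCompactSupport_cut hρ
  have cη := hη.continuous
  have cu := hu.continuous
  have cξ := (contDiff_disc hu).continuous
  have cg := continuous_gsq (u := u) (hu.of_le (by norm_num))
  have cW : Continuous fun x => W (u x) := (contDiff_W (k := 0)).continuous.comp cu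
  set I : ℝ := ∫ x : E 3, cut (2 * L) x ^ 2 with hI
  have hcut2 : Integrable fun x : E 3 => cut (2 * L) x ^ 2 :=
    integrable_of_cutoff hc (by fun_prop) fun x h1 _ => by simp [h1]
  have main : ∀ s > 0, ∫ x in ball (0 : E 3) L, max 0 (disc u x) ≤
      4 * (1 / 2 * (1 * defect u (2 * L) + (2 / (2 * m + 1) + 32 / L ^ 2) * energy u (2 * L))
        + κ * (S * 2197 * l ^ 3 * T) + (0 * defect u (2 * L) + 4 * m ^ 2 / κ ^ 2 * energy u (2 * L))
        + 2 * s * I) := by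
    intro s hs
    have h := isTruncation_max_sq_div hs
    set φ : ℝ → ℝ := fun t => max 0 (t - s) ^ 2 / t
    set φ' : ℝ → ℝ := fun t => 1 - (s / max t s) ^ 2
    have cφ : Continuous fun x => φ (disc u x) := h.continuous.comp cξ
    have hwd : ContDiff ℝ 1 fun y => φ (disc u y) * cut (2 * L) y ^ 2 :=
      (h.contDiff.comp (contDiff_disc hu)).mul (hη.pow 2)
    have hwc : HasCompactSupport fun y => φ (disc u y) * cut (2 * L) y ^ 2 :=
      HasCompactSupport.intro hc fun x hx => by simp [image_eq_zero_of_notMem_tsupport hx]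
    have hw0 : ∀ y, 0 ≤ φ (disc u y) * cut (2 * L) y ^ 2 := fun y =>
      mul_nonneg (h.nonneg _) (sq_nonneg _)
    have hsob : ∫ x, √(φ (disc u x) * cut (2 * L) x ^ 2) ^ 3 ≤ S * 2197 * l ^ 3 * T := by
      have h1 := hSob _ hwd hwc hw0 (13 * l * √T) (by positivity) ?_
      · refine h1.trans ?_
        have h2 : √T ^ 3 ≤ T := by
          have h3 : √T ≤ 1 := Real.sqrt_le_one.2 hT1
          calc √T ^ 3 = √T ^ 2 * √T := by ring
            _ = T * √T := by rw [Real.sq_sqrt hT0]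
            _ ≤ T * 1 := by gcongr
            _ = T := mul_one _
        calc S * (13 * l * √T) ^ 3 = S * 2197 * l ^ 3 * √T ^ 3 := by ring
          _ ≤ _ := by gcongr
      · refine (h.integral_norm_fderiv_le hu huc hL).trans ?_
        calc 165 * L * T ≤ 169 * L * T := by gcongr; norm_num
          _ = (13 * l * √T) ^ 2 := by rw [mul_pow, mul_pow, Real.sq_sqrt hT0]; ring
    have i1 : Integrable fun x => min (u x ^ (2 * m)) 1 * gsq u x * cut (2 * L) x ^ 2 :=
      integrable_of_cutoff hc (by fun_prop) fun x h1 _ => by simp [h1]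
    have i2 : Integrable fun x => √(φ (disc u x) * cut (2 * L) x ^ 2) ^ 3 :=
      integrable_of_cutoff hc ((Real.continuous_sqrt.comp hwd.continuous).pow 3)
        fun x h1 _ => by simp [h1]
    have i3 : Integrable (indicator (ball (0 : E 3) (2 * L))
        fun x => 4 * m ^ 2 / κ ^ 2 * W (u x)) :=
      (integrableOn_ball (by fun_prop) _).integrable_indicator measurableSet_ball
    have hsplit : ∫ x in ball (0 : E 3) L, max 0 (disc u x) ≤
        ∫ x, 4 * (1 / 2 * (min (u x ^ (2 * m)) 1 * gsq u x * cut (2 * L) x ^ 2)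
          + κ * √(φ (disc u x) * cut (2 * L) x ^ 2) ^ 3
          + indicator (ball (0 : E 3) (2 * L)) (fun x => 4 * m ^ 2 / κ ^ 2 * W (u x)) x
          + 2 * s * cut (2 * L) x ^ 2) := by
      have hW0 : ∀ x, 0 ≤ indicator (ball (0 : E 3) (2 * L))
          (fun x => 4 * m ^ 2 / κ ^ 2 * W (u x)) x := fun x =>
        indicator_nonneg (fun x _ => mul_nonneg (by positivity) (W_nonneg _)) x
      refine setIntegral_ball_le_integral (((((i1.const_mul _).add (i2.const_mul κ)).add i3).add
        (hcut2.const_mul _)).const_mul 4) (by fun_prop) (fun x hx => ?_) fun x => ?_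
      · have hx2 : x ∈ ball (0 : E 3) (2 * L) := ball_subset_ball (by linarith) hx
        have hcx : 1 / 2 ≤ cut (2 * L) x := half_le_cut hρ (by convert hx using 2; ring)
        rw [indicator_of_mem hx2]
        set c := cut (2 * L) x
        set ω := min (u x ^ (2 * m)) 1
        have hω0 : 0 ≤ ω := le_min (by rw [pow_mul]; positivity) zero_le_one
        have hω1 : ω ≤ 1 := min_le_right _ _
        have hω3 : (1 - ω) ^ 3 ≤ 4 * m ^ 2 * W (u x) := one_sub_min_pow_cube_le _ _
        have hφ1 : max 0 (disc u x) ≤ φ (disc u x) + 2 * s := le_max_sq_div_add hs _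
        have hφ0 := h.nonneg (disc u x)
        have hφ2 : φ (disc u x) ≤ gsq u x / 2 := by
          refine (h.le_max _).trans (max_le ?_ (disc_le_gsq u x))
          have := gsq_nonneg u x
          positivity
        have hy := sq_mul_le_young (Real.sqrt_nonneg (φ (disc u x) * c ^ 2))
          (show 0 ≤ 1 - ω by linarith) hκ
        rw [Real.sq_sqrt (hw0 x)] at hy
        have hy2 : (1 - ω) ^ 3 / κ ^ 2 ≤ 4 * m ^ 2 / κ ^ 2 * W (u x) := by
          rw [div_mul_eq_mul_div]; gcongr
        have hc4 : 1 ≤ 4 * c ^ 2 := by nlinarith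
        have h5 : max 0 (disc u x) ≤ 4 * c ^ 2 * (φ (disc u x) + 2 * s) :=
          hφ1.trans (le_mul_of_one_le_left (by positivity) hc4)
        have h6 : ω * c ^ 2 * φ (disc u x) ≤ ω * c ^ 2 * (gsq u x / 2) := by gcongr
        linarith
      · have := gsq_nonneg u x
        have h1 : 0 ≤ min (u x ^ (2 * m)) 1 := le_min (by rw [pow_mul]; positivity) zero_le_one
        have := hW0 x
        positivity
    refine hsplit.trans ?_
    have j12 : Integrable fun x => 1 / 2 * (min (u x ^ (2 * m)) 1 * gsq u x * cut (2 * L) x ^ 2)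
        + κ * √(φ (disc u x) * cut (2 * L) x ^ 2) ^ 3 := (i1.const_mul _).add (i2.const_mul κ)
    have j123 : Integrable fun x => 1 / 2 * (min (u x ^ (2 * m)) 1 * gsq u x * cut (2 * L) x ^ 2)
        + κ * √(φ (disc u x) * cut (2 * L) x ^ 2) ^ 3
        + indicator (ball (0 : E 3) (2 * L)) (fun x => 4 * m ^ 2 / κ ^ 2 * W (u x)) x := j12.add i3
    rw [integral_const_mul, integral_add j123 (hcut2.const_mul _), integral_add j12 i3,
      integral_add (i1.const_mul _) (i2.const_mul κ), integral_const_mul, integral_const_mul,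
      integral_const_mul, ← hI]
    have h3 : ∫ x, indicator (ball (0 : E 3) (2 * L)) (fun x => 4 * m ^ 2 / κ ^ 2 * W (u x)) x ≤
        0 * defect u (2 * L) + 4 * m ^ 2 / κ ^ 2 * energy u (2 * L) := by
      refine integral_le_defect_add_energy hu i3 (fun x hx => ?_) fun x hx => ?_
      · rw [indicator_of_mem hx, zero_mul, zero_add]
        exact mul_le_mul_of_nonneg_left (W_le_en u x) (by positivity)
      · rw [indicator_of_notMem hx]
    have h1 := integral_min_pow_mul_gsq_cut_le hu m hL
    have h2 := mul_le_mul_of_nonneg_left hsob hκ.le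
    linarith
  have hI0 : 0 ≤ I := integral_nonneg fun x => sq_nonneg _
  have lim := le_of_forall_pos_le_add (a := ∫ x in ball (0 : E 3) L, max 0 (disc u x))
    (b := 4 * (1 / 2 * (1 * defect u (2 * L) + (2 / (2 * m + 1) + 32 / L ^ 2) * energy u (2 * L))
        + κ * (S * 2197 * l ^ 3 * T)
        + (0 * defect u (2 * L) + 4 * m ^ 2 / κ ^ 2 * energy u (2 * L)))) fun e he => by
      refine (main (e / (8 * (I + 1))) (by positivity)).trans ?_
      have : 4 * (2 * (e / (8 * (I + 1))) * I) ≤ e := by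
        have : 4 * (2 * (e / (8 * (I + 1))) * I) = e * (I / (I + 1)) := by field_simp; ring
        rw [this]
        exact mul_le_of_le_one_right he.le ((div_le_one (by positivity)).2 (by linarith))
      linarith
  refine lim.trans ?_
  have hM : energy u (2 * L) = L ^ 2 * (energy u (2 * L) / L ^ 2) := by field_simp
  set M := energy u (2 * L) / L ^ 2 with hMdef
  have hM0 : 0 ≤ M := by positivity
  have hMT : M ≤ T := by linarith
  have hDT : defect u (2 * L) ≤ T := by linarith
  rw [hM]
  have hlL : l ≤ L := by nlinarith
  have hL2 : l ≤ L ^ 2 := by nlinarith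
  have b1 : defect u (2 * L) ≤ L ^ 2 * (1 / l) * T := by
    have : 1 ≤ L ^ 2 * (1 / l) := by rw [mul_one_div, one_le_div hl0]; exact hL2
    exact hDT.trans (le_mul_of_one_le_left hT0 this)
  have b2 : 32 / L ^ 2 * (L ^ 2 * M) ≤ 32 * (L ^ 2 * (1 / l) * T) := by
    have e : 32 / L ^ 2 * (L ^ 2 * M) = 32 * M := by field_simp
    have : 1 ≤ L ^ 2 * (1 / l) := by rw [mul_one_div, one_le_div hl0]; exact hL2
    have := hMT.trans (le_mul_of_one_le_left hT0 this)
    linarith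
  have b3 : 2 / (2 * (m : ℝ) + 1) * (L ^ 2 * M) ≤ 2 * (L ^ 2 * (1 / (2 * m + 1)) * T) := by
    calc 2 / (2 * (m : ℝ) + 1) * (L ^ 2 * M) ≤ 2 / (2 * (m : ℝ) + 1) * (L ^ 2 * T) := by gcongr
      _ = _ := by ring
  have b4 : κ * (S * 2197 * l ^ 3 * T) = S * 2197 * (L ^ 2 * (κ / l) * T) := by
    rw [hLdef]; field_simp
  have b5 : 4 * (m : ℝ) ^ 2 / κ ^ 2 * (L ^ 2 * M) ≤ 4 * (L ^ 2 * (m ^ 2 / κ ^ 2) * T) := by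
    calc 4 * (m : ℝ) ^ 2 / κ ^ 2 * (L ^ 2 * M) ≤ 4 * (m : ℝ) ^ 2 / κ ^ 2 * (L ^ 2 * T) := by gcongr
      _ = _ := by ring
  have p1 : 0 ≤ L ^ 2 * (1 / l) * T := by positivity
  have p2 : 0 ≤ L ^ 2 * (1 / (2 * (m : ℝ) + 1)) * T := by positivity
  have p3 : 0 ≤ L ^ 2 * (κ / l) * T := by positivity
  have p4 : 0 ≤ L ^ 2 * ((m : ℝ) ^ 2 / κ ^ 2) * T := by positivity
  have q1 : 0 ≤ S * 2197 * (L ^ 2 * (1 / l) * T) := by positivity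
  have q2 : 0 ≤ S * 2197 * (L ^ 2 * (1 / (2 * (m : ℝ) + 1)) * T) := by positivity
  have q4 : 0 ≤ S * 2197 * (L ^ 2 * ((m : ℝ) ^ 2 / κ ^ 2) * T) := by positivity
  rw [b4]
  have e : L ^ 2 * ((100 + 4 * (S * 2197)) * (1 / (2 * m + 1) + 1 / l + κ / l + m ^ 2 / κ ^ 2)) * T =
      100 * (L ^ 2 * (1 / (2 * (m : ℝ) + 1)) * T) + 100 * (L ^ 2 * (1 / l) * T)
      + 100 * (L ^ 2 * (κ / l) * T) + 100 * (L ^ 2 * ((m : ℝ) ^ 2 / κ ^ 2) * T)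
      + 4 * (S * 2197 * (L ^ 2 * (1 / (2 * (m : ℝ) + 1)) * T))
      + 4 * (S * 2197 * (L ^ 2 * (1 / l) * T))
      + 4 * (S * 2197 * (L ^ 2 * (κ / l) * T))
      + 4 * (S * 2197 * (L ^ 2 * ((m : ℝ) ^ 2 / κ ^ 2) * T)) := by ring
  rw [e]
  linarith

end DiscrepancyDecay

section Monotonicity

variable {n : ℕ} {u : E n → ℝ} {σ R : ℝ}

lemma contDiff_cut_mul_inv (hσ : 0 < σ) :
    ContDiff ℝ 1 fun x : E n => cut R x * (σ ^ 2 + ∑ i, x i ^ 2)⁻¹ := by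
  refine contDiff_cut.mul (ContDiff.inv (by fun_prop) fun x => ?_)
  positivity

lemma pd_cut_mul_inv (hσ : 0 < σ) (i : Fin n) (x : E n) :
    pd i (fun x => cut R x * (σ ^ 2 + ∑ i, x i ^ 2)⁻¹) x =
      -((4 * max 0 (1 - (∑ i, x i ^ 2) / R ^ 2) / R ^ 2 * (σ ^ 2 + ∑ i, x i ^ 2)⁻¹
        + 2 * cut R x * ((σ ^ 2 + ∑ i, x i ^ 2)⁻¹) ^ 2) * x i) := by
  have hD : 0 < σ ^ 2 + ∑ i, x i ^ 2 := by positivity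
  have hd : DifferentiableAt ℝ (fun x : E n => ∑ i, x i ^ 2) x := by fun_prop
  have h1 : HasDerivAt (fun t : ℝ => (σ ^ 2 + t)⁻¹) (-1 / (σ ^ 2 + ∑ i, x i ^ 2) ^ 2)
      (∑ i, x i ^ 2) := ((hasDerivAt_id _).const_add _).fun_inv hD.ne'
  have h2 : DifferentiableAt ℝ (fun x : E n => (σ ^ 2 + ∑ i, x i ^ 2)⁻¹) x :=
    (hd.const_add _).fun_inv hD.ne'
  rw [pd_mul (contDiff_cut.differentiable (by norm_num) x) h2, pd_cut, pd_comp h1 hd, pd_sum_sq]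
  field_simp
  ring

/-- The almost monotonicity formula for the energy density. -/
lemma energy_div_sq_le {u : E 3 → ℝ} (hu : ContDiff ℝ 2 u) (hσ : 0 < σ) (hR : 2 * σ ≤ R) :
    energy u σ / σ ^ 2 ≤ defect u R + 16 * (energy u R / R ^ 2)
      + 4 * ∫ x in ball (0 : E 3) R, max 0 (disc u x) * (σ ^ 2 + ∑ i, x i ^ 2)⁻¹ := by
  have hR0 : 0 < R := by linarith
  have hD : ∀ x : E 3, 0 < σ ^ 2 + ∑ i, x i ^ 2 := fun x => by positivity
  have cD : Continuous fun x : E 3 => (σ ^ 2 + ∑ i, x i ^ 2)⁻¹ :=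
    Continuous.inv₀ (by fun_prop) fun x => (hD x).ne'
  have ce := continuous_en hu
  have cc := continuous_chem hu
  have cξ := (contDiff_disc hu).continuous
  have cg := continuous_gsq (u := u) (hu.of_le (by norm_num))
  have ccut : Continuous (cut R : E 3 → ℝ) := contDiff_cut.continuous
  have hg := contDiff_cut_mul_inv (n := 3) (R := R) hσ
  have hc : HasCompactSupport fun x : E 3 => cut R x * (σ ^ 2 + ∑ i, x i ^ 2)⁻¹ :=
    (hasCompactSupport_cut hR0).mul_right
  have hP := integral_pohozaev hu hg hc
  have cp : ∀ i, Continuous (pd i u) := fun i => (hu.pd (m := 1) (by norm_num) i).continuous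
  have cgp : ∀ i, Continuous (pd i fun x : E 3 => cut R x * (σ ^ 2 + ∑ i, x i ^ 2)⁻¹) :=
    fun i => (hg.pd (m := 0) (by norm_num) i).continuous
  have cgd := continuous_gdot (hu.of_le (by norm_num)) hg
  set g : E 3 → ℝ := fun x => cut R x * (σ ^ 2 + ∑ i, x i ^ 2)⁻¹ with hgdef
  have cg0 := hg.continuous
  set J : E 3 → ℝ := fun x => chem u x * (∑ i, x i * pd i u x) * g x
    + en u x * ((3 : ℕ) * g x + ∑ i, x i * pd i g x)
      - gsq u x * g x - (∑ i, x i * pd i u x) * gdot u g x with hJ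
  have iJ : Integrable J := by
    refine integrable_of_cutoff hc ?_ fun x h1 h2 => ?_
    · fun_prop
    · simp [hJ, h1, h2, gdot_eq_zero h2]
  set G : E 3 → ℝ := fun x =>
    2 * σ ^ 2 * en u x * cut R x * ((σ ^ 2 + ∑ i, x i ^ 2)⁻¹) ^ 2 with hG
  have iG : Integrable G := integrable_of_cutoff (hasCompactSupport_cut hR0) (by fun_prop)
    fun x h1 _ => by simp [hG, h1]
  have key : ∀ x, G x - J x ≤ (4 * max 0 (1 - (∑ i, x i ^ 2) / R ^ 2) / R ^ 2) * en u x
      + 1 / 8 * (cut R x * chem u x ^ 2) + g x * max 0 (disc u x) := by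
    intro x
    set M := max 0 (1 - (∑ i, x i ^ 2) / R ^ 2) with hM
    have hM0 : 0 ≤ M := le_max_left _ _
    have hpd : ∀ i, pd i g x = -((4 * M / R ^ 2 * (σ ^ 2 + ∑ i, x i ^ 2)⁻¹
        + 2 * cut R x * ((σ ^ 2 + ∑ i, x i ^ 2)⁻¹) ^ 2) * x i) := fun i => pd_cut_mul_inv hσ i x
    set d := (σ ^ 2 + ∑ i, x i ^ 2)⁻¹ with hd
    have hd0 : 0 < d := inv_pos.2 (hD x)
    set c := cut R x with hcdef
    have hc0 : 0 ≤ c := cut_nonneg x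
    have hgx : g x = c * d := rfl
    set q := ∑ i, x i ^ 2 with hq
    have hq0 : 0 ≤ q := Finset.sum_nonneg fun i _ => sq_nonneg _
    set P := 4 * M / R ^ 2 * d with hPdef
    have hP0 : 0 ≤ P := by positivity
    set S := ∑ i, x i * pd i u x with hS
    have s1 : ∑ i, x i * pd i g x = -((P + 2 * c * d ^ 2) * q) := by
      simp only [hpd, hq, Finset.mul_sum, ← Finset.sum_neg_distrib]
      exact Finset.sum_congr rfl fun i _ => by ring
    have s2 : gdot u g x = -((P + 2 * c * d ^ 2) * S) := by
      simp only [gdot, hpd, hS, Finset.mul_sum, ← Finset.sum_neg_distrib]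
      exact Finset.sum_congr rfl fun i _ => by ring
    have hdq : d * (σ ^ 2 + q) = 1 := inv_mul_cancel₀ (hD x).ne'
    have hξ : gsq u x = en u x + disc u x := by unfold en disc; ring
    have he := en_nonneg u x
    have hJx : J x = chem u x * S * (c * d) + en u x * (3 * (c * d) - (P + 2 * c * d ^ 2) * q)
        - (en u x + disc u x) * (c * d) + (P + 2 * c * d ^ 2) * S ^ 2 := by
      simp only [hJ]
      rw [s1, s2, hξ, hgx]; push_cast; ring
    have hGx : G x = 2 * σ ^ 2 * en u x * c * d ^ 2 := rfl
    have e1 : 2 * σ ^ 2 * en u x * c * d ^ 2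
        = en u x * (2 * (c * d) - 2 * c * d ^ 2 * q) := by
      have : 2 * (c * d) = 2 * (c * d) * (d * (σ ^ 2 + q)) := by rw [hdq, mul_one]
      rw [this]; ring
    have e2 : P * q ≤ 4 * M / R ^ 2 := by
      have : d * q ≤ 1 := by nlinarith
      calc P * q = 4 * M / R ^ 2 * (d * q) := by rw [hPdef]; ring
        _ ≤ 4 * M / R ^ 2 * 1 := by gcongr
        _ = _ := mul_one _
    have e3 : en u x * (P * q) ≤ en u x * (4 * M / R ^ 2) := by gcongr
    have e4 : -(chem u x * S * (c * d)) - 2 * c * d ^ 2 * S ^ 2 ≤ 1 / 8 * (c * chem u x ^ 2) := by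
      have := mul_nonneg hc0 (sq_nonneg (4 * (d * S) + chem u x))
      nlinarith
    have e5 : disc u x * (c * d) ≤ max 0 (disc u x) * (c * d) := by
      gcongr; exact le_max_right _ _
    have e6 : 0 ≤ P * S ^ 2 := by positivity
    rw [hJx, hGx, e1, hgx]
    linarith
  have up : ∫ x, (G x - J x) ≤ ∫ x in ball (0 : E 3) R, (1 / 8 * chem u x ^ 2
      + 4 / R ^ 2 * en u x + max 0 (disc u x) * (σ ^ 2 + ∑ i, x i ^ 2)⁻¹) := by
    refine integral_le_setIntegral_ball (iG.sub iJ) (by fun_prop) (fun x _ => (key x).trans ?_)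
      fun x hx => (key x).trans ?_
    · have hM1 : max 0 (1 - (∑ i, x i ^ 2) / R ^ 2) ≤ 1 := by
        refine max_le zero_le_one ?_
        have : 0 ≤ (∑ i, x i ^ 2) / R ^ 2 := by positivity
        linarith
      have hc1 : cut R x ≤ 1 := cut_le_one x
      have hd0 : 0 < (σ ^ 2 + ∑ i, x i ^ 2)⁻¹ := inv_pos.2 (hD x)
      have he := en_nonneg u x
      have f1 : 4 * max 0 (1 - (∑ i, x i ^ 2) / R ^ 2) / R ^ 2 * en u x
          ≤ 4 * 1 / R ^ 2 * en u x := by gcongr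
      have f2 : cut R x * chem u x ^ 2 ≤ 1 * chem u x ^ 2 := by gcongr
      have f3 : g x * max 0 (disc u x)
          ≤ 1 * (σ ^ 2 + ∑ i, x i ^ 2)⁻¹ * max 0 (disc u x) := by
        simp only [hgdef]; gcongr
      linarith
    · rw [max_cut_eq_zero hR0 hx]
      simp [hgdef, cut_eq_zero hR0 hx]
  have low : ∫ x in ball (0 : E 3) σ, 1 / (4 * σ ^ 2) * en u x ≤ ∫ x, G x := by
    refine setIntegral_ball_le_integral iG (by fun_prop) (fun x hx => ?_) fun x => ?_
    · have hcx : 1 / 2 ≤ cut R x :=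
        half_le_cut hR0 (ball_subset_ball (by linarith) hx)
      rw [mem_ball_zero_iff] at hx
      have hd : (2 * σ ^ 2)⁻¹ ≤ (σ ^ 2 + ∑ i, x i ^ 2)⁻¹ := by
        refine inv_anti₀ (hD x) ?_
        rw [sum_sq_eq_norm_sq]
        nlinarith [norm_nonneg x]
      have he := en_nonneg u x
      calc 1 / (4 * σ ^ 2) * en u x = 2 * σ ^ 2 * en u x * (1 / 2) * ((2 * σ ^ 2)⁻¹) ^ 2 := by
            field_simp; ring
        _ ≤ G x := by simp only [hG]; gcongr
    · have := en_nonneg u x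
      have := cut_nonneg (ρ := R) x
      have := (inv_pos.2 (hD x)).le
      positivity
  rw [integral_const_mul] at low
  rw [integral_sub iG iJ, hP, sub_zero] at up
  have i1 : IntegrableOn (fun x => 1 / 8 * chem u x ^ 2) (ball (0 : E 3) R) :=
    integrableOn_ball (by fun_prop) R
  have i2 : IntegrableOn (fun x => 4 / R ^ 2 * en u x) (ball (0 : E 3) R) :=
    integrableOn_ball (by fun_prop) R
  have i3 : IntegrableOn (fun x => max 0 (disc u x) * (σ ^ 2 + ∑ i, x i ^ 2)⁻¹)
      (ball (0 : E 3) R) := integrableOn_ball (by fun_prop) R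
  have i12 : IntegrableOn (fun x => 1 / 8 * chem u x ^ 2 + 4 / R ^ 2 * en u x)
      (ball (0 : E 3) R) := i1.add i2
  rw [integral_add i12 i3, integral_add i1 i2, integral_const_mul, integral_const_mul] at up
  have hde := defect_nonneg u R
  have e0 : energy u σ / σ ^ 2 = 4 * (1 / (4 * σ ^ 2) * energy u σ) := by
    field_simp
  have e1 : 16 * (energy u R / R ^ 2) = 4 * (4 / R ^ 2 * energy u R) := by ring
  rw [e0, e1]
  change 1 / (4 * σ ^ 2) * energy u σ ≤ _ at low
  change _ ≤ 1 / 8 * defect u R + 4 / R ^ 2 * energy u R + _ at up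
  linarith

/-- Decomposition of a Newtonian-type integral into dyadic balls. -/
lemma setIntegral_mul_inv_le {F : E n → ℝ} (hF : Continuous F) (hF0 : ∀ x, 0 ≤ F x) {j K : ℕ}
    (hjK : j ≤ K) :
    ∫ x in ball (0 : E n) (256 ^ K), F x * ((256 ^ j : ℝ) ^ 2 + ∑ i, x i ^ 2)⁻¹ ≤
      65536 * ∑ k ∈ Finset.Ico j (K + 1), (∫ x in ball (0 : E n) (256 ^ k), F x) / (256 ^ k) ^ 2 := by
  have hD : ∀ x : E n, 0 < (256 ^ j : ℝ) ^ 2 + ∑ i, x i ^ 2 := fun x => by positivity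
  have cD : Continuous fun x : E n => ((256 ^ j : ℝ) ^ 2 + ∑ i, x i ^ 2)⁻¹ :=
    Continuous.inv₀ (by fun_prop) fun x => (hD x).ne'
  have hI0 : ∀ r, 0 ≤ ∫ x in ball (0 : E n) r, F x := fun r =>
    setIntegral_nonneg measurableSet_ball fun x _ => hF0 x
  induction K, hjK using Nat.le_induction with
  | base =>
    rw [Nat.Ico_succ_singleton, Finset.sum_singleton]
    calc ∫ x in ball (0 : E n) (256 ^ j), F x * ((256 ^ j : ℝ) ^ 2 + ∑ i, x i ^ 2)⁻¹
        ≤ ∫ x in ball (0 : E n) (256 ^ j), F x * ((256 ^ j : ℝ) ^ 2)⁻¹ := by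
          refine setIntegral_mono_on (integrableOn_ball (by fun_prop) _)
            (integrableOn_ball (by fun_prop) _) measurableSet_ball fun x _ => ?_
          refine mul_le_mul_of_nonneg_left (inv_anti₀ (by positivity) ?_) (hF0 x)
          have : 0 ≤ ∑ i, x i ^ 2 := by positivity
          linarith
      _ = (∫ x in ball (0 : E n) (256 ^ j), F x) / (256 ^ j) ^ 2 := by
          rw [integral_mul_const, div_eq_mul_inv]
      _ ≤ _ := le_mul_of_one_le_left (div_nonneg (hI0 _) (by positivity)) (by norm_num)
  | succ K hjK ih =>
    rw [Finset.sum_Ico_succ_top (by omega), mul_add]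
    have hsub : ball (0 : E n) (256 ^ K) ⊆ ball (0 : E n) (256 ^ (K + 1)) :=
      ball_subset_ball (pow_le_pow_right₀ (by norm_num) (by omega))
    have i1 : IntegrableOn (fun x => F x * ((256 ^ j : ℝ) ^ 2 + ∑ i, x i ^ 2)⁻¹)
      (ball (0 : E n) (256 ^ (K + 1))) := integrableOn_ball (by fun_prop) _
    have i2 : IntegrableOn (fun x => F x * ((256 ^ K : ℝ) ^ 2)⁻¹)
      (ball (0 : E n) (256 ^ (K + 1))) := integrableOn_ball (by fun_prop) _
    have hd := setIntegral_sdiff measurableSet_ball i1 hsub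
    have h2 : ∫ x in ball (0 : E n) (256 ^ (K + 1)) \ ball (0 : E n) (256 ^ K),
        F x * ((256 ^ j : ℝ) ^ 2 + ∑ i, x i ^ 2)⁻¹ ≤
        65536 * ((∫ x in ball (0 : E n) (256 ^ (K + 1)), F x) / (256 ^ (K + 1)) ^ 2) := by
      calc _ ≤ ∫ x in ball (0 : E n) (256 ^ (K + 1)) \ ball (0 : E n) (256 ^ K),
              F x * ((256 ^ K : ℝ) ^ 2)⁻¹ := by
            refine setIntegral_mono_on (i1.mono_set sdiff_subset) (i2.mono_set sdiff_subset)
              (measurableSet_ball.diff measurableSet_ball) fun x hx => ?_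
            refine mul_le_mul_of_nonneg_left (inv_anti₀ (by positivity) ?_) (hF0 x)
            have := hx.2
            rw [mem_ball_zero_iff, not_lt] at this
            rw [sum_sq_eq_norm_sq]
            have h3 : ((256 : ℝ) ^ K) ^ 2 ≤ ‖x‖ ^ 2 := by gcongr
            have : 0 ≤ ((256 : ℝ) ^ j) ^ 2 := by positivity
            linarith
        _ ≤ ∫ x in ball (0 : E n) (256 ^ (K + 1)), F x * ((256 ^ K : ℝ) ^ 2)⁻¹ :=
            setIntegral_mono_set i2 (Eventually.of_forall fun x =>
              mul_nonneg (hF0 x) (by positivity)) sdiff_subset.eventuallyLE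
        _ = _ := by
            rw [integral_mul_const, pow_succ]; field_simp; ring
    linarith

end Monotonicity

section Iteration

lemma sum_Ico_inv_two_pow_le (j K : ℕ) : ∑ k ∈ Finset.Ico j K, ((2 : ℝ)⁻¹) ^ k ≤ 2 * 2⁻¹ ^ j := by
  rcases le_or_gt j K with h | h
  · have : ∑ k ∈ Finset.Ico j K, ((2 : ℝ)⁻¹) ^ k = 2 * 2⁻¹ ^ j - 2 * 2⁻¹ ^ K := by
      induction K, h using Nat.le_induction with
      | base => simp
      | succ K h ih => rw [Finset.sum_Ico_succ_top h, ih]; ring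
    rw [this]
    have : (0 : ℝ) ≤ 2 * 2⁻¹ ^ K := by positivity
    linarith
  · rw [Finset.Ico_eq_empty_of_le h.le]; simp

/-- A backward discrete Gronwall inequality with geometrically decaying weights. -/
lemma le_of_backward_gronwall {e : ℕ → ℝ} {F A B δ : ℝ} {k₀ K : ℕ} (hA : 0 ≤ A)
    (hB : 0 ≤ B) (hF : 0 ≤ F) (he : ∀ k, 0 ≤ e k) (hk : B * (2 * 2⁻¹ ^ k₀) ≤ 1 / 4)
    (hsmall : F + (2 * A + 1) * (F + e K) ≤ δ)
    (h : ∀ j, k₀ ≤ j → j < K → (∀ k, j ≤ k → k < K → F + e (k + 1) ≤ δ) →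
      e j ≤ A * (F + e K) + B * ∑ k ∈ Finset.Ico j K, 2⁻¹ ^ k * (F + e (k + 1)))
    {j : ℕ} (hj : k₀ ≤ j) (hjK : j ≤ K) : e j ≤ (2 * A + 1) * (F + e K) := by
  have hT : 0 ≤ F + e K := add_nonneg hF (he K)
  induction hd : K - j using Nat.strong_induction_on generalizing j with
  | _ d ih =>
    have hM : e K ≤ (2 * A + 1) * (F + e K) := by nlinarith [he K]
    rcases hjK.eq_or_lt with rfl | hlt
    · exact hM
    have hs : ∀ k, j ≤ k → k < K → e (k + 1) ≤ (2 * A + 1) * (F + e K) := fun k h1 h2 =>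
      ih (K - (k + 1)) (by omega) (by omega) (by omega) rfl
    have h1 := h j hj hlt fun k h1 h2 => by linarith [hs k h1 h2]
    have h2 : ∑ k ∈ Finset.Ico j K, (2 : ℝ)⁻¹ ^ k * (F + e (k + 1)) ≤
        2 * 2⁻¹ ^ k₀ * ((2 * A + 2) * (F + e K)) := by
      calc ∑ k ∈ Finset.Ico j K, (2 : ℝ)⁻¹ ^ k * (F + e (k + 1))
          ≤ ∑ k ∈ Finset.Ico j K, (2 : ℝ)⁻¹ ^ k * ((2 * A + 2) * (F + e K)) := by
            refine Finset.sum_le_sum fun k hk => mul_le_mul_of_nonneg_left ?_ (by positivity)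
            rw [Finset.mem_Ico] at hk
            linarith [hs k hk.1 hk.2, he K]
        _ = (∑ k ∈ Finset.Ico j K, (2 : ℝ)⁻¹ ^ k) * ((2 * A + 2) * (F + e K)) := by
            rw [Finset.sum_mul]
        _ ≤ 2 * 2⁻¹ ^ j * ((2 * A + 2) * (F + e K)) := by
            gcongr; exact sum_Ico_inv_two_pow_le j K
        _ ≤ _ := by
            gcongr ?_ * _
            exact mul_le_mul_of_nonneg_left
              (pow_le_pow_of_le_one (by norm_num) (by norm_num) hj) (by norm_num)
    have h3 : B * ∑ k ∈ Finset.Ico j K, (2 : ℝ)⁻¹ ^ k * (F + e (k + 1)) ≤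
        1 / 4 * ((2 * A + 2) * (F + e K)) := by
      calc _ ≤ B * (2 * 2⁻¹ ^ k₀ * ((2 * A + 2) * (F + e K))) := by gcongr
        _ = B * (2 * 2⁻¹ ^ k₀) * ((2 * A + 2) * (F + e K)) := by ring
        _ ≤ _ := by gcongr
    nlinarith [mul_nonneg hA hT]

/-- Geometric decay of the positive part of the discrepancy along dyadic scales. -/
lemma exists_integral_disc_dyadic_le :
    ∃ C > 0, ∀ u : E 3 → ℝ, ContDiff ℝ 2 u → HasCompactSupport u → ∀ k : ℕ, ∀ F : ℝ,
      defect u (256 ^ (k + 1)) ≤ F →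
      F + energy u (256 ^ (k + 1)) / (256 ^ (k + 1)) ^ 2 ≤ 1 / 65536 →
      (∫ x in ball (0 : E 3) (256 ^ k), max 0 (disc u x)) / (256 ^ k) ^ 2 ≤
        C * (2⁻¹ ^ k * (F + energy u (256 ^ (k + 1)) / (256 ^ (k + 1)) ^ 2)) := by
  obtain ⟨C, hC, h⟩ := exists_integral_disc_le
  refine ⟨C * 4 * 65536, by positivity, fun u hu huc k F hF hs => ?_⟩
  have hl : (16 ^ k : ℝ) ^ 2 = 256 ^ k := by rw [← pow_mul, mul_comm, pow_mul]; norm_num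
  have hL : (0 : ℝ) < 256 ^ k := by positivity
  have hle : 2 * (256 ^ k : ℝ) ≤ 256 ^ (k + 1) := by rw [pow_succ]; linarith
  have hT : defect u (2 * 256 ^ k) + energy u (2 * 256 ^ k) / (256 ^ k) ^ 2 ≤
      65536 * (F + energy u (256 ^ (k + 1)) / (256 ^ (k + 1)) ^ 2) := by
    have h1 := defect_mono hu hle
    have h2 : energy u (2 * 256 ^ k) / (256 ^ k) ^ 2 ≤ energy u (256 ^ (k + 1)) / (256 ^ k) ^ 2 := by
      gcongr; exact energy_mono hu hle
    have h3 : energy u (256 ^ (k + 1)) / (256 ^ k) ^ 2 =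
        65536 * (energy u (256 ^ (k + 1)) / (256 ^ (k + 1)) ^ 2) := by
      rw [pow_succ]; field_simp; ring
    have h4 := defect_nonneg u (256 ^ (k + 1))
    linarith
  have h1 := h u hu huc (16 ^ k) (one_le_pow₀ (by norm_num)) (2 ^ k) (4 ^ k) (by positivity)
    (by rw [hl]; linarith)
  rw [hl] at h1
  have h16 : ((2 : ℝ)⁻¹ ^ k) = 1 / 2 ^ k := by rw [inv_pow, one_div]
  have hb : 1 / (2 * ((2 ^ k : ℕ) : ℝ) + 1) + 1 / 16 ^ k + 4 ^ k / 16 ^ k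
      + ((2 ^ k : ℕ) : ℝ) ^ 2 / (4 ^ k) ^ 2 ≤ 4 * 2⁻¹ ^ k := by
    have h2 : (0 : ℝ) < 2 ^ k := by positivity
    have h21 : (1 : ℝ) ≤ 2 ^ k := one_le_pow₀ (by norm_num)
    have e4 : (4 : ℝ) ^ k = (2 ^ k) ^ 2 := by rw [← pow_mul, mul_comm, pow_mul]; norm_num
    have e16 : (16 : ℝ) ^ k = (2 ^ k) ^ 4 := by rw [← pow_mul, mul_comm, pow_mul]; norm_num
    rw [h16, e4, e16]; push_cast
    set p : ℝ := 2 ^ k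
    have t1 : 1 / (2 * p + 1) ≤ 1 / p := by gcongr; linarith
    have t2 : 1 / p ^ 4 ≤ 1 / p := by gcongr; exact le_self_pow₀ h21 (by norm_num)
    have t3 : p ^ 2 / p ^ 4 ≤ 1 / p := by
      rw [show p ^ 2 / p ^ 4 = 1 / p ^ 2 by field_simp]
      gcongr; exact le_self_pow₀ h21 (by norm_num)
    have t4 : p ^ 2 / (p ^ 2) ^ 2 ≤ 1 / p := by
      rw [show p ^ 2 / (p ^ 2) ^ 2 = 1 / p ^ 2 by field_simp]
      gcongr; exact le_self_pow₀ h21 (by norm_num)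
    linarith
  rw [div_le_iff₀ (by positivity)]
  refine h1.trans ?_
  have h0 : 0 ≤ defect u (2 * 256 ^ k) + energy u (2 * 256 ^ k) / (256 ^ k) ^ 2 :=
    add_nonneg (defect_nonneg _ _) (div_nonneg (energy_nonneg _ _) (by positivity))
  calc _ ≤ (256 ^ k) ^ 2 * (C * (4 * 2⁻¹ ^ k)) *
        (65536 * (F + energy u (256 ^ (k + 1)) / (256 ^ (k + 1)) ^ 2)) := by gcongr
    _ = _ := by ring

/-- Smallness of the scaled energy propagates from large scales down to a fixed scale. -/
lemma exists_energy_le : ∃ k₀ : ℕ, 1 ≤ k₀ ∧ ∃ M > 0, ∃ δ > 0, ∀ u : E 3 → ℝ, ContDiff ℝ 2 u →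
    HasCompactSupport u → ∀ K, k₀ ≤ K →
    defect u (256 ^ K) + energy u (256 ^ K) / (256 ^ K) ^ 2 ≤ δ →
    energy u (256 ^ k₀) ≤ M * (defect u (256 ^ K) + energy u (256 ^ K) / (256 ^ K) ^ 2) := by
  obtain ⟨C, hC, hdisc⟩ := exists_integral_disc_dyadic_le
  set A : ℝ := 16 + 4 * 65536 with hA
  set B : ℝ := 4 * 65536 * C with hB
  have hB0 : 0 < B := by positivity
  obtain ⟨k₁, hk₁⟩ := exists_pow_lt_of_lt_one (show 0 < 1 / (8 * B) by positivity)
    (show (2 : ℝ)⁻¹ < 1 by norm_num)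
  have hk₀ : B * (2 * 2⁻¹ ^ (k₁ + 1)) ≤ 1 / 4 := by
    have : B * (1 / (8 * B)) = 1 / 8 := by field_simp
    have h2 : B * 2⁻¹ ^ k₁ ≤ B * (1 / (8 * B)) := by gcongr
    rw [pow_succ]; linarith
  refine ⟨k₁ + 1, by omega, (256 ^ (k₁ + 1)) ^ 2 * (2 * A + 1), by positivity,
    1 / 65536 / (2 * A + 2), by positivity, fun u hu huc K hK hδ => ?_⟩
  set e : ℕ → ℝ := fun k => energy u (256 ^ k) / (256 ^ k) ^ 2 with he
  set F := defect u (256 ^ K) with hF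
  have hF0 : 0 ≤ F := defect_nonneg _ _
  have he0 : ∀ k, 0 ≤ e k := fun k => div_nonneg (energy_nonneg _ _) (by positivity)
  have hδ' : (2 * A + 2) * (F + e K) ≤ 1 / 65536 := by
    rw [le_div_iff₀ (by positivity)] at hδ
    linarith
  have := le_of_backward_gronwall (e := e) (F := F) (A := A) (B := B) (δ := 1 / 65536) (K := K)
    (k₀ := k₁ + 1) (by positivity) hB0.le hF0 he0 hk₀ (by linarith [he0 K])
    (fun j _ hjK hsm => ?_) le_rfl hK
  · simp only [he] at this
    rw [div_le_iff₀ (by positivity)] at this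
    linarith
  have cξ := (contDiff_disc hu).continuous
  have h1 := energy_div_sq_le hu (σ := 256 ^ j) (R := 256 ^ K) (by positivity) (by
    calc 2 * (256 : ℝ) ^ j ≤ 256 ^ (j + 1) := by
          rw [pow_succ]; have : (0 : ℝ) < 256 ^ j := by positivity
          linarith
      _ ≤ 256 ^ K := pow_le_pow_right₀ (by norm_num) hjK)
  have h2 := setIntegral_mul_inv_le (F := fun x => max 0 (disc u x)) (by fun_prop)
    (fun x => le_max_left _ _) hjK.le
  rw [Finset.sum_Ico_succ_top hjK.le] at h2
  have h3 : (∫ x in ball (0 : E 3) (256 ^ K), max 0 (disc u x)) / (256 ^ K) ^ 2 ≤ e K := by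
    simp only [he]
    gcongr
    exact setIntegral_mono_on (integrableOn_ball (by fun_prop) _)
      (integrableOn_ball (continuous_en hu) _) measurableSet_ball fun x _ => max_disc_le_en u x
  have h4 : ∑ k ∈ Finset.Ico j K, (∫ x in ball (0 : E 3) (256 ^ k), max 0 (disc u x)) / (256 ^ k) ^ 2
      ≤ C * ∑ k ∈ Finset.Ico j K, 2⁻¹ ^ k * (F + e (k + 1)) := by
    rw [Finset.mul_sum]
    refine Finset.sum_le_sum fun k hk => ?_
    rw [Finset.mem_Ico] at hk
    exact hdisc u hu huc k F (defect_mono hu (pow_le_pow_right₀ (by norm_num) hk.2))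
      (hsm k hk.1 hk.2)
  change e j ≤ F + 16 * e K + _ at h1
  rw [hA, hB]
  have := he0 K
  nlinarith

end Iteration

section LocalEstimate

variable {n : ℕ} {u : E n → ℝ}

lemma integral_hsq_cut_le (hu : ContDiff ℝ 2 u) (huc : HasCompactSupport u) :
    ∫ x, hsq u x * cut 2 x ^ 2 ≤ 24 * defect u 2 + 592 * energy u 2 := by
  have hη : ContDiff ℝ 1 (cut 2 : E n → ℝ) := contDiff_cut
  have hc : HasCompactSupport (cut 2 : E n → ℝ) := hasCompactSupport_cut (by norm_num)
  have cη := hη.continuous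
  have cgη := continuous_gsq hη
  have cu := hu.continuous
  have cg := continuous_gsq (u := u) (hu.of_le (by norm_num))
  have cc := continuous_chem hu
  have cl := continuous_lap hu
  have cW : Continuous fun x => W' (u x) := (contDiff_W' (k := 0)).continuous.comp cu
  have iW : Integrable fun x => W' (u x) ^ 2 * cut 2 x ^ 2 :=
    integrable_of_cutoff hc (by fun_prop) fun x h1 _ => by simp [h1]
  have ic : Integrable fun x => 8 * chem u x ^ 2 * cut 2 x ^ 2 + 6 * gsq u x * gsq (cut 2) x :=
    integrable_of_cutoff hc (by fun_prop) fun x h1 h2 => by simp [h1, gsq_eq_zero h2]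
  have iR : Integrable fun x => 2 * gsq u x * cut 2 x ^ 2 + 2 * chem u x ^ 2 * cut 2 x ^ 2
      + 8 * gsq u x * gsq (cut 2) x :=
    integrable_of_cutoff hc (by fun_prop) fun x h1 h2 => by simp [h1, gsq_eq_zero h2]
  have iL : Integrable fun x => 4 * lap u x ^ 2 * cut 2 x ^ 2 + 6 * gsq u x * gsq (cut 2) x :=
    integrable_of_cutoff hc (by fun_prop) fun x h1 h2 => by simp [h1, gsq_eq_zero h2]
  calc ∫ x, hsq u x * cut 2 x ^ 2
      ≤ ∫ x, (4 * lap u x ^ 2 * cut 2 x ^ 2 + 6 * gsq u x * gsq (cut 2) x) :=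
        integral_hsq_le hu huc hη hc
    _ ≤ ∫ x, (8 * (W' (u x) ^ 2 * cut 2 x ^ 2)
          + (8 * chem u x ^ 2 * cut 2 x ^ 2 + 6 * gsq u x * gsq (cut 2) x)) := by
        refine integral_mono iL ((iW.const_mul 8).add ic) fun x => ?_
        have h : lap u x ^ 2 ≤ 2 * W' (u x) ^ 2 + 2 * chem u x ^ 2 := by
          rw [lap_eq]; nlinarith [sq_nonneg (W' (u x) + chem u x)]
        have := mul_le_mul_of_nonneg_right h (sq_nonneg (cut 2 x))
        simp only
        linarith
    _ = 8 * (∫ x, W' (u x) ^ 2 * cut 2 x ^ 2)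
          + ∫ x, (8 * chem u x ^ 2 * cut 2 x ^ 2 + 6 * gsq u x * gsq (cut 2) x) := by
        rw [integral_add (iW.const_mul 8) ic, integral_const_mul]
    _ ≤ 8 * (∫ x, (2 * gsq u x * cut 2 x ^ 2 + 2 * chem u x ^ 2 * cut 2 x ^ 2
          + 8 * gsq u x * gsq (cut 2) x))
          + ∫ x, (8 * chem u x ^ 2 * cut 2 x ^ 2 + 6 * gsq u x * gsq (cut 2) x) := by
        have := integral_W'_sq_le hu hη hc
        linarith
    _ = ∫ x, (8 * (2 * gsq u x * cut 2 x ^ 2 + 2 * chem u x ^ 2 * cut 2 x ^ 2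
          + 8 * gsq u x * gsq (cut 2) x)
          + (8 * chem u x ^ 2 * cut 2 x ^ 2 + 6 * gsq u x * gsq (cut 2) x)) := by
        rw [integral_add (iR.const_mul 8) ic, integral_const_mul]
    _ ≤ _ := by
        refine integral_le_defect_add_energy hu ((iR.const_mul 8).add ic) (fun x _ => ?_)
          fun x hx => ?_
        · have h1 : cut 2 x ^ 2 ≤ 1 := pow_le_one₀ (cut_nonneg x) (cut_le_one x)
          have h2 : gsq (cut 2) x ≤ 4 := (gsq_cut_le (by norm_num) x).trans (by norm_num)
          have h3 := gsq_nonneg u x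
          have h4 := mul_le_mul_of_nonneg_left h1 h3
          have h5 := mul_le_mul_of_nonneg_left h2 h3
          have h6 := mul_le_mul_of_nonneg_left h1 (sq_nonneg (chem u x))
          have h7 := half_gsq_le_en u x
          simp only [Pi.add_apply]
          linarith
        · simp [cut_eq_zero (by norm_num : (0 : ℝ) < 2) hx,
            gsq_cut_eq_zero (by norm_num : (0 : ℝ) < 2) hx]

lemma integral_gsq_cut_mul_pd_le (hu : ContDiff ℝ 2 u) (huc : HasCompactSupport u) (i : Fin n) :
    ∫ x, gsq (fun y => cut 2 y * pd i u y) x ≤ 1200 * (defect u 2 + energy u 2) := by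
  have hη : ContDiff ℝ 1 (cut 2 : E n → ℝ) := contDiff_cut
  have hc : HasCompactSupport (cut 2 : E n → ℝ) := hasCompactSupport_cut (by norm_num)
  have hp : ContDiff ℝ 1 (pd i u) := hu.pd (by norm_num) i
  have cη := hη.continuous
  have cgη := continuous_gsq hη
  have cg := continuous_gsq (u := u) (hu.of_le (by norm_num))
  have ch := continuous_hsq hu
  have cv := continuous_gsq (hη.mul hp)
  have hpd : ∀ j x, pd j (fun y => cut 2 y * pd i u y) x =
      pd j (cut 2) x * pd i u x + cut 2 x * pd j (pd i u) x := fun j x => by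
    rw [pd_mul (hη.differentiable (by norm_num) x) (hp.differentiable (by norm_num) x)]
  have hle : ∀ x, gsq (fun y => cut 2 y * pd i u y) x ≤
      2 * (hsq u x * cut 2 x ^ 2) + 2 * (gsq u x * gsq (cut 2) x) := by
    intro x
    have h1 : gsq (fun y => cut 2 y * pd i u y) x ≤
        2 * ((∑ j, pd j (pd i u) x ^ 2) * cut 2 x ^ 2) + 2 * (pd i u x ^ 2 * gsq (cut 2) x) := by
      simp only [gsq, hpd, Finset.mul_sum, Finset.sum_mul, ← Finset.sum_add_distrib]
      refine Finset.sum_le_sum fun j _ => ?_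
      nlinarith [sq_nonneg (pd j (cut 2) x * pd i u x - cut 2 x * pd j (pd i u) x)]
    have h2 : pd i u x ^ 2 ≤ gsq u x :=
      Finset.single_le_sum (f := fun i => pd i u x ^ 2) (fun j _ => sq_nonneg _) (Finset.mem_univ i)
    have h3 : ∑ j, pd j (pd i u) x ^ 2 ≤ hsq u x := by
      rw [hsq, Finset.sum_comm]
      exact Finset.single_le_sum (f := fun i => ∑ j, pd j (pd i u) x ^ 2)
        (fun j _ => Finset.sum_nonneg fun _ _ => sq_nonneg _) (Finset.mem_univ i)
    have h4 := mul_le_mul_of_nonneg_right h2 (gsq_nonneg (cut 2) x)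
    have h5 := mul_le_mul_of_nonneg_right h3 (sq_nonneg (cut 2 x))
    linarith
  have i1 : Integrable fun x => hsq u x * cut 2 x ^ 2 :=
    integrable_of_cutoff hc (by fun_prop) fun x h1 _ => by simp [h1]
  have i2 : Integrable fun x => gsq u x * gsq (cut 2) x :=
    integrable_of_cutoff hc (by fun_prop) fun x _ h2 => by simp [gsq_eq_zero h2]
  have i0 : Integrable (gsq fun y => cut 2 y * pd i u y) :=
    integrable_of_cutoff hc cv fun x h1 h2 => gsq_eq_zero fun j => by rw [hpd, h1, h2]; ring
  have h2 : ∫ x, gsq u x * gsq (cut 2) x ≤ 0 * defect u 2 + 8 * energy u 2 := by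
    refine integral_le_defect_add_energy hu i2 (fun x _ => ?_) fun x hx => ?_
    · have h2 : gsq (cut 2) x ≤ 4 := (gsq_cut_le (by norm_num) x).trans (by norm_num)
      have := mul_le_mul_of_nonneg_left h2 (gsq_nonneg u x)
      have := half_gsq_le_en u x
      linarith
    · simp [gsq_cut_eq_zero (by norm_num : (0 : ℝ) < 2) hx]
  have h1 := integral_hsq_cut_le hu huc
  have h3 := integral_mono i0 ((i1.const_mul 2).add (i2.const_mul 2)) hle
  rw [integral_add' (i1.const_mul 2) (i2.const_mul 2), integral_const_mul, integral_const_mul] at h3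
  have := defect_nonneg u 2
  linarith

lemma gsq_pow_three_le (u : E 3 → ℝ) (x : E 3) : gsq u x ^ 3 ≤ 9 * ∑ i, pd i u x ^ 6 := by
  have h3 := pow_sum_div_card_le_sum_pow (s := Finset.univ)
    (f := fun i : Fin 3 => pd i u x ^ 2) (fun i _ => sq_nonneg _) 2
  simp only [← pow_mul, Finset.card_univ, Fintype.card_fin] at h3
  rw [div_le_iff₀ (by norm_num)] at h3
  refine h3.trans (le_of_eq ?_)
  norm_num
  ring

lemma exists_integral_gsq_cube_le :
    ∃ C > 0, ∀ u : E 3 → ℝ, ContDiff ℝ 2 u → HasCompactSupport u →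
      ∫ x in ball (0 : E 3) 1, gsq u x ^ 3 ≤ C * (defect u 2 + energy u 2) ^ 3 := by
  obtain ⟨C, hC, h⟩ := exists_integral_pow_six_le
  refine ⟨576 * 3 * (C * 1200 ^ 3), by positivity, fun u hu huc => ?_⟩
  have hc : HasCompactSupport (cut 2 : E 3 → ℝ) := hasCompactSupport_cut (by norm_num)
  have hp : ∀ i, ContDiff ℝ 1 (pd i u) := fun i => hu.pd (by norm_num) i
  have cg := continuous_gsq (u := u) (hu.of_le (by norm_num))
  have hv : ∀ i, ContDiff ℝ 1 fun x => cut 2 x * pd i u x := fun i => contDiff_cut.mul (hp i)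
  have hvc : ∀ i, HasCompactSupport fun x => cut 2 x * pd i u x := fun i => hc.mul_right
  have iv : ∀ i, Integrable fun x => (cut 2 x * pd i u x) ^ 6 := fun i =>
    integrable_of_cutoff hc ((hv i).continuous.pow 6) fun x h1 _ => by simp [h1]
  calc ∫ x in ball (0 : E 3) 1, gsq u x ^ 3
      ≤ ∫ x, ∑ i, 576 * (cut 2 x * pd i u x) ^ 6 := by
        refine setIntegral_ball_le_integral (integrable_finsetSum _ fun i _ => (iv i).const_mul _)
          (by fun_prop) (fun x hx => ?_) fun x => Finset.sum_nonneg fun i _ => by positivity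
        have hcx : 1 / 2 ≤ cut 2 x := half_le_cut (by norm_num) (by simpa using hx)
        have h1 : ∀ i, pd i u x ^ 6 ≤ 64 * (cut 2 x * pd i u x) ^ 6 := fun i => by
          have h6 : (1 / 2 : ℝ) ^ 6 ≤ cut 2 x ^ 6 := by gcongr
          have h7 : 0 ≤ pd i u x ^ 6 := by positivity
          rw [mul_pow]
          nlinarith
        refine (gsq_pow_three_le u x).trans ?_
        rw [Finset.mul_sum]
        refine Finset.sum_le_sum fun i _ => ?_
        linarith [h1 i]
    _ = ∑ i, 576 * ∫ x, (cut 2 x * pd i u x) ^ 6 := by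
        rw [integral_finsetSum _ fun i _ => (iv i).const_mul _]
        simp only [integral_const_mul]
    _ ≤ ∑ i : Fin 3, 576 * (C * (1200 * (defect u 2 + energy u 2)) ^ 3) := by
        refine Finset.sum_le_sum fun i _ => ?_
        have h1 := h _ (hv i) (hvc i)
        have h2 := integral_gsq_cut_mul_pd_le hu huc i
        have h3 : 0 ≤ ∫ x, gsq (fun y => cut 2 y * pd i u y) x :=
          integral_nonneg fun x => gsq_nonneg _ x
        have h4 : (∫ x, gsq (fun y => cut 2 y * pd i u y) x) ^ 3 ≤
          (1200 * (defect u 2 + energy u 2)) ^ 3 := by gcongr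
        have := mul_le_mul_of_nonneg_left h4 hC.le
        linarith
    _ = 576 * 3 * (C * 1200 ^ 3) * (defect u 2 + energy u 2) ^ 3 := by
        rw [Finset.sum_const, Finset.card_univ, Fintype.card_fin, nsmul_eq_mul]
        push_cast
        ring

lemma setIntegral_unitBall_comp_smul_le {F : E n → ℝ} (hF : Continuous F) (h0 : ∀ x, 0 ≤ F x)
    {t : ℝ} (ht0 : 0 < t) (ht1 : t ≤ 1) :
    t ^ n * ∫ x in ball (0 : E n) 1, F (t • x) ≤ ∫ x in ball (0 : E n) 1, F x := by
  rw [Measure.setIntegral_comp_smul_of_pos _ _ _ ht0, smul_unitBall ht0.ne', finrank_euclideanSpace,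
    Fintype.card_fin, smul_eq_mul, Real.norm_of_nonneg ht0.le, mul_inv_cancel_left₀ (by positivity)]
  exact setIntegral_ball_mono hF h0 ht1

/-- A Morrey-type estimate of the value at the origin. -/
lemma volume_mul_le_integral {v : E 3 → ℝ} (hv : ContDiff ℝ 1 v) {τ : ℝ} (hτ : 0 < τ) :
    volume.real (ball (0 : E 3) 1) * v 0 ≤ (∫ x in ball (0 : E 3) 1, v x)
      + 2 * τ * volume.real (ball (0 : E 3) 1)
      + 2 / τ ^ 5 * ∫ x in ball (0 : E 3) 1, gsq v x ^ 3 := by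
  have cv := hv.continuous
  have cg := continuous_gsq hv
  set H : E 3 → ℝ → ℝ := fun y s => 2 * τ + 2 / τ ^ 5 * (s ^ 6 * gsq v (s ^ 2 • y) ^ 3) with hH
  have cH : Continuous (Function.uncurry H) := by
    simp only [hH, Function.uncurry_def]
    fun_prop
  have hpt : ∀ y ∈ ball (0 : E 3) 1, v 0 ≤ v y + ∫ s in (0 : ℝ)..1, H y s := by
    intro y hy
    rw [mem_ball_zero_iff] at hy
    have hd : ∀ s : ℝ, HasDerivAt (fun s : ℝ => v (s ^ 2 • y))
        (fderiv ℝ v (s ^ 2 • y) ((2 * s) • y)) s := fun s => by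
      have h1 : HasDerivAt (fun s : ℝ => s ^ 2 • y) ((2 * s) • y) s := by
        have := (hasDerivAt_pow 2 s).smul_const y
        simpa using this
      exact (hv.differentiable (by norm_num) _).hasFDerivAt.comp_hasDerivAt s h1
    have cd : Continuous fun s : ℝ => fderiv ℝ v (s ^ 2 • y) ((2 * s) • y) := by
      have cf := hv.continuous_fderiv (by norm_num)
      fun_prop
    have ftc := intervalIntegral.integral_eq_sub_of_hasDerivAt (fun s _ => hd s)
      (cd.intervalIntegrable 0 1)
    have hle : ∫ s in (0 : ℝ)..1, -(fderiv ℝ v (s ^ 2 • y) ((2 * s) • y)) ≤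
        ∫ s in (0 : ℝ)..1, H y s := by
      refine intervalIntegral.integral_mono_on zero_le_one (cd.neg.intervalIntegrable _ _)
        ((cH.comp (by fun_prop : Continuous fun s : ℝ => (y, s))).intervalIntegrable _ _) ?_
      intro s hs
      set p := s * ‖fderiv ℝ v (s ^ 2 • y)‖ with hp
      have hp0 : 0 ≤ p := mul_nonneg hs.1 (norm_nonneg _)
      have h1 : -(fderiv ℝ v (s ^ 2 • y) ((2 * s) • y)) ≤ 2 * p := by
        calc _ ≤ ‖fderiv ℝ v (s ^ 2 • y) ((2 * s) • y)‖ := neg_le_abs _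
          _ ≤ ‖fderiv ℝ v (s ^ 2 • y)‖ * ‖(2 * s) • y‖ := ContinuousLinearMap.le_opNorm _ _
          _ ≤ ‖fderiv ℝ v (s ^ 2 • y)‖ * (2 * s * 1) := by
              rw [norm_smul, Real.norm_of_nonneg (by linarith [hs.1])]
              gcongr
              linarith [hs.1]
          _ = 2 * p := by rw [hp]; ring
      have h2 : p ≤ τ + p ^ 6 / τ ^ 5 := by
        rcases le_total p τ with h | h
        · have : 0 ≤ p ^ 6 / τ ^ 5 := by positivity
          linarith
        · have : p ≤ p ^ 6 / τ ^ 5 := by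
            rw [le_div_iff₀ (by positivity), pow_succ' p 5]
            gcongr
          linarith
      have h3 : p ^ 6 = s ^ 6 * gsq v (s ^ 2 • y) ^ 3 := by
        rw [hp, mul_pow, show gsq v (s ^ 2 • y) = ‖fderiv ℝ v (s ^ 2 • y)‖ ^ 2 from
          (norm_fderiv_sq v _).symm, ← pow_mul]
      simp only [hH]
      rw [← h3]
      calc _ ≤ 2 * p := h1
        _ ≤ 2 * (τ + p ^ 6 / τ ^ 5) := by gcongr
        _ = _ := by ring
    rw [intervalIntegral.integral_neg, ftc] at hle
    simp only [one_pow, one_smul, ne_eq, OfNat.ofNat_ne_zero, not_false_eq_true, zero_pow,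
      zero_smul] at hle
    linarith
  have cI : Continuous fun y => ∫ s in (0 : ℝ)..1, H y s :=
    intervalIntegral.continuous_parametric_intervalIntegral_of_continuous' cH 0 1
  have h1 : volume.real (ball (0 : E 3) 1) * v 0 ≤
      (∫ x in ball (0 : E 3) 1, v x) + ∫ x in ball (0 : E 3) 1, ∫ s in (0 : ℝ)..1, H x s := by
    rw [← integral_add (integrableOn_ball cv 1) (integrableOn_ball cI 1), ← smul_eq_mul,
      ← setIntegral_const]
    exact setIntegral_mono_on (integrableOn_ball continuous_const 1)
      (integrableOn_ball (cv.add cI) 1) measurableSet_ball hpt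
  have iH : Integrable (Function.uncurry H)
      ((volume.restrict (ball (0 : E 3) 1)).prod (volume.restrict (Ioc (0 : ℝ) 1))) := by
    rw [Measure.prod_restrict]
    exact (cH.continuousOn.integrableOn_compact (μ := volume.prod volume)
      ((isCompact_closedBall (0 : E 3) 1).prod (isCompact_Icc (a := (0 : ℝ)) (b := 1)))).mono_set
      (prod_mono ball_subset_closedBall Ioc_subset_Icc_self)
  have h2 : ∫ x in ball (0 : E 3) 1, ∫ s in (0 : ℝ)..1, H x s =
      ∫ s in (0 : ℝ)..1, ∫ x in ball (0 : E 3) 1, H x s := by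
    simp only [intervalIntegral.integral_of_le zero_le_one]
    exact integral_integral_swap iH
  have h3 : ∀ s ∈ Icc (0 : ℝ) 1, ∫ x in ball (0 : E 3) 1, H x s ≤
      2 * τ * volume.real (ball (0 : E 3) 1)
      + 2 / τ ^ 5 * ∫ x in ball (0 : E 3) 1, gsq v x ^ 3 := by
    intro s hs
    simp only [hH]
    have hG : 0 ≤ ∫ x in ball (0 : E 3) 1, gsq v x ^ 3 :=
      setIntegral_nonneg measurableSet_ball fun x _ => pow_nonneg (gsq_nonneg v x) 3
    rw [integral_add (integrableOn_ball continuous_const 1) (integrableOn_ball (by fun_prop) 1),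
      setIntegral_const, integral_const_mul, integral_const_mul, smul_eq_mul,
      mul_comm (volume.real _)]
    gcongr
    rcases hs.1.eq_or_lt with rfl | h0
    · simpa using hG
    · have := setIntegral_unitBall_comp_smul_le (F := fun x => gsq v x ^ 3) (by fun_prop)
        (fun x => pow_nonneg (gsq_nonneg v x) 3) (t := s ^ 2) (by positivity)
        (pow_le_one₀ hs.1 hs.2)
      rwa [← pow_mul] at this
  have iJ : IntervalIntegrable (fun s : ℝ => ∫ x in ball (0 : E 3) 1, H x s) volume 0 1 :=
    (intervalIntegrable_iff_integrableOn_Ioc_of_le zero_le_one).2 iH.integral_prod_right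
  have h4 := intervalIntegral.integral_mono_on zero_le_one iJ
    intervalIntegrable_const h3
  rw [intervalIntegral.integral_const, sub_zero, one_smul] at h4
  linarith

/-- If `u` is bounded away from the wells at the origin, the energy near it is not small. -/
lemma exists_le_defect_add_energy_two {θ : ℝ} (hθ0 : 0 ≤ θ) (hθ1 : θ < 1) :
    ∃ c > 0, ∀ u : E 3 → ℝ, ContDiff ℝ 2 u → HasCompactSupport u → |u 0| ≤ θ →
      c ≤ defect u 2 + energy u 2 := by
  obtain ⟨C, hC, hcube⟩ := exists_integral_gsq_cube_le
  set ω := volume.real (ball (0 : E 3) 1) with hω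
  have hω0 : 0 < ω := ENNReal.toReal_pos (measure_ball_pos _ _ one_pos).ne' measure_ball_lt_top.ne
  set τ := (1 / (1 + θ ^ 2) - 1 / 2) / 6 with hτ
  have hθ2 : θ ^ 2 < 1 := by nlinarith
  have hτ0 : 0 < τ := by
    have : 1 / 2 < 1 / (1 + θ ^ 2) := by gcongr; linarith
    rw [hτ]; linarith
  set B := 1 / (4 * τ) + 2 / τ ^ 5 * C with hB
  have hB0 : 0 < B := by positivity
  refine ⟨min 1 (3 * τ * ω / B), by positivity, fun u hu huc h0 => ?_⟩
  by_contra! hlt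
  obtain ⟨hT1, hT2⟩ := lt_min_iff.1 hlt
  set T := defect u 2 + energy u 2 with hT
  have hd := defect_nonneg u 2
  have he := energy_nonneg u 2
  have hT0 : 0 ≤ T := add_nonneg hd he
  have hΨ : ∀ t : ℝ, HasDerivAt (fun t : ℝ => 1 / (1 + t ^ 2) - 1 / 2)
      (-(2 * t) / (1 + t ^ 2) ^ 2) t := fun t => by
    have h1 : HasDerivAt (fun t : ℝ => 1 + t ^ 2) (2 * t) t := by
      simpa using (hasDerivAt_pow 2 t).const_add 1
    simpa [one_div] using (h1.fun_inv (by positivity)).sub_const (1 / 2)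
  have hu1 : ContDiff ℝ 1 u := hu.of_le (by norm_num)
  have hv : ContDiff ℝ 1 fun x => 1 / (1 + u x ^ 2) - 1 / 2 := by
    refine ContDiff.sub (contDiff_const.div (contDiff_const.add (hu1.pow 2)) fun x => ?_)
      contDiff_const
    positivity
  have cg := continuous_gsq hu1
  have cgv := continuous_gsq hv
  have hg : ∀ x, gsq (fun x => 1 / (1 + u x ^ 2) - 1 / 2) x ≤ gsq u x := fun x => by
    refine Finset.sum_le_sum fun i _ => ?_
    rw [pd_comp (hΨ (u x)) (hu1.differentiable (by norm_num) x), mul_pow]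
    refine mul_le_of_le_one_left (sq_nonneg _) ?_
    rw [div_pow, div_le_one (by positivity)]
    nlinarith [sq_nonneg (u x), sq_nonneg (u x ^ 2), sq_nonneg (u x ^ 3), sq_nonneg (u x ^ 4)]
  have h1 := volume_mul_le_integral hv hτ0
  have h2 : ∫ x in ball (0 : E 3) 1, gsq (fun x => 1 / (1 + u x ^ 2) - 1 / 2) x ^ 3 ≤ C * T ^ 3 :=
    (setIntegral_mono_on (integrableOn_ball (by fun_prop) 1) (integrableOn_ball (by fun_prop) 1)
      measurableSet_ball fun x _ => pow_le_pow_left₀ (gsq_nonneg _ x) (hg x) 3).trans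
      (hcube u hu huc)
  have h3 : ∫ x in ball (0 : E 3) 1, (1 / (1 + u x ^ 2) - 1 / 2) ≤ τ * ω + 1 / (4 * τ) * T := by
    have ce := continuous_en hu
    calc ∫ x in ball (0 : E 3) 1, (1 / (1 + u x ^ 2) - 1 / 2)
        ≤ ∫ x in ball (0 : E 3) 1, (τ + 1 / (4 * τ) * en u x) := by
          refine setIntegral_mono_on (integrableOn_ball hv.continuous 1)
            (integrableOn_ball (by fun_prop) 1) measurableSet_ball fun x _ => ?_
          have hW : (1 / (1 + u x ^ 2) - 1 / 2) ^ 2 ≤ W (u x) := by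
            have : 1 / (1 + u x ^ 2) - 1 / 2 = (1 - u x ^ 2) / 2 / (1 + u x ^ 2) := by
              field_simp; ring
            rw [this, div_pow, W, show ((1 - u x ^ 2) / 2) ^ 2 = (u x ^ 2 - 1) ^ 2 / 4 by ring]
            exact div_le_self (by positivity) (one_le_pow₀ (by nlinarith [sq_nonneg (u x)]))
          have hW2 := hW.trans (W_le_en u x)
          set p := 1 / (1 + u x ^ 2) - 1 / 2
          have : p ≤ τ + 1 / (4 * τ) * p ^ 2 := by
            have : τ + 1 / (4 * τ) * p ^ 2 - p = (p - 2 * τ) ^ 2 / (4 * τ) := by field_simp; ring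
            have : 0 ≤ (p - 2 * τ) ^ 2 / (4 * τ) := by positivity
            linarith
          refine this.trans ?_
          gcongr
      _ = τ * ω + 1 / (4 * τ) * energy u 1 := by
          rw [integral_add (integrableOn_ball continuous_const 1) (integrableOn_ball (by fun_prop) 1),
            setIntegral_const, integral_const_mul, smul_eq_mul, mul_comm τ]
          rfl
      _ ≤ _ := by
          gcongr
          have := energy_mono hu (show (1 : ℝ) ≤ 2 by norm_num)
          linarith
  have h4 : 6 * τ ≤ 1 / (1 + u 0 ^ 2) - 1 / 2 := by
    have : u 0 ^ 2 ≤ θ ^ 2 := sq_le_sq' (by linarith [(abs_le.1 h0).1]) (abs_le.1 h0).2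
    have : 1 / (1 + θ ^ 2) ≤ 1 / (1 + u 0 ^ 2) := by gcongr
    rw [hτ]; linarith
  have h5 : T ^ 3 ≤ T := by
    calc T ^ 3 = T * (T * T) := by ring
      _ ≤ T * 1 := by gcongr; nlinarith
      _ = T := mul_one T
  have h6 : 2 / τ ^ 5 * (C * T ^ 3) ≤ 2 / τ ^ 5 * C * T := by
    rw [← mul_assoc]; gcongr
  have h7 := mul_le_mul_of_nonneg_left h4 hω0.le
  have h8 := mul_le_mul_of_nonneg_left h2 (show 0 ≤ 2 / τ ^ 5 by positivity)
  rw [lt_div_iff₀ hB0, hB] at hT2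
  linarith

/-- The scaled energy on large balls is bounded below. -/
lemma exists_le_defect_add_energy {θ : ℝ} (hθ0 : 0 ≤ θ) (hθ1 : θ < 1) :
    ∃ c > 0, ∃ k₀ : ℕ, ∀ u : E 3 → ℝ, ContDiff ℝ 2 u → HasCompactSupport u → |u 0| ≤ θ →
      ∀ K, k₀ ≤ K → c ≤ defect u (256 ^ K) + energy u (256 ^ K) / (256 ^ K) ^ 2 := by
  obtain ⟨c, hc, hloc⟩ := exists_le_defect_add_energy_two hθ0 hθ1
  obtain ⟨k₀, hk₀, M, hM, δ, hδ, hen⟩ := exists_energy_le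
  refine ⟨min δ (c / (M + 1)), by positivity, k₀, fun u hu huc h0 K hK => ?_⟩
  by_contra! hlt
  obtain ⟨h1, h2⟩ := lt_min_iff.1 hlt
  have h3 := hen u hu huc K hK h1.le
  have h4 := hloc u hu huc h0
  have hle : (2 : ℝ) ≤ 256 ^ k₀ :=
    le_trans (by norm_num) (pow_le_pow_right₀ (by norm_num : (1 : ℝ) ≤ 256) hk₀)
  have h5 := energy_mono hu hle
  have h6 := defect_mono hu (hle.trans (pow_le_pow_right₀ (by norm_num : (1 : ℝ) ≤ 256) hK))
  have h7 : 0 ≤ energy u (256 ^ K) / (256 ^ K) ^ 2 :=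
    div_nonneg (energy_nonneg _ _) (by positivity)
  rw [lt_div_iff₀ (by positivity)] at h2
  linarith

end LocalEstimate

section Reduction

variable {m n : ℕ} {u v : E n → ℝ}

lemma fderiv_comp_clm_apply (A : E m →L[ℝ] E n) {y : E m} (hu : DifferentiableAt ℝ u (A y))
    (w : E m) : fderiv ℝ (fun z => u (A z)) y w = fderiv ℝ u (A y) (A w) := by
  have h := (hu.hasFDerivAt.comp y A.hasFDerivAt).fderiv
  exact congrArg (fun L : E m →L[ℝ] ℝ => L w) h

lemma fderiv_fderiv_comp_clm_apply (A : E m →L[ℝ] E n) {y : E m} (hu : ContDiffAt ℝ 2 u (A y))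
    (w z : E m) : fderiv ℝ (fderiv ℝ fun z => u (A z)) y w z
      = fderiv ℝ (fderiv ℝ u) (A y) (A w) (A z) := by
  have he : (fderiv ℝ fun z => u (A z)) =ᶠ[nhds y]
      fun p => ((ContinuousLinearMap.compL ℝ (E m) (E n) ℝ).flip A) (fderiv ℝ u (A p)) := by
    filter_upwards [A.continuous.continuousAt.eventually (hu.eventually (by simp))] with p hp
    ext q
    exact fderiv_comp_clm_apply A (hp.differentiableAt (by simp)) q
  have hd : DifferentiableAt ℝ (fderiv ℝ u) (A y) :=
    (hu.fderiv_right (m := 1) (by norm_num)).differentiableAt (by simp)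
  have h := ((((ContinuousLinearMap.compL ℝ (E m) (E n) ℝ).flip A).hasFDerivAt).comp y
    (hd.hasFDerivAt.comp y A.hasFDerivAt)).fderiv
  rw [he.fderiv_eq]
  exact congrArg (fun L : E m →L[ℝ] E m →L[ℝ] ℝ => L w z) h

lemma areaDensity_eq (ev : ℝ) (u : E n → ℝ) (x : E n) :
    areaDensity ev u x = ev / 2 * gsq u x + (1 / ev) * W (u x) := by
  rw [areaDensity, norm_fderiv_sq, gsq]

lemma areaDensity_nonneg {ev : ℝ} (hev : 0 < ev) (u : E n → ℝ) (x : E n) :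
    0 ≤ areaDensity ev u x := by
  have := W_nonneg (u x)
  unfold areaDensity
  positivity

lemma willDensity_nonneg (ev : ℝ) (u : E n → ℝ) (x : E n) : 0 ≤ willDensity ev u x :=
  sq_nonneg _

lemma Filter.EventuallyEq.areaDensity_eq {x : E n} (h : u =ᶠ[nhds x] v) (ev : ℝ) :
    areaDensity ev u x = areaDensity ev v x := by
  simp only [areaDensity, h.fderiv_eq, h.self_of_nhds]

lemma Filter.EventuallyEq.willDensity_eq {x : E n} (h : u =ᶠ[nhds x] v) (ev : ℝ) :
    willDensity ev u x = willDensity ev v x := by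
  simp only [willDensity, lap, h.fderiv.fderiv_eq, h.self_of_nhds]

lemma en_comp_smul (hu : ContDiff ℝ 2 u) {ev : ℝ} (hev : 0 < ev) (y : E n) :
    en (fun z => u (ev • z)) y = ev * areaDensity ev u (ev • y) := by
  have h : ∀ i, pd i (fun z => u (ev • z)) y = ev * pd i u (ev • y) := fun i => by
    have := fderiv_comp_clm_apply (ev • ContinuousLinearMap.id ℝ (E n)) (y := y)
      (hu.differentiable (by simp) _) (EuclideanSpace.single i 1)
    simpa [pd] using this
  simp only [en, _root_.areaDensity_eq, gsq, h, mul_pow, ← Finset.mul_sum]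
  field_simp

lemma chem_sq_comp_smul (hu : ContDiff ℝ 2 u) {ev : ℝ} (hev : 0 < ev) (y : E n) :
    chem (fun z => u (ev • z)) y ^ 2 = ev ^ 2 * willDensity ev u (ev • y) := by
  have h : lap (fun z => u (ev • z)) y = ev ^ 2 * lap u (ev • y) := by
    simp only [lap, Finset.mul_sum]
    refine Finset.sum_congr rfl fun i _ => ?_
    have := fderiv_fderiv_comp_clm_apply (ev • ContinuousLinearMap.id ℝ (E n)) (y := y)
      hu.contDiffAt (EuclideanSpace.single i 1) (EuclideanSpace.single i 1)
    rw [sq, mul_assoc]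
    simpa using this
  simp only [chem, willDensity, h]
  field_simp
  ring

lemma integral_ball_comp_smul (F : E n → ℝ) {ev : ℝ} (hev : 0 < ev) (r : ℝ) :
    ∫ y in ball (0 : E n) r, F (ev • y) = (ev ^ n)⁻¹ * ∫ x in ball (0 : E n) (ev * r), F x := by
  rw [Measure.setIntegral_comp_smul_of_pos _ _ _ hev, _root_.smul_ball hev.ne']
  simp [abs_of_pos hev]

lemma energy_comp_smul {u : E 3 → ℝ} (hu : ContDiff ℝ 2 u) {ev : ℝ} (hev : 0 < ev) (r : ℝ) :
    energy (fun z => u (ev • z)) r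
      = (ev ^ 2)⁻¹ * ∫ x in ball (0 : E 3) (ev * r), areaDensity ev u x := by
  simp only [energy, en_comp_smul hu hev]
  rw [integral_const_mul, integral_ball_comp_smul _ hev]
  field_simp

lemma defect_comp_smul {u : E 3 → ℝ} (hu : ContDiff ℝ 2 u) {ev : ℝ} (hev : 0 < ev) (r : ℝ) :
    defect (fun z => u (ev • z)) r
      = ev⁻¹ * ∫ x in ball (0 : E 3) (ev * r), willDensity ev u x := by
  simp only [defect, chem_sq_comp_smul hu hev]
  rw [integral_const_mul, integral_ball_comp_smul _ hev]
  field_simp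

lemma ContDiffOn.fderiv_extends (hu : ContDiffOn ℝ 2 u (closedBall (0 : E n) 1)) :
    ∃ (D : E n → E n →L[ℝ] ℝ) (H : E n → E n →L[ℝ] E n →L[ℝ] ℝ),
      ContinuousOn D (closedBall 0 1) ∧ ContinuousOn H (closedBall 0 1) ∧
      EqOn (fderiv ℝ u) D (ball 0 1) ∧ EqOn (fderiv ℝ (fderiv ℝ u)) H (ball 0 1) := by
  set s := closedBall (0 : E n) 1
  have hs : UniqueDiffOn ℝ s := uniqueDiffOn_convex (convex_closedBall _ _)
    ⟨0, mem_interior_iff_mem_nhds.2 (closedBall_mem_nhds _ one_pos)⟩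
  have hn : ∀ x ∈ ball (0 : E n) 1, s ∈ nhds x := fun x hx =>
    mem_of_superset (isOpen_ball.mem_nhds hx) ball_subset_closedBall
  have h1 : ContDiffOn ℝ 1 (fderivWithin ℝ u s) s := hu.fderivWithin hs (by norm_num)
  refine ⟨fderivWithin ℝ u s, fderivWithin ℝ (fderivWithin ℝ u s) s, h1.continuousOn,
    h1.continuousOn_fderivWithin hs (by simp), fun x hx => (fderivWithin_of_mem_nhds (hn x hx)).symm,
    fun x hx => ?_⟩
  rw [fderivWithin_of_mem_nhds (hn x hx)]
  refine Filter.EventuallyEq.fderiv_eq ?_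
  filter_upwards [isOpen_ball.mem_nhds hx] with y hy
  exact (fderivWithin_of_mem_nhds (hn y hy)).symm

lemma ContinuousOn.integrableOn_ball_of_eqOn {F G : E n → ℝ}
    (hG : ContinuousOn G (closedBall 0 1)) (h : EqOn F G (ball 0 1)) :
    IntegrableOn F (ball (0 : E n) 1) :=
  ((hG.integrableOn_compact (isCompact_closedBall _ _)).mono_set
    ball_subset_closedBall).congr_fun h.symm measurableSet_ball

lemma ContDiffOn.integrableOn_areaDensity (hu : ContDiffOn ℝ 2 u (closedBall (0 : E n) 1))
    (ev : ℝ) : IntegrableOn (areaDensity ev u) (ball (0 : E n) 1) := by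
  obtain ⟨D, H, hD, -, hDe, -⟩ := hu.fderiv_extends
  have hc := hu.continuousOn
  have hW : Continuous W := (contDiff_W (k := 0)).continuous
  have hWu := hW.comp_continuousOn hc
  refine ContinuousOn.integrableOn_ball_of_eqOn
    (G := fun x => ev / 2 * ‖D x‖ ^ 2 + (1 / ev) * W (u x)) ?_ fun x hx => ?_
  · exact (continuousOn_const.mul (hD.norm.pow 2)).add (continuousOn_const.mul hWu)
  · simp only [areaDensity, hDe hx]

lemma ContDiffOn.integrableOn_willDensity (hu : ContDiffOn ℝ 2 u (closedBall (0 : E n) 1))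
    (ev : ℝ) : IntegrableOn (willDensity ev u) (ball (0 : E n) 1) := by
  obtain ⟨D, H, -, hH, -, hHe⟩ := hu.fderiv_extends
  have hc := hu.continuousOn
  have hW : Continuous W' := (contDiff_W' (k := 0)).continuous
  have hWu := hW.comp_continuousOn hc
  refine ContinuousOn.integrableOn_ball_of_eqOn
    (G := fun x => (ev * ∑ i, H x (EuclideanSpace.single i 1) (EuclideanSpace.single i 1)
      - (1 / ev) * W' (u x)) ^ 2) ?_ fun x hx => ?_
  · refine ContinuousOn.pow (ContinuousOn.sub (continuousOn_const.mul
      (continuousOn_finsetSum _ fun i _ => ?_)) (continuousOn_const.mul hWu)) 2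
    exact (hH.clm_apply continuousOn_const).clm_apply continuousOn_const
  · simp only [willDensity, lap, hHe hx]

/-- A `C²` function on the closed unit ball coincides on the half ball with a compactly supported
`C²` function. -/
lemma ContDiffOn.exists_contDiff_hasCompactSupport_eqOn
    (hu : ContDiffOn ℝ 2 u (closedBall (0 : E n) 1)) :
    ∃ v : E n → ℝ, ContDiff ℝ 2 v ∧ HasCompactSupport v ∧ EqOn v u (ball 0 (1 / 2)) := by
  let f : ContDiffBump (0 : E n) := ⟨1 / 2, 3 / 4, by norm_num, by norm_num⟩
  refine ⟨fun x => f x * u x, contDiff_iff_contDiffAt.2 fun x => ?_,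
    f.hasCompactSupport.mul_right, fun x hx => ?_⟩
  · by_cases hx : x ∈ ball (0 : E n) 1
    · exact f.contDiff.contDiffAt.mul (hu.contDiffAt
        (mem_of_superset (isOpen_ball.mem_nhds hx) ball_subset_closedBall))
    · have hx' : x ∉ tsupport f := by
        rw [f.tsupport_eq]
        intro h
        have : ‖x‖ ≤ 3 / 4 := by simpa using h
        exact hx (by simp; linarith)
      have he : (fun x => f x * u x) =ᶠ[nhds x] fun _ => 0 := by
        filter_upwards [(isClosed_tsupport f).isOpen_compl.mem_nhds hx'] with y hy
        simp [image_eq_zero_of_notMem_tsupport hy]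
      exact contDiffAt_const.congr_of_eventuallyEq he
  · have : f x = 1 := f.one_of_mem_closedBall (ball_subset_closedBall hx)
    simp [this]

lemma c0_pos : 0 < c0 := by unfold c0; positivity

lemma exists_le_We_add_Se_three {θ : ℝ} (hθ0 : 0 ≤ θ) (hθ1 : θ < 1) :
    ∃ c > 0, ∃ ε0 > 0, ∀ ε : ℝ, 0 < ε → ε < ε0 → ∀ u : E 3 → ℝ,
      ContDiffOn ℝ 2 u (closedBall (0 : E 3) 1) → |u 0| ≤ θ →
        c ≤ We ε (ball (0 : E 3) 1) u + Se ε (ball (0 : E 3) 1) u := by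
  obtain ⟨c, hc, k₀, h⟩ := exists_le_defect_add_energy hθ0 hθ1
  have hc0 := c0_pos
  refine ⟨c / (512 ^ 2 * c0), by positivity, 1 / (2 * 256 ^ k₀), by positivity,
    fun ε hε hε0 u hu hu0 => ?_⟩
  have hx : 1 * (256 : ℝ) ^ k₀ < 1 / (2 * ε) := by
    rw [lt_div_iff₀ (by positivity)] at hε0 ⊢
    linarith
  obtain ⟨K, hK1, hK2⟩ := exists_nat_pow_near (x := 1 / (2 * ε)) (y := (256 : ℝ))
    (by have : (1 : ℝ) ≤ 256 ^ k₀ := one_le_pow₀ (by norm_num)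
        linarith) (by norm_num)
  have hkK : k₀ ≤ K := by
    have := (pow_lt_pow_iff_right₀ (a := (256 : ℝ)) (by norm_num)).1
      ((by linarith : (256 : ℝ) ^ k₀ < 1 / (2 * ε)).trans hK2)
    omega
  set r : ℝ := 256 ^ K with hr
  have hr0 : 0 < r := by positivity
  have hρ1 : ε * r ≤ 1 / 2 := by
    rw [le_div_iff₀ (by positivity)] at hK1
    linarith
  have hρ2 : 1 / 512 ≤ ε * r := by
    rw [pow_succ, div_lt_iff₀ (by positivity)] at hK2
    linarith
  obtain ⟨v, hv, hvc, hvu⟩ := hu.exists_contDiff_hasCompactSupport_eqOn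
  have hsub : ball (0 : E 3) (ε * r) ⊆ ball 0 (1 / 2) := ball_subset_ball hρ1
  have hsub' : ball (0 : E 3) (ε * r) ⊆ ball 0 1 := ball_subset_ball (by linarith)
  have hloc : ∀ x ∈ ball (0 : E 3) (ε * r), v =ᶠ[nhds x] u := fun x hx =>
    eventually_of_mem (isOpen_ball.mem_nhds (hsub hx)) hvu
  have hA : ∫ x in ball (0 : E 3) (ε * r), areaDensity ε v x
      ≤ ∫ x in ball (0 : E 3) 1, areaDensity ε u x := by
    rw [setIntegral_congr_fun measurableSet_ball fun x hx => (hloc x hx).areaDensity_eq ε]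
    exact setIntegral_mono_set (hu.integrableOn_areaDensity ε)
      (ae_of_all _ fun x => areaDensity_nonneg hε u x) hsub'.eventuallyLE
  have hB : ∫ x in ball (0 : E 3) (ε * r), willDensity ε v x
      ≤ ∫ x in ball (0 : E 3) 1, willDensity ε u x := by
    rw [setIntegral_congr_fun measurableSet_ball fun x hx => (hloc x hx).willDensity_eq ε]
    exact setIntegral_mono_set (hu.integrableOn_willDensity ε)
      (ae_of_all _ fun x => willDensity_nonneg ε u x) hsub'.eventuallyLE
  have hmain := h (fun z => v (ε • z)) (hv.comp (contDiff_const_smul ε))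
    (hvc.comp_smul hε.ne') (by simpa [hvu (mem_ball_self (by norm_num : (0:ℝ) < 1/2))] using hu0)
    K hkK
  rw [← hr, defect_comp_smul hv hε, energy_comp_smul hv hε] at hmain
  set a := ∫ x in ball (0 : E 3) 1, areaDensity ε u x with ha
  set w := ∫ x in ball (0 : E 3) 1, willDensity ε u x with hw
  have ha0 : 0 ≤ a := integral_nonneg fun x => areaDensity_nonneg hε u x
  have hw0 : 0 ≤ w := integral_nonneg fun x => willDensity_nonneg ε u x
  have e1 : (ε ^ 2)⁻¹ * (∫ x in ball (0 : E 3) (ε * r), areaDensity ε v x) / r ^ 2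
      ≤ 512 ^ 2 * a := by
    have : (ε ^ 2)⁻¹ * (∫ x in ball (0 : E 3) (ε * r), areaDensity ε v x) / r ^ 2
        = (∫ x in ball (0 : E 3) (ε * r), areaDensity ε v x) / (ε * r) ^ 2 := by field_simp
    rw [this, div_le_iff₀ (by positivity)]
    have : 1 ≤ 512 ^ 2 * (ε * r) ^ 2 := by nlinarith
    nlinarith
  have e2 : ε⁻¹ * (∫ x in ball (0 : E 3) (ε * r), willDensity ε v x) ≤ 512 ^ 2 * (ε⁻¹ * w) := by
    have := mul_le_mul_of_nonneg_left hB (inv_pos.2 hε).le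
    have : 0 ≤ ε⁻¹ * w := by positivity
    linarith
  have e3 : We ε (ball (0 : E 3) 1) u + Se ε (ball (0 : E 3) 1) u = (ε⁻¹ * w + a) / c0 := by
    rw [We, Se, ← ha, ← hw]
    field_simp
  rw [e3, div_le_div_iff₀ (by positivity) hc0]
  nlinarith

end Reduction

section Cylinder

/-- The projection of `ℝⁿ⁺¹` onto its last `n` coordinates. -/
def dropFirst (n : ℕ) : E (n + 1) →L[ℝ] E n :=
  LinearMap.toContinuousLinearMap
    { toFun := fun x => WithLp.toLp 2 fun j => x j.succ
      map_add' := fun _ _ => rfl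
      map_smul' := fun _ _ => rfl }

variable {n : ℕ} {u : E n → ℝ}

lemma dropFirst_apply (x : E (n + 1)) (j : Fin n) : dropFirst n x j = x j.succ := rfl

lemma dropFirst_single_zero : dropFirst n (EuclideanSpace.single 0 1) = 0 := by
  ext j
  simp [dropFirst_apply]

lemma dropFirst_single_succ (j : Fin n) :
    dropFirst n (EuclideanSpace.single j.succ 1) = EuclideanSpace.single j 1 := by
  ext i
  simp [dropFirst_apply]

lemma norm_sq_eq_add_norm_dropFirst_sq (x : E (n + 1)) :
    ‖x‖ ^ 2 = x 0 ^ 2 + ‖dropFirst n x‖ ^ 2 := by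
  simp only [EuclideanSpace.real_norm_sq_eq, Fin.sum_univ_succ, dropFirst_apply]

lemma norm_dropFirst_le (x : E (n + 1)) : ‖dropFirst n x‖ ≤ ‖x‖ := by
  nlinarith [norm_sq_eq_add_norm_dropFirst_sq x, sq_nonneg (x 0), norm_nonneg x,
    norm_nonneg (dropFirst n x)]

lemma abs_apply_zero_le_norm (x : E (n + 1)) : |x 0| ≤ ‖x‖ := by
  refine abs_le_of_sq_le_sq ?_ (norm_nonneg x)
  nlinarith [norm_sq_eq_add_norm_dropFirst_sq x]

lemma areaDensity_comp_dropFirst (ev : ℝ) {x : E (n + 1)}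
    (hu : DifferentiableAt ℝ u (dropFirst n x)) :
    areaDensity ev (fun y => u (dropFirst n y)) x = areaDensity ev u (dropFirst n x) := by
  simp only [areaDensity_eq, gsq, pd, fderiv_comp_clm_apply _ hu, Fin.sum_univ_succ,
    dropFirst_single_zero, dropFirst_single_succ]
  simp

lemma willDensity_comp_dropFirst (ev : ℝ) {x : E (n + 1)}
    (hu : ContDiffAt ℝ 2 u (dropFirst n x)) :
    willDensity ev (fun y => u (dropFirst n y)) x = willDensity ev u (dropFirst n x) := by
  simp only [willDensity, lap, fderiv_fderiv_comp_clm_apply _ hu, Fin.sum_univ_succ,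
    dropFirst_single_zero, dropFirst_single_succ]
  simp

lemma measurePreserving_apply_zero_dropFirst :
    MeasurePreserving (fun x : E (n + 1) => (x 0, dropFirst n x)) := by
  have h1 := volume_preserving_piFinSuccAbove (fun _ : Fin (n + 1) => ℝ) 0
  have h2 := (MeasurePreserving.id (volume : Measure ℝ)).prod (PiLp.volume_preserving_toLp (Fin n))
  exact h2.comp (h1.comp (PiLp.volume_preserving_ofLp (Fin (n + 1))))

lemma setIntegral_comp_dropFirst_le {F : E n → ℝ} (hF : IntegrableOn F (ball 0 1))
    (h0 : ∀ x, 0 ≤ F x) :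
    ∫ x in ball (0 : E (n + 1)) 1, F (dropFirst n x) ≤ 2 * ∫ x in ball (0 : E n) 1, F x := by
  set f : ℝ → ℝ := (Icc (-1) 1).indicator fun _ => 1
  set g : E n → ℝ := (ball 0 1).indicator F
  have hf : Integrable f := (integrable_indicator_iff measurableSet_Icc).2
    (integrableOn_const (by simp))
  have hg : Integrable g := (integrable_indicator_iff measurableSet_ball).2 hF
  have hfg := hf.mul_prod hg
  have hmp := measurePreserving_apply_zero_dropFirst (n := n)
  have hprod : Integrable (fun x : E (n + 1) => f (x 0) * g (dropFirst n x)) :=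
    hmp.integrable_comp_of_integrable hfg
  have heq : ∫ x : E (n + 1), f (x 0) * g (dropFirst n x) = 2 * ∫ x in ball (0 : E n) 1, F x := by
    have h := integral_map (μ := (volume : Measure (E (n + 1)))) hmp.measurable.aemeasurable
      (f := fun p : ℝ × E n => f p.1 * g p.2)
      (by rw [hmp.map_eq]; exact hfg.aestronglyMeasurable)
    rw [← h, hmp.map_eq, Measure.volume_eq_prod, integral_prod_mul,
      integral_indicator measurableSet_Icc, integral_indicator measurableSet_ball]
    norm_num
  rw [← heq, ← integral_indicator measurableSet_ball]
  refine integral_mono_of_nonneg (ae_of_all _ fun x => indicator_nonneg (fun _ _ => h0 _) _)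
    hprod (ae_of_all _ fun x => ?_)
  by_cases hx : x ∈ ball (0 : E (n + 1)) 1
  · have hx1 : ‖x‖ < 1 := by simpa using hx
    have h1 : x 0 ∈ Icc (-1 : ℝ) 1 := abs_le.1 ((abs_apply_zero_le_norm x).trans hx1.le)
    have h2 : dropFirst n x ∈ ball (0 : E n) 1 := by
      simpa using (norm_dropFirst_le x).trans_lt hx1
    simp [f, g, indicator_of_mem hx, indicator_of_mem h1, indicator_of_mem h2]
  · simp only [indicator_of_notMem hx]
    exact mul_nonneg (indicator_nonneg (fun _ _ => zero_le_one) _)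
      (indicator_nonneg (fun _ _ => h0 _) _)

lemma We_add_Se_comp_dropFirst_le (hu : ContDiffOn ℝ 2 u (closedBall (0 : E n) 1)) {ev : ℝ}
    (hev : 0 < ev) :
    We ev (ball (0 : E (n + 1)) 1) (fun y => u (dropFirst n y))
        + Se ev (ball (0 : E (n + 1)) 1) (fun y => u (dropFirst n y))
      ≤ 2 * (We ev (ball (0 : E n) 1) u + Se ev (ball (0 : E n) 1) u) := by
  have hc0 := c0_pos
  have hat : ∀ x ∈ ball (0 : E (n + 1)) 1, ContDiffAt ℝ 2 u (dropFirst n x) := fun x hx =>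
    hu.contDiffAt (mem_of_superset (isOpen_ball.mem_nhds (by
      simpa using (norm_dropFirst_le x).trans_lt (by simpa using hx : ‖x‖ < 1)))
      ball_subset_closedBall)
  have hA := setIntegral_comp_dropFirst_le (hu.integrableOn_areaDensity ev)
    (areaDensity_nonneg hev u)
  have hB := setIntegral_comp_dropFirst_le (hu.integrableOn_willDensity ev)
    (willDensity_nonneg ev u)
  rw [← setIntegral_congr_fun measurableSet_ball fun x hx =>
    areaDensity_comp_dropFirst ev ((hat x hx).differentiableAt (by simp))] at hA
  rw [← setIntegral_congr_fun measurableSet_ball fun x hx =>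
    willDensity_comp_dropFirst ev (hat x hx)] at hB
  have hA' := mul_le_mul_of_nonneg_left hA (by positivity : 0 ≤ 1 / c0)
  have hB' := mul_le_mul_of_nonneg_left hB (by positivity : 0 ≤ 1 / (c0 * ev))
  unfold We Se
  linarith

end Cylinder

theorem stmt10 (n : ℕ) (hn : n = 2 ∨ n = 3) (θ : ℝ) (hθ0 : 0 ≤ θ) (hθ1 : θ < 1) :
    ∃ c > 0, ∃ ε0 > 0, ∀ ε : ℝ, 0 < ε → ε < ε0 →
      ∀ u : E n → ℝ, ContDiffOn ℝ 2 u (closure (ball (0 : E n) 1)) → |u 0| ≤ θ →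
        c ≤ We ε (ball (0 : E n) 1) u + Se ε (ball (0 : E n) 1) u := by
  rw [closure_ball _ one_ne_zero]
  obtain ⟨c, hc, ε0, hε0, h⟩ := exists_le_We_add_Se_three hθ0 hθ1
  rcases hn with rfl | rfl
  · refine ⟨c / 2, by positivity, ε0, hε0, fun ε hε hεε0 u hu hu0 => ?_⟩
    have hcomp : ContDiffOn ℝ 2 (fun y => u (dropFirst 2 y)) (closedBall (0 : E 3) 1) :=
      hu.comp (dropFirst 2).contDiff.contDiffOn fun x hx => by
        simpa using (norm_dropFirst_le x).trans (by simpa using hx : ‖x‖ ≤ 1)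
    have h3 := h ε hε hεε0 _ hcomp (by simpa using hu0)
    linarith [We_add_Se_comp_dropFirst_le hu hε]
  · exact ⟨c, hc, ε0, hε0, h⟩

end
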